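/- arXiv:2405.05222 — 3 statements merged into one kernel-verified Lean document; each statement's English description precedes it below -/
import Mathlib

section
/- Every biconnected graph with at least three vertices admits a CSP-decomposition. -/
open scoped Classical

/-- A finite simple graph with vertex set a `Finset ℕ`, edges given as a finite set of
unordered pairs, and no loops. -/
structure FinGraph where
  verts : Finset ℕ
  edges : Finset (Sym2 ℕ)
  edge_mem : ∀ e ∈ edges, ∀ v ∈ e, v ∈ verts
  no_loops : ∀ e ∈ edges, ¬ e.IsDiag

namespace FinGraph

/-- Degree of `v` in `G`. -/
def deg (G : FinGraph) (v : ℕ) : ℕ := (G.edges.filter fun e => v ∈ e).card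

/-- Adjacency in `G`. -/
def adj (G : FinGraph) (u v : ℕ) : Prop := s(u, v) ∈ G.edges

/-- `G` is connected. -/
def Connected (G : FinGraph) : Prop :=
  G.verts.Nonempty ∧ ∀ u ∈ G.verts, ∀ v ∈ G.verts, Relation.ReflTransGen G.adj u v

/-- The subgraph of `G` induced by `X`. -/
noncomputable def induce (G : FinGraph) (X : Finset ℕ) : FinGraph where
  verts := G.verts ∩ X
  edges := G.edges.filter fun e => ∀ v ∈ e, v ∈ X
  edge_mem := fun e he v hv => by
    simp only [Finset.mem_filter] at he
    exact Finset.mem_inter.mpr ⟨G.edge_mem e he.1 v hv, he.2 v hv⟩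
  no_loops := fun e he => by
    simp only [Finset.mem_filter] at he
    exact G.no_loops e he.1

/-- `G` is biconnected: at least two vertices, connected, and it remains connected after the
removal of any vertex. -/
def Biconnected (G : FinGraph) : Prop :=
  2 ≤ G.verts.card ∧ G.Connected ∧ ∀ x ∈ G.verts, (G.induce (G.verts.erase x)).Connected

/-- `H` is a subgraph of `G`. -/
def IsSubgraph (H G : FinGraph) : Prop := H.verts ⊆ G.verts ∧ H.edges ⊆ G.edges

/-- `H` is a cycle: connected and every vertex has degree two. -/
def IsCycleGraph (H : FinGraph) : Prop :=
  H.Connected ∧ ∀ v ∈ H.verts, H.deg v = 2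

/-- `H` is a star with central vertex `v` of degree at least two; every vertex of `H` other
than `v` (a leaf) is incident to an edge of `H`, and all edges contain `v`. -/
def IsStarAt (H : FinGraph) (v : ℕ) : Prop :=
  v ∈ H.verts ∧ 2 ≤ H.deg v ∧ (∀ e ∈ H.edges, v ∈ e) ∧
    ∀ u ∈ H.verts, u ≠ v → ∃ e ∈ H.edges, u ∈ e

/-- `H` is the path `p 0, p 1, …, p ℓ`. -/
def IsPathGraph (H : FinGraph) (ℓ : ℕ) (p : Fin (ℓ + 1) → ℕ) : Prop :=
  Function.Injective p ∧
  H.verts = Finset.univ.image p ∧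
  H.edges = Finset.univ.image fun i : Fin ℓ => s(p i.castSucc, p i.succ)

/-- The union of the vertex sets of the subgraphs `H j` for `j < i`. -/
def prevVerts {r : ℕ} (H : Fin (r + 1) → FinGraph) (i : Fin (r + 1)) : Finset ℕ :=
  (Finset.univ.filter fun j => j < i).biUnion fun j => (H j).verts

/-- A CSP-decomposition of `G`: a sequence `(H₀,…,H_r)` of subgraphs of `G` partitioning the
edges of `G`, with `H₀` a cycle, and each subsequent `Hᵢ` either a star whose set of leaves is
exactly its intersection with the previous subgraphs, or a path of length at least `3` meeting
the previous subgraphs exactly in its two endpoints. -/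
def IsCSPDecomposition (G : FinGraph) (r : ℕ) (H : Fin (r + 1) → FinGraph) : Prop :=
  (∀ i, (H i).IsSubgraph G) ∧
  (∀ i j, i ≠ j → Disjoint (H i).edges (H j).edges) ∧
  (Finset.univ.biUnion fun i => (H i).edges) = G.edges ∧
  IsCycleGraph (H 0) ∧
  ∀ i : Fin (r + 1), i ≠ 0 →
    (∃ v : ℕ, IsStarAt (H i) v ∧ (H i).verts ∩ prevVerts H i = (H i).verts.erase v) ∨
    (∃ ℓ : ℕ, 3 ≤ ℓ ∧ ∃ p : Fin (ℓ + 1) → ℕ, IsPathGraph (H i) ℓ p ∧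
      (H i).verts ∩ prevVerts H i = {p 0, p (Fin.last ℓ)})

end FinGraph

namespace FinGraph

theorem adj.symm {G : FinGraph} {u v : ℕ} (h : G.adj u v) : G.adj v u := by
  unfold adj at *
  rwa [Sym2.eq_swap]

theorem adj.ne {G : FinGraph} {u v : ℕ} (h : G.adj u v) : u ≠ v :=
  fun huv => G.no_loops _ h (by simpa using huv)

theorem adj.left_mem {G : FinGraph} {u v : ℕ} (h : G.adj u v) : u ∈ G.verts :=
  G.edge_mem _ h _ (by simp)

theorem adj_induce {G : FinGraph} {X : Finset ℕ} {u v : ℕ} :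
    (G.induce X).adj u v ↔ G.adj u v ∧ u ∈ X ∧ v ∈ X := by
  simp [adj, induce]

theorem induce_verts_self (G : FinGraph) : G.induce G.verts = G := by
  cases G with
  | mk verts edges edge_mem no_loops =>
    simp only [induce, mk.injEq, Finset.inter_self, true_and]
    exact Finset.filter_true_of_mem edge_mem

/-- An `X`-ear of length `l`: a walk of length `l ≥ 2` in `G` between two distinct vertices
of `X` whose interior avoids `X`. -/
structure IsEar (G : FinGraph) (X : Finset ℕ) (l : ℕ) (p : ℕ → ℕ) : Prop where
  two_le : 2 ≤ l
  first_mem : p 0 ∈ X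
  last_mem : p l ∈ X
  first_ne_last : p 0 ≠ p l
  interior : ∀ i, 0 < i → i < l → p i ∉ X
  step : ∀ i, i < l → G.adj (p i) (p (i + 1))

/-- A walk from outside `X` to `X` contains one that stops as soon as `X` is reached. -/
theorem exists_walk_to_set {r : ℕ → ℕ → Prop} {X : Finset ℕ} {u y : ℕ}
    (h : Relation.ReflTransGen r u y) (hu : u ∉ X) (hy : y ∈ X) :
    ∃ (l : ℕ) (p : ℕ → ℕ), 0 < l ∧ p 0 = u ∧ p l ∈ X ∧ (∀ i < l, p i ∉ X) ∧
      ∀ i < l, r (p i) (p (i + 1)) := by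
  induction h using Relation.ReflTransGen.head_induction_on with
  | refl => exact absurd hy hu
  | @head a c hac hcy ih =>
    by_cases hc : c ∈ X
    · refine ⟨1, fun i => if i = 0 then a else c, by simp, by simp, by simpa, ?_, ?_⟩
      · intro i hi
        obtain rfl : i = 0 := by omega
        simpa
      · intro i hi
        obtain rfl : i = 0 := by omega
        simpa
    · obtain ⟨l, p, hl, h0, hlX, hint, hstep⟩ := ih hc
      refine ⟨l + 1, fun i => if i = 0 then a else p (i - 1), by simp, by simp, by simpa, ?_, ?_⟩
      · rintro (_ | i) hi
        · simpa
        · simpa using hint i (by omega)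
      · rintro (_ | i) hi
        · simpa [h0]
        · simpa using hstep i (by omega)

/-- A proper subset with at least two vertices of a biconnected graph has an ear. -/
theorem Biconnected.exists_isEar {G : FinGraph} (hG : G.Biconnected) {X : Finset ℕ}
    (hX : X ⊂ G.verts) (hcard : 2 ≤ X.card) : ∃ l p, G.IsEar X l p := by
  obtain ⟨-, ⟨-, hconn⟩, hdel⟩ := hG
  obtain ⟨w, hw, hwX⟩ := Finset.exists_of_ssubset hX
  obtain ⟨z, hz⟩ : X.Nonempty := Finset.card_pos.mp (by omega)
  obtain ⟨x, hx, u, huX, hxu⟩ : ∃ x ∈ X, ∃ u, u ∉ X ∧ G.adj x u := by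
    obtain ⟨l, p, hl, -, hlX, hint, hstep⟩ :=
      exists_walk_to_set (hconn w hw z (hX.1 hz)) hwX hz
    refine ⟨p l, hlX, p (l - 1), hint _ (by omega), ?_⟩
    have := hstep (l - 1) (by omega)
    rw [Nat.sub_add_cancel hl] at this
    exact this.symm
  obtain ⟨y, hy, hyx⟩ := Finset.exists_mem_ne (by omega : 1 < X.card) x
  have hux : u ≠ x := fun h => huX (h ▸ hx)
  obtain ⟨l, p, hl, h0, hlX, hint, hstep⟩ := exists_walk_to_set
    ((hdel x (hX.1 hx)).2 u (by simp [induce, hux, hxu.symm.left_mem])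
      y (by simp [induce, hyx, hX.1 hy])) huX hy
  refine ⟨l + 1, fun i => if i = 0 then x else p (i - 1), by omega, by simpa, by simpa,
    ?_, ?_, ?_⟩
  · have := hstep (l - 1) (by omega)
    rw [Nat.sub_add_cancel hl, adj_induce] at this
    have h2 := this.2.2
    simp only [Finset.mem_erase] at h2
    simpa using h2.1.symm
  · intro i hi hil
    simpa [hi.ne'] using hint (i - 1) (by omega)
  · rintro (_ | i) hi
    · simpa [h0]
    · simpa using (adj_induce.mp (hstep i (by omega))).1

/-- An ear of minimum length. -/
structure IsShortestEar (G : FinGraph) (X : Finset ℕ) (l : ℕ) (p : ℕ → ℕ) : Prop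
    extends IsEar G X l p where
  minimal : ∀ m q, G.IsEar X m q → l ≤ m

theorem Biconnected.exists_isShortestEar {G : FinGraph} (hG : G.Biconnected) {X : Finset ℕ}
    (hX : X ⊂ G.verts) (hcard : 2 ≤ X.card) : ∃ l p, G.IsShortestEar X l p := by
  have h := hG.exists_isEar hX hcard
  obtain ⟨p, hp⟩ := Nat.find_spec h
  exact ⟨Nat.find h, p, hp, fun m q hq => Nat.find_min' h ⟨q, hq⟩⟩

namespace IsShortestEar

variable {G : FinGraph} {X : Finset ℕ} {l : ℕ} {p : ℕ → ℕ}

theorem ne_of_lt (h : G.IsShortestEar X l p) {i j : ℕ} (hij : i < j) (hj : j ≤ l) :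
    p i ≠ p j := by
  intro he
  have hi0 : 0 < i := by
    by_contra hi
    obtain rfl : i = 0 := by omega
    rcases hj.lt_or_eq with hj | rfl
    · exact h.interior j hij hj (he ▸ h.first_mem)
    · exact h.first_ne_last he
  have hjl : j < l := by
    rcases hj.lt_or_eq with hj | rfl
    · exact hj
    · exact absurd (he ▸ h.last_mem) (h.interior i hi0 hij)
  have := h.minimal (l - (j - i)) (fun k => if k ≤ i then p k else p (k + (j - i)))
    { two_le := by omega
      first_mem := by simpa using h.first_mem
      last_mem := by
        rw [if_neg (by omega), Nat.sub_add_cancel (by omega)]; exact h.last_mem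
      first_ne_last := by
        rw [if_neg (by omega : ¬ l - (j - i) ≤ i), Nat.sub_add_cancel (by omega)]
        simpa using h.first_ne_last
      interior := by
        intro k hk hkl
        split_ifs
        · exact h.interior k hk (by omega)
        · exact h.interior _ (by omega) (by omega)
      step := by
        intro k hk
        rcases lt_trichotomy k i with hki | rfl | hki
        · rw [if_pos hki.le, if_pos (by omega)]
          exact h.step k (by omega)
        · rw [if_pos le_rfl, if_neg (by omega), he]
          convert h.step j hjl using 2
          omega
        · rw [if_neg (by omega), if_neg (by omega)]
          convert h.step (k + (j - i)) (by omega) using 2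
          omega }
  omega

theorem injOn (h : G.IsShortestEar X l p) {i j : ℕ} (hi : i ≤ l) (hj : j ≤ l)
    (he : p i = p j) : i = j := by
  rcases lt_trichotomy i j with hij | hij | hij
  · exact absurd he (h.ne_of_lt hij hj)
  · exact hij
  · exact absurd he.symm (h.ne_of_lt hij hi)

/-- The interior of a shortest ear has no chords. -/
theorem eq_succ_of_adj (h : G.IsShortestEar X l p) {i j : ℕ} (hi : 0 < i) (hij : i < j)
    (hj : j < l) (ha : G.adj (p i) (p j)) : j = i + 1 := by
  by_contra hne
  have := h.minimal (l - (j - i) + 1) (fun k => if k ≤ i then p k else p (k + (j - i) - 1))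
    { two_le := by omega
      first_mem := by simpa using h.first_mem
      last_mem := by
        rw [if_neg (by omega), show l - (j - i) + 1 + (j - i) - 1 = l by omega]
        exact h.last_mem
      first_ne_last := by
        rw [if_neg (by omega : ¬ l - (j - i) + 1 ≤ i),
          show l - (j - i) + 1 + (j - i) - 1 = l by omega]
        simpa using h.first_ne_last
      interior := by
        intro k hk hkl
        split_ifs
        · exact h.interior k hk (by omega)
        · exact h.interior _ (by omega) (by omega)
      step := by
        intro k hk
        rcases lt_trichotomy k i with hki | rfl | hki
        · rw [if_pos hki.le, if_pos (by omega)]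
          exact h.step k (by omega)
        · rw [if_pos le_rfl, if_neg (by omega)]
          convert ha using 2
          omega
        · rw [if_neg (by omega), if_neg (by omega)]
          convert h.step (k + (j - i) - 1) (by omega) using 2
          omega }
  omega

theorem eq_first_or_eq_pred (h : G.IsShortestEar X l p) {i x : ℕ} (hi : 0 < i) (hil : i < l)
    (hx : x ∈ X) (ha : G.adj (p i) x) : x = p 0 ∨ i + 1 = l := by
  by_contra! hne
  have := h.minimal (i + 1) (fun k => if k ≤ i then p k else x)
    { two_le := by omega
      first_mem := by simpa using h.first_mem
      last_mem := by simpa using hx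
      first_ne_last := by simpa using hne.1.symm
      interior := by
        intro k hk hkl
        rw [if_pos (by omega)]
        exact h.interior k hk (by omega)
      step := by
        intro k hk
        rcases (Nat.lt_succ_iff.mp hk).lt_or_eq with hki | rfl
        · rw [if_pos hki.le, if_pos (by omega)]
          exact h.step k (by omega)
        · rw [if_pos le_rfl, if_neg (by omega)]
          exact ha }
  omega

theorem eq_last_or_eq_one (h : G.IsShortestEar X l p) {i x : ℕ} (hi : 0 < i) (hil : i < l)
    (hx : x ∈ X) (ha : G.adj (p i) x) : x = p l ∨ i = 1 := by
  by_contra! hne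
  have := h.minimal (l - i + 1) (fun k => if k = 0 then x else p (k + i - 1))
    { two_le := by omega
      first_mem := by simpa using hx
      last_mem := by
        rw [if_neg (by omega), show l - i + 1 + i - 1 = l by omega]
        exact h.last_mem
      first_ne_last := by
        rw [if_neg (by omega : ¬ l - i + 1 = 0), show l - i + 1 + i - 1 = l by omega]
        simpa using hne.1
      interior := by
        intro k hk hkl
        rw [if_neg (by omega)]
        exact h.interior _ (by omega) (by omega)
      step := by
        rintro (_ | k) hk
        · simpa using ha.symm
        · rw [if_neg (by omega), if_neg (by omega)]
          convert h.step (k + 1 + i - 1) (by omega) using 2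
          omega }
  omega

/-- Every edge at an interior vertex of a shortest ear, with both ends in `X` or on the ear, is
an edge of the ear, provided the ear has length at least three or `X` consists of the two ends
of the ear. -/
theorem exists_eq_edge (h : G.IsShortestEar X l p)
    (hX : 3 ≤ l ∨ ∀ x ∈ X, x = p 0 ∨ x = p l) {i y : ℕ} (hi : 0 < i) (hil : i < l)
    (hy : y ∈ X ∨ ∃ j, 0 < j ∧ j < l ∧ y = p j) (ha : G.adj (p i) y) :
    ∃ k < l, s(p i, y) = s(p k, p (k + 1)) := by
  rcases hy with hy | ⟨j, hj, hjl, rfl⟩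
  · have hends : (y = p 0 ∧ i = 1) ∨ (y = p l ∧ i + 1 = l) := by
      have h1 := h.eq_first_or_eq_pred hi hil hy ha
      have h2 := h.eq_last_or_eq_one hi hil hy ha
      have h3 := h.first_ne_last
      have h4 : i = 1 → i + 1 = l → y = p 0 ∨ y = p l := fun _ _ =>
        hX.elim (fun _ => by omega) (fun hX => hX y hy)
      grind
    rcases hends with ⟨rfl, rfl⟩ | ⟨rfl, rfl⟩
    · exact ⟨0, by omega, Sym2.eq_swap⟩
    · exact ⟨i, hil, rfl⟩
  · rcases lt_trichotomy i j with hij | rfl | hij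
    · obtain rfl := h.eq_succ_of_adj hi hij hjl ha
      exact ⟨i, hil, rfl⟩
    · exact absurd rfl ha.ne
    · obtain rfl := h.eq_succ_of_adj hj hij hil ha.symm
      exact ⟨j, hjl, Sym2.eq_swap⟩

end IsShortestEar

/-- `K` is a star or a path of length at least three attached to the vertex set `X` as required
in a CSP-decomposition. -/
def IsAttachment (K : FinGraph) (X : Finset ℕ) : Prop :=
  (∃ v : ℕ, IsStarAt K v ∧ K.verts ∩ X = K.verts.erase v) ∨
    (∃ ℓ : ℕ, 3 ≤ ℓ ∧ ∃ p : Fin (ℓ + 1) → ℕ, IsPathGraph K ℓ p ∧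
      K.verts ∩ X = {p 0, p (Fin.last ℓ)})

/-- `G` has a CSP-decomposition whose pieces cover all vertices of `G`. -/
def HasSpanningCSP (G : FinGraph) : Prop :=
  ∃ (r : ℕ) (H : Fin (r + 1) → FinGraph), G.IsCSPDecomposition r H ∧
    (Finset.univ.biUnion fun i => (H i).verts) = G.verts

theorem IsCycleGraph.hasSpanningCSP {G : FinGraph} (h : G.IsCycleGraph) :
    G.HasSpanningCSP := by
  refine ⟨0, fun _ => G, ⟨fun _ => ⟨subset_rfl, subset_rfl⟩, ?_, ?_, h, ?_⟩, ?_⟩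
  · intro i j hij
    exact absurd (Fin.ext (by omega)) hij
  · simp
  · intro i hi
    exact absurd (Fin.ext (by omega)) hi
  · simp

theorem HasSpanningCSP.attach {G G' K : FinGraph} (hG : G.HasSpanningCSP)
    (hK : K.IsAttachment G.verts) (hdisj : Disjoint G.edges K.edges)
    (hedges : G.edges ∪ K.edges = G'.edges) (hverts : G.verts ∪ K.verts = G'.verts) :
    G'.HasSpanningCSP := by
  obtain ⟨r, H, ⟨hsub, hdis, hun, hcyc, hatt⟩, hspan⟩ := hG
  have hdisK : ∀ i, Disjoint (H i).edges K.edges := fun i =>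
    Finset.disjoint_of_subset_left (hsub i).2 hdisj
  have hprev : ∀ i : Fin (r + 1), prevVerts (Fin.snoc H K : Fin (r + 2) → FinGraph) i.castSucc =
      prevVerts H i := by
    intro i
    ext x
    simp only [prevVerts, Finset.mem_biUnion, Finset.mem_filter, Finset.mem_univ, true_and]
    constructor
    · rintro ⟨j, hj, hx⟩
      induction j using Fin.lastCases with
      | last => exact absurd hj (by simp [Fin.lt_def])
      | cast j => exact ⟨j, by simpa using hj, by simpa using hx⟩
    · rintro ⟨j, hj, hx⟩
      exact ⟨j.castSucc, by simpa using hj, by simpa using hx⟩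
  have hprevlast : prevVerts (Fin.snoc H K : Fin (r + 2) → FinGraph) (Fin.last (r + 1)) =
      G.verts := by
    rw [← hspan]
    ext x
    simp only [prevVerts, Finset.mem_biUnion, Finset.mem_filter, Finset.mem_univ, true_and]
    constructor
    · rintro ⟨j, hj, hx⟩
      induction j using Fin.lastCases with
      | last => exact absurd hj (lt_irrefl _)
      | cast j => exact ⟨j, by simpa using hx⟩
    · rintro ⟨j, hx⟩
      exact ⟨j.castSucc, Fin.castSucc_lt_last j, by simpa using hx⟩
  refine ⟨r + 1, Fin.snoc H K, ⟨?_, ?_, ?_, ?_, ?_⟩, ?_⟩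
  · intro i
    induction i using Fin.lastCases with
    | last =>
      simp only [Fin.snoc_last]
      exact ⟨hverts ▸ Finset.subset_union_right, hedges ▸ Finset.subset_union_right⟩
    | cast i =>
      simp only [Fin.snoc_castSucc]
      exact ⟨(hsub i).1.trans (hverts ▸ Finset.subset_union_left),
        (hsub i).2.trans (hedges ▸ Finset.subset_union_left)⟩
  · intro i j hij
    induction i using Fin.lastCases with
    | last =>
      induction j using Fin.lastCases with
      | last => exact absurd rfl hij
      | cast j => simpa using (hdisK j).symm
    | cast i =>
      induction j using Fin.lastCases with
      | last => simpa using hdisK i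
      | cast j => simpa using hdis i j (fun h => hij (by rw [h]))
  · rw [← hedges, ← hun]
    ext e
    simp [Fin.exists_fin_succ']
  · have : (Fin.snoc H K : Fin (r + 2) → FinGraph) 0 = H 0 :=
      Fin.snoc_castSucc (α := fun _ => FinGraph) K H 0
    rwa [this]
  · intro i hi
    induction i using Fin.lastCases with
    | last =>
      rw [hprevlast]
      simpa [IsAttachment] using hK
    | cast i =>
      rw [hprev]
      simpa using hatt i (fun h => hi (by rw [h]; rfl))
  · rw [← hverts, ← hspan]
    ext e
    simp [Fin.exists_fin_succ']

/-- The part of `G.induce Y` that is not in `G.induce X`, without the vertices that are isolated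
in it. -/
noncomputable def between (G : FinGraph) (X Y : Finset ℕ) : FinGraph where
  verts := G.verts.filter fun v => ∃ e ∈ (G.induce Y).edges \ (G.induce X).edges, v ∈ e
  edges := (G.induce Y).edges \ (G.induce X).edges
  edge_mem := fun e he v hv => by
    have h := (Finset.mem_sdiff.mp he).1
    exact Finset.mem_filter.mpr
      ⟨(Finset.mem_inter.mp ((G.induce Y).edge_mem e h v hv)).1, e, he, hv⟩
  no_loops := fun e he => (G.induce Y).no_loops e (Finset.mem_sdiff.mp he).1

theorem adj_between {G : FinGraph} {X Y : Finset ℕ} {u v : ℕ} :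
    (G.between X Y).adj u v ↔ G.adj u v ∧ u ∈ Y ∧ v ∈ Y ∧ ¬ (u ∈ X ∧ v ∈ X) := by
  have : (G.between X Y).adj u v ↔ (G.induce Y).adj u v ∧ ¬ (G.induce X).adj u v := by
    simp [adj, between]
  rw [this, adj_induce, adj_induce]
  tauto

theorem mem_verts_between {G : FinGraph} {X Y : Finset ℕ} {u : ℕ} :
    u ∈ (G.between X Y).verts ↔ ∃ v, (G.between X Y).adj u v := by
  constructor
  · intro h
    obtain ⟨-, e, he, hue⟩ := Finset.mem_filter.mp h
    obtain ⟨v, rfl⟩ := Sym2.mem_iff_exists.mp hue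
    exact ⟨v, he⟩
  · rintro ⟨v, h⟩
    exact h.left_mem

theorem HasSpanningCSP.attach_between {G : FinGraph} {X Y : Finset ℕ}
    (hX : (G.induce X).HasSpanningCSP) (hXY : X ⊆ Y) (hY : Y ⊆ G.verts)
    (hnew : ∀ y ∈ Y, y ∉ X → ∃ z ∈ Y, G.adj y z)
    (hK : (G.between X Y).IsAttachment X) : (G.induce Y).HasSpanningCSP := by
  have hXv : (G.induce X).verts = X := Finset.inter_eq_right.mpr (hXY.trans hY)
  have hYv : (G.induce Y).verts = Y := Finset.inter_eq_right.mpr hY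
  refine hX.attach (K := G.between X Y) (by rwa [hXv]) Finset.disjoint_sdiff ?_ ?_
  · refine Finset.union_sdiff_of_subset ?_
    intro e he
    simp only [induce, Finset.mem_filter] at he ⊢
    exact ⟨he.1, fun v hv => hXY (he.2 v hv)⟩
  · rw [hXv, hYv]
    ext y
    rw [Finset.mem_union, mem_verts_between]
    constructor
    · rintro (h | ⟨v, h⟩)
      · exact hXY h
      · exact (adj_between.mp h).2.1
    · intro h
      by_cases hy : y ∈ X
      · exact Or.inl hy
      · obtain ⟨z, hz, ha⟩ := hnew y h hy
        exact Or.inr ⟨z, adj_between.mpr ⟨ha, h, hz, fun hh => hy hh.1⟩⟩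

/-- Attaching a vertex with at least two neighbours in `X` as a star. -/
theorem isAttachment_insert {G : FinGraph} {X : Finset ℕ} {v a b : ℕ} (hv : v ∉ X)
    (ha : a ∈ X) (hb : b ∈ X) (hab : a ≠ b) (hva : G.adj v a) (hvb : G.adj v b) :
    (G.between X (insert v X)).IsAttachment X := by
  have hadj : ∀ x ∈ X, G.adj v x → (G.between X (insert v X)).adj v x := fun x hx h =>
    adj_between.mpr ⟨h, by simp, by simp [hx], fun hh => hv hh.1⟩
  have hcenter : ∀ e ∈ (G.between X (insert v X)).edges, v ∈ e := by
    intro e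
    induction e with
    | h x y =>
      intro he
      obtain ⟨-, hx, hy, hxy⟩ := adj_between.mp he
      simp only [Finset.mem_insert, Sym2.mem_iff] at *
      grind
  refine Or.inl ⟨v, ⟨(hadj a ha hva).left_mem, ?_, hcenter, ?_⟩, ?_⟩
  · refine (Finset.card_pair (a := s(v, a)) (b := s(v, b)) ?_).symm.le.trans
      (Finset.card_le_card ?_)
    · simpa [Sym2.eq_iff] using ⟨hab, fun h => absurd (h ▸ hb) hv⟩
    · intro e he
      simp only [Finset.mem_insert, Finset.mem_singleton] at he
      rcases he with rfl | rfl
      · exact Finset.mem_filter.mpr ⟨hadj a ha hva, by simp⟩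
      · exact Finset.mem_filter.mpr ⟨hadj b hb hvb, by simp⟩
  · intro u hu _
    obtain ⟨w, hw⟩ := mem_verts_between.mp hu
    exact ⟨_, hw, by simp⟩
  · ext x
    simp only [Finset.mem_inter, Finset.mem_erase]
    constructor
    · rintro ⟨hx, hxX⟩
      exact ⟨fun h => hv (h ▸ hxX), hx⟩
    · rintro ⟨hxv, hx⟩
      obtain ⟨w, hw⟩ := mem_verts_between.mp hx
      exact ⟨hx, (Finset.mem_insert.mp (adj_between.mp hw).2.1).resolve_left hxv⟩

/-- `X` together with the vertices of the walk `p` of length `l`. -/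
noncomputable def earVerts (X : Finset ℕ) (l : ℕ) (p : ℕ → ℕ) : Finset ℕ :=
  X ∪ (Finset.range (l + 1)).image p

theorem apply_mem_earVerts {X : Finset ℕ} {l : ℕ} {p : ℕ → ℕ} {i : ℕ} (hi : i ≤ l) :
    p i ∈ earVerts X l p :=
  Finset.mem_union_right _ (Finset.mem_image_of_mem p (Finset.mem_range.mpr (by omega)))

theorem IsEar.mem_earVerts {G : FinGraph} {X : Finset ℕ} {l : ℕ} {p : ℕ → ℕ}
    (h : G.IsEar X l p) {y : ℕ} :
    y ∈ earVerts X l p ↔ y ∈ X ∨ ∃ j, 0 < j ∧ j < l ∧ y = p j := by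
  constructor
  · intro hy
    rcases Finset.mem_union.mp hy with hy | hy
    · exact Or.inl hy
    · obtain ⟨j, hj, rfl⟩ := Finset.mem_image.mp hy
      rw [Finset.mem_range] at hj
      rcases Nat.eq_zero_or_pos j with rfl | hj0
      · exact Or.inl h.first_mem
      · rcases (Nat.lt_succ_iff.mp hj).lt_or_eq with hjl | rfl
        · exact Or.inr ⟨j, hj0, hjl, rfl⟩
        · exact Or.inl h.last_mem
  · rintro (hy | ⟨j, -, hj, rfl⟩)
    · exact Finset.mem_union_left _ hy
    · exact apply_mem_earVerts hj.le

theorem IsEar.apply_mem_verts {G : FinGraph} {X : Finset ℕ} {l : ℕ} {p : ℕ → ℕ}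
    (h : G.IsEar X l p) {i : ℕ} (hi : i ≤ l) : p i ∈ G.verts := by
  rcases hi.lt_or_eq with hi | rfl
  · exact (h.step i hi).left_mem
  · have h1 := h.two_le
    have := h.step (i - 1) (by omega)
    rw [Nat.sub_add_cancel (by omega)] at this
    exact this.symm.left_mem

theorem IsEar.earVerts_subset {G : FinGraph} {X : Finset ℕ} {l : ℕ} {p : ℕ → ℕ}
    (h : G.IsEar X l p) (hX : X ⊆ G.verts) : earVerts X l p ⊆ G.verts := by
  intro y hy
  rcases h.mem_earVerts.mp hy with hy | ⟨j, -, hj, rfl⟩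
  · exact hX hy
  · exact h.apply_mem_verts hj.le

theorem IsShortestEar.mem_edges_between {G : FinGraph} {X : Finset ℕ} {l : ℕ} {p : ℕ → ℕ}
    (h : G.IsShortestEar X l p) (hX : 3 ≤ l ∨ ∀ x ∈ X, x = p 0 ∨ x = p l) {e : Sym2 ℕ} :
    e ∈ (G.between X (earVerts X l p)).edges ↔ ∃ k < l, e = s(p k, p (k + 1)) := by
  have hl := h.two_le
  constructor
  · induction e with
    | h x y =>
      intro he
      obtain ⟨ha, hx, hy, hxy⟩ := adj_between.mp he
      rw [h.mem_earVerts] at hx hy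
      rcases hx with hxX | ⟨i, hi, hil, rfl⟩
      · rcases hy with hyX | ⟨j, hj, hjl, rfl⟩
        · exact absurd ⟨hxX, hyX⟩ hxy
        · rw [Sym2.eq_swap]
          exact h.exists_eq_edge hX hj hjl (Or.inl hxX) ha.symm
      · exact h.exists_eq_edge hX hi hil hy ha
  · rintro ⟨k, hk, rfl⟩
    refine adj_between.mpr ⟨h.step k hk, apply_mem_earVerts hk.le, apply_mem_earVerts hk, ?_⟩
    rintro ⟨h1, h2⟩
    rcases Nat.eq_zero_or_pos k with rfl | hk0
    · exact h.interior 1 one_pos (by omega) h2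
    · exact h.interior k hk0 hk h1

theorem IsShortestEar.isAttachment {G : FinGraph} {X : Finset ℕ} {l : ℕ} {p : ℕ → ℕ}
    (h : G.IsShortestEar X l p) (hl : 3 ≤ l) :
    (G.between X (earVerts X l p)).IsAttachment X := by
  have hedge : ∀ k < l, (G.between X (earVerts X l p)).adj (p k) (p (k + 1)) := fun k hk =>
    (h.mem_edges_between (Or.inl hl)).mpr ⟨k, hk, rfl⟩
  have hverts : (G.between X (earVerts X l p)).verts =
      Finset.univ.image fun i : Fin (l + 1) => p i := by
    ext x
    simp only [Finset.mem_image, Finset.mem_univ, true_and]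
    constructor
    · intro hx
      obtain ⟨y, hy⟩ := mem_verts_between.mp hx
      obtain ⟨k, hk, hxy⟩ := (h.mem_edges_between (Or.inl hl)).mp hy
      rcases Sym2.eq_iff.mp hxy with ⟨rfl, -⟩ | ⟨rfl, -⟩
      · exact ⟨⟨k, by omega⟩, rfl⟩
      · exact ⟨⟨k + 1, by omega⟩, rfl⟩
    · rintro ⟨⟨i, hi⟩, rfl⟩
      rcases (Nat.lt_succ_iff.mp hi).lt_or_eq with hil | rfl
      · exact (hedge i hil).left_mem
      · have := hedge (i - 1) (by omega)
        rw [Nat.sub_add_cancel (by omega)] at this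
        exact this.symm.left_mem
  refine Or.inr ⟨l, hl, fun i => p i, ⟨?_, hverts, ?_⟩, ?_⟩
  · intro i j hij
    exact Fin.ext (h.injOn (by omega) (by omega) hij)
  · ext e
    rw [h.mem_edges_between (Or.inl hl)]
    simp only [Finset.mem_image, Finset.mem_univ, true_and, Fin.val_castSucc, Fin.val_succ]
    constructor
    · rintro ⟨k, hk, rfl⟩
      exact ⟨⟨k, hk⟩, rfl⟩
    · rintro ⟨k, rfl⟩
      exact ⟨k, k.2, rfl⟩
  · rw [hverts]
    ext x
    simp only [Finset.mem_inter, Finset.mem_image, Finset.mem_univ, true_and, Finset.mem_insert,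
      Finset.mem_singleton, Fin.val_zero, Fin.val_last]
    constructor
    · rintro ⟨⟨⟨i, hi⟩, rfl⟩, hx⟩
      rcases Nat.eq_zero_or_pos i with rfl | hi0
      · exact Or.inl rfl
      · rcases (Nat.lt_succ_iff.mp hi).lt_or_eq with hil | rfl
        · exact absurd hx (h.interior i hi0 hil)
        · exact Or.inr rfl
    · rintro (rfl | rfl)
      · exact ⟨⟨0, rfl⟩, h.first_mem⟩
      · exact ⟨⟨Fin.last l, rfl⟩, h.last_mem⟩

/-- The vertex set of a spanning CSP-decomposed induced subgraph can be enlarged. -/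
theorem Biconnected.exists_ssuperset_hasSpanningCSP {G : FinGraph} (hG : G.Biconnected)
    {X : Finset ℕ} (hX : X ⊂ G.verts) (hcard : 2 ≤ X.card)
    (hcsp : (G.induce X).HasSpanningCSP) :
    ∃ Y, X ⊂ Y ∧ Y ⊆ G.verts ∧ (G.induce Y).HasSpanningCSP := by
  obtain ⟨l, p, h⟩ := hG.exists_isShortestEar hX hcard
  have hl := h.two_le
  have h1 : p 1 ∉ X := h.interior 1 one_pos (by omega)
  rcases hl.lt_or_eq with hl | rfl
  · have hXY : X ⊆ earVerts X l p := Finset.subset_union_left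
    have hY := h.earVerts_subset hX.1
    refine ⟨earVerts X l p, ⟨hXY, fun hh => h1 (hh (apply_mem_earVerts (by omega)))⟩, hY,
      hcsp.attach_between hXY hY ?_ (h.isAttachment hl)⟩
    intro y hy hyX
    obtain ⟨j, -, hj, rfl⟩ := (h.mem_earVerts.mp hy).resolve_left hyX
    exact ⟨p (j + 1), apply_mem_earVerts hj, h.step j hj⟩
  · have ha := (h.step 0 (by omega)).symm
    have hb := h.step 1 (by omega)
    have hY : insert (p 1) X ⊆ G.verts := Finset.insert_subset ha.left_mem hX.1
    refine ⟨insert (p 1) X, Finset.ssubset_insert h1, hY,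
      hcsp.attach_between (Finset.subset_insert _ _) hY ?_
        (isAttachment_insert h1 h.first_mem h.last_mem h.first_ne_last ha hb)⟩
    intro y hy hyX
    obtain rfl := (Finset.mem_insert.mp hy).resolve_right hyX
    exact ⟨p 0, Finset.mem_insert_of_mem h.first_mem, ha⟩

theorem Biconnected.hasSpanningCSP_of_induce {G : FinGraph} (hG : G.Biconnected)
    {X : Finset ℕ} (hX : X ⊆ G.verts) (hcard : 2 ≤ X.card)
    (hcsp : (G.induce X).HasSpanningCSP) : G.HasSpanningCSP := by
  rcases hX.eq_or_ssubset with rfl | hss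
  · rwa [induce_verts_self] at hcsp
  · obtain ⟨Y, hXY, hY, hcspY⟩ := hG.exists_ssuperset_hasSpanningCSP hss hcard hcsp
    have := Finset.card_lt_card hXY
    have := Finset.card_le_card hY
    exact hG.hasSpanningCSP_of_induce hY (by omega) hcspY
termination_by G.verts.card - X.card

/-- A graph whose vertices are enumerated cyclically by an injective map, with exactly the edges
joining consecutive vertices, is a cycle. -/
theorem isCycleGraph_of_cyclic {H : FinGraph} {n : ℕ} (hn : 3 ≤ n) [NeZero n] {c : Fin n → ℕ}
    (hc : Function.Injective c) (hverts : ∀ x, x ∈ H.verts ↔ ∃ i, x = c i)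
    (hedges : ∀ e, e ∈ H.edges ↔ ∃ i, e = s(c i, c (i + 1))) : H.IsCycleGraph := by
  have hone : ∀ i : Fin n, i + 1 ≠ i := by
    intro i h
    have h1 : (1 : Fin n) = 0 := by simpa using h
    have := congrArg Fin.val h1
    rw [Fin.val_one', Fin.val_zero, Nat.mod_eq_of_lt (by omega)] at this
    omega
  have htwo : ∀ i : Fin n, i + 1 + 1 ≠ i := by
    intro i h
    rw [add_assoc] at h
    have h1 : (1 + 1 : Fin n) = 0 := by simpa using h
    have := congrArg Fin.val h1
    rw [Fin.val_add, Fin.val_one', Fin.val_zero, Nat.mod_eq_of_lt (by omega : 1 < n),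
      Nat.mod_eq_of_lt (by omega)] at this
    omega
  have hadj : ∀ i, H.adj (c i) (c (i + 1)) := fun i => (hedges _).mpr ⟨i, rfl⟩
  refine ⟨⟨⟨c 0, (hverts _).mpr ⟨0, rfl⟩⟩, ?_⟩, ?_⟩
  · have hreach : ∀ k : ℕ, ∀ i : Fin n,
        Relation.ReflTransGen H.adj (c i) (c (i + (Fin.ofNat n k))) := by
      intro k
      induction k with
      | zero => intro i; simp [Relation.ReflTransGen.refl]
      | succ k ih =>
        intro i
        have hk : Fin.ofNat n (k + 1) = Fin.ofNat n k + 1 := by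
          ext; simp [Fin.val_add, Fin.ofNat]
        rw [hk, ← add_assoc]
        exact (ih i).tail (hadj _)
    intro u hu v hv
    obtain ⟨i, rfl⟩ := (hverts u).mp hu
    obtain ⟨j, rfl⟩ := (hverts v).mp hv
    have := hreach (j - i).val i
    simpa using this
  · intro v hv
    obtain ⟨i, rfl⟩ := (hverts v).mp hv
    obtain ⟨i, rfl⟩ : ∃ j, i = j + 1 := ⟨i - 1, by simp⟩
    have hfilter : (H.edges.filter fun e => c (i + 1) ∈ e) =
        {s(c i, c (i + 1)), s(c (i + 1), c (i + 1 + 1))} := by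
      ext e
      simp only [Finset.mem_filter, hedges, Finset.mem_insert, Finset.mem_singleton]
      constructor
      · rintro ⟨⟨j, rfl⟩, hj⟩
        rcases Sym2.mem_iff.mp hj with hj | hj
        · exact Or.inr (by rw [hc hj])
        · exact Or.inl (by rw [add_right_cancel (hc hj)])
      · rintro (rfl | rfl)
        · exact ⟨⟨i, rfl⟩, by simp⟩
        · exact ⟨⟨i + 1, rfl⟩, by simp⟩
    rw [deg, hfilter, Finset.card_pair]
    intro h
    rcases Sym2.eq_iff.mp h with ⟨h, -⟩ | ⟨h, -⟩
    · exact hone i (hc h).symm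
    · exact htwo i (hc h).symm

/-- A shortest ear on the two ends of an edge closes up to an induced cycle. -/
theorem IsShortestEar.isCycleGraph_of_adj {G : FinGraph} {a b l : ℕ} {p : ℕ → ℕ}
    (hab : G.adj a b) (h : G.IsShortestEar {a, b} l p) :
    (G.induce (earVerts {a, b} l p)).IsCycleGraph := by
  have hl := h.two_le
  have hne := h.first_ne_last
  have hfirst := h.first_mem
  have hlast := h.last_mem
  simp only [Finset.mem_insert, Finset.mem_singleton] at hfirst hlast
  have hends : s(p l, p 0) = s(a, b) := by
    rw [Sym2.eq_iff]
    grind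
  have hX : ∀ x ∈ ({a, b} : Finset ℕ), x = p 0 ∨ x = p l := by
    intro x hx
    simp only [Finset.mem_insert, Finset.mem_singleton] at hx
    grind
  have hsub : earVerts {a, b} l p ⊆ G.verts := h.earVerts_subset (by
    intro x hx
    rcases hX x hx with rfl | rfl
    · exact h.apply_mem_verts (Nat.zero_le l)
    · exact h.apply_mem_verts le_rfl)
  have hverts : (G.induce (earVerts {a, b} l p)).verts = earVerts {a, b} l p :=
    Finset.inter_eq_right.mpr hsub
  have hcast : ∀ k (hk : k < l), (⟨k, by omega⟩ + 1 : Fin (l + 1)) = ⟨k + 1, by omega⟩ := by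
    intro k hk
    ext
    rw [Fin.val_add_one_of_lt (by simpa [Fin.lt_def] using hk)]
  have hedges : ∀ e, e ∈ (G.induce (earVerts {a, b} l p)).edges ↔
      (∃ k < l, e = s(p k, p (k + 1))) ∨ e = s(p l, p 0) := by
    intro e
    rw [← h.mem_edges_between (Or.inr hX)]
    induction e with
    | h x y =>
      change (G.induce _).adj x y ↔ (G.between _ _).adj x y ∨ _
      rw [adj_induce, adj_between]
      constructor
      · rintro ⟨ha, hx, hy⟩
        by_cases hxy : x ∈ ({a, b} : Finset ℕ) ∧ y ∈ ({a, b} : Finset ℕ)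
        · right
          have := ha.ne
          have h1 := hX x hxy.1
          have h2 := hX y hxy.2
          rw [Sym2.eq_iff]
          grind
        · exact Or.inl ⟨ha, hx, hy, hxy⟩
      · rintro (⟨ha, hx, hy, -⟩ | he)
        · exact ⟨ha, hx, hy⟩
        · refine ⟨?_, ?_⟩
          · unfold adj
            rw [he, hends]
            exact hab
          · rcases Sym2.eq_iff.mp he with ⟨rfl, rfl⟩ | ⟨rfl, rfl⟩
            · exact ⟨apply_mem_earVerts le_rfl, apply_mem_earVerts (Nat.zero_le l)⟩
            · exact ⟨apply_mem_earVerts (Nat.zero_le l), apply_mem_earVerts le_rfl⟩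
  refine isCycleGraph_of_cyclic (n := l + 1) (c := fun i => p i) (by omega) ?_ ?_ ?_
  · intro i j hij
    exact Fin.ext (h.injOn (by omega) (by omega) hij)
  · intro x
    rw [hverts]
    constructor
    · intro hx
      rcases h.mem_earVerts.mp hx with hx | ⟨j, -, hj, rfl⟩
      · rcases hX x hx with rfl | rfl
        · exact ⟨0, rfl⟩
        · exact ⟨Fin.last l, rfl⟩
      · exact ⟨⟨j, by omega⟩, rfl⟩
    · rintro ⟨i, rfl⟩
      exact apply_mem_earVerts (by omega)
  · intro e
    rw [hedges]
    constructor
    · rintro (⟨k, hk, rfl⟩ | rfl)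
      · exact ⟨⟨k, by omega⟩, by rw [hcast k hk]⟩
      · exact ⟨Fin.last l, by simp⟩
    · rintro ⟨i, rfl⟩
      induction i using Fin.lastCases with
      | last => exact Or.inr (by simp)
      | cast i => exact Or.inl ⟨i, i.2, congrArg (fun k : Fin (l + 1) => s(p i, p k)) (hcast i i.2)⟩

theorem Biconnected.exists_adj {G : FinGraph} (hG : G.Biconnected) : ∃ a b, G.adj a b := by
  obtain ⟨hcard, ⟨-, hconn⟩, -⟩ := hG
  obtain ⟨u, hu, v, hv, huv⟩ := Finset.one_lt_card.mp (by omega : 1 < G.verts.card)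
  rcases (hconn u hu v hv).cases_head with h | ⟨c, hc, -⟩
  · exact absurd h huv
  · exact ⟨u, c, hc⟩

theorem Biconnected.hasSpanningCSP {G : FinGraph} (hG : G.Biconnected)
    (h3 : 3 ≤ G.verts.card) : G.HasSpanningCSP := by
  obtain ⟨a, b, hab⟩ := hG.exists_adj
  have hcard : ({a, b} : Finset ℕ).card = 2 := Finset.card_pair hab.ne
  have hsub : ({a, b} : Finset ℕ) ⊆ G.verts :=
    Finset.insert_subset hab.left_mem (Finset.singleton_subset_iff.mpr hab.symm.left_mem)
  have hss : ({a, b} : Finset ℕ) ⊂ G.verts :=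
    hsub.ssubset_of_ne (fun h => by rw [h] at hcard; omega)
  obtain ⟨l, p, h⟩ := hG.exists_isShortestEar hss hcard.ge
  exact hG.hasSpanningCSP_of_induce (h.earVerts_subset hsub)
    (hcard.ge.trans (Finset.card_le_card Finset.subset_union_left))
    (h.isCycleGraph_of_adj hab).hasSpanningCSP

end FinGraph

/-- **Lemma (CSP-decomposition).** Every biconnected graph with at least three vertices admits
a CSP-decomposition. -/
theorem csp_decomposition_exists (G : FinGraph)
    (hbi : G.Biconnected) (h3 : 3 ≤ G.verts.card) :
    ∃ (r : ℕ) (H : Fin (r + 1) → FinGraph), G.IsCSPDecomposition r H := by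
  obtain ⟨r, H, hH, -⟩ := hbi.hasSpanningCSP h3
  exact ⟨r, H, hH⟩
end

section
/- Let (D,F = (f₁,f₂)) be a valid tight pair that is not a hard pair, and let v ∈ V(D) be such that both D and D − v are biconnected, UG(D) is not a cycle, and UG(D − v) is not a cycle. Then either there exists a colour c ∈ {1,2} such that colouring v with c is safe (namely f_c(v) ≠ (0,0), D − v is connected, and the pair reduced from (D,F) by colouring v with c is a hard pair if and only if (D,F) is), or D is F-dicolourable. -/
open scoped Classical

/-- A finite digraph with vertex set a `Finset ℕ` and no loops.
Both arcs `(u,v)` and `(v,u)` may be present (a digon). -/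
structure Digraph' where
  verts : Finset ℕ
  arcs : Finset (ℕ × ℕ)
  mem_fst : ∀ a ∈ arcs, a.1 ∈ verts
  mem_snd : ∀ a ∈ arcs, a.2 ∈ verts
  no_loops : ∀ a ∈ arcs, a.1 ≠ a.2

namespace Digraph'

/-- In-degree of `v`. -/
def inDeg (D : Digraph') (v : ℕ) : ℕ := (D.arcs.filter fun a => a.2 = v).card

/-- Out-degree of `v`. -/
def outDeg (D : Digraph') (v : ℕ) : ℕ := (D.arcs.filter fun a => a.1 = v).card

/-- In-neighbourhood of `v`. -/
def inNbrs (D : Digraph') (v : ℕ) : Finset ℕ := (D.arcs.filter fun a => a.2 = v).image Prod.fst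

/-- Out-neighbourhood of `v`. -/
def outNbrs (D : Digraph') (v : ℕ) : Finset ℕ := (D.arcs.filter fun a => a.1 = v).image Prod.snd

/-- Neighbourhood of `v` in the underlying graph. -/
def ugNbrs (D : Digraph') (v : ℕ) : Finset ℕ := D.inNbrs v ∪ D.outNbrs v

/-- `H` is a subdigraph of `D`. -/
def IsSubdigraph (H D : Digraph') : Prop := H.verts ⊆ D.verts ∧ H.arcs ⊆ D.arcs

/-- The subdigraph of `D` induced by the vertex set `X`. -/
def induce (D : Digraph') (X : Finset ℕ) : Digraph' where
  verts := D.verts ∩ X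
  arcs := D.arcs.filter fun a => a.1 ∈ X ∧ a.2 ∈ X
  mem_fst := fun a ha => by
    simp only [Finset.mem_filter] at ha
    exact Finset.mem_inter.mpr ⟨D.mem_fst a ha.1, ha.2.1⟩
  mem_snd := fun a ha => by
    simp only [Finset.mem_filter] at ha
    exact Finset.mem_inter.mpr ⟨D.mem_snd a ha.1, ha.2.2⟩
  no_loops := fun a ha => by
    simp only [Finset.mem_filter] at ha
    exact D.no_loops a ha.1

/-- `D − X`, the digraph obtained from `D` by deleting the vertices of `X`. -/
def del (D : Digraph') (X : Finset ℕ) : Digraph' := D.induce (D.verts \ X)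

/-- Adjacency in the underlying graph of `D`. -/
def ugAdj (D : Digraph') (u v : ℕ) : Prop :=
  u ∈ D.verts ∧ v ∈ D.verts ∧ ((u, v) ∈ D.arcs ∨ (v, u) ∈ D.arcs)

/-- `D` is connected, i.e. its underlying graph is connected. -/
def Connected (D : Digraph') : Prop :=
  D.verts.Nonempty ∧ ∀ u ∈ D.verts, ∀ v ∈ D.verts, Relation.ReflTransGen D.ugAdj u v

/-- `D` is biconnected: it has at least two vertices, is connected, and stays
connected after the deletion of any vertex. -/
def Biconnected (D : Digraph') : Prop :=
  2 ≤ D.verts.card ∧ D.Connected ∧ ∀ x ∈ D.verts, (D.del {x}).Connected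

/-- Every arc of `D` lies in a digon. -/
def Bidirected (D : Digraph') : Prop := ∀ a ∈ D.arcs, (a.2, a.1) ∈ D.arcs

/-- The underlying graph of `D` is a cycle. -/
def IsCycleUG (D : Digraph') : Prop :=
  D.Connected ∧ ∀ v ∈ D.verts, (D.ugNbrs v).card = 2

/-- `D` is a bidirected odd cycle. -/
def BidirectedOddCycle (D : Digraph') : Prop :=
  D.Bidirected ∧ D.IsCycleUG ∧ Odd D.verts.card

/-- `D` is a bidirected complete graph. -/
def BidirectedComplete (D : Digraph') : Prop :=
  ∀ u ∈ D.verts, ∀ v ∈ D.verts, u ≠ v → (u, v) ∈ D.arcs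

/-- `D` is strictly-`f`-bidegenerate: every nonempty subdigraph `H` of `D` contains a
vertex `v` with `d⁻_H(v) < f⁻(v)` or `d⁺_H(v) < f⁺(v)`. -/
def StrictlyBidegenerate (D : Digraph') (f : ℕ → ℕ × ℕ) : Prop :=
  ∀ H : Digraph', H.IsSubdigraph D → H.verts.Nonempty →
    ∃ v ∈ H.verts, H.inDeg v < (f v).1 ∨ H.outDeg v < (f v).2

/-- `α` is an `F`-dicolouring of `D`: for each colour `i`, the subdigraph induced by the
vertices coloured `i` is strictly-`Fᵢ`-bidegenerate. -/
def IsDicolouring (D : Digraph') (s : ℕ) (F : Fin s → ℕ → ℕ × ℕ) (α : ℕ → Fin s) : Prop :=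
  ∀ i : Fin s, (D.induce (D.verts.filter fun v => α v = i)).StrictlyBidegenerate (F i)

/-- `D` is `F`-dicolourable. -/
def Dicolourable (D : Digraph') (s : ℕ) (F : Fin s → ℕ → ℕ × ℕ) : Prop :=
  ∃ α : ℕ → Fin s, D.IsDicolouring s F α

/-- `(D,F)` is a valid pair: `D` is connected and the colour budget dominates the
in- and out-degrees at every vertex. -/
def ValidPair (D : Digraph') (s : ℕ) (F : Fin s → ℕ → ℕ × ℕ) : Prop :=
  D.Connected ∧ ∀ v ∈ D.verts,
    D.inDeg v ≤ ∑ i, (F i v).1 ∧ D.outDeg v ≤ ∑ i, (F i v).2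

/-- `(D,F)` is tight: both budget inequalities are equalities at every vertex. -/
def Tight (D : Digraph') (s : ℕ) (F : Fin s → ℕ → ℕ × ℕ) : Prop :=
  ∀ v ∈ D.verts, ∑ i, (F i v).1 = D.inDeg v ∧ ∑ i, (F i v).2 = D.outDeg v

/-- Hard pairs, defined inductively: monochromatic, bicycle, complete, and join hard pairs. -/
inductive IsHardPair : (s : ℕ) → Digraph' → (Fin s → ℕ → ℕ × ℕ) → Prop
  | mono {s : ℕ} {D : Digraph'} {F : Fin s → ℕ → ℕ × ℕ} (i : Fin s)
      (hbi : D.Biconnected)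
      (hi : ∀ v ∈ D.verts, F i v = (D.inDeg v, D.outDeg v))
      (hk : ∀ k : Fin s, k ≠ i → ∀ v ∈ D.verts, F k v = (0, 0)) :
      IsHardPair s D F
  | bicycle {s : ℕ} {D : Digraph'} {F : Fin s → ℕ → ℕ × ℕ} (i j : Fin s) (hij : i ≠ j)
      (hD : D.BidirectedOddCycle)
      (hi : ∀ v ∈ D.verts, F i v = (1, 1))
      (hj : ∀ v ∈ D.verts, F j v = (1, 1))
      (hk : ∀ k : Fin s, k ≠ i → k ≠ j → ∀ v ∈ D.verts, F k v = (0, 0)) :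
      IsHardPair s D F
  | complete {s : ℕ} {D : Digraph'} {F : Fin s → ℕ → ℕ × ℕ}
      (hD : D.BidirectedComplete)
      (hconst : ∀ k : Fin s, ∀ u ∈ D.verts, ∀ v ∈ D.verts, F k u = F k v)
      (hsym : ∀ k : Fin s, ∀ v ∈ D.verts, (F k v).1 = (F k v).2)
      (hsum : ∀ v ∈ D.verts, ∑ k, (F k v).2 = D.verts.card - 1) :
      IsHardPair s D F
  | join {s : ℕ} {D : Digraph'} {F : Fin s → ℕ → ℕ × ℕ}
      (D₁ D₂ : Digraph') (F₁ F₂ : Fin s → ℕ → ℕ × ℕ) (x : ℕ)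
      (h₁ : IsHardPair s D₁ F₁) (h₂ : IsHardPair s D₂ F₂)
      (hx : D₁.verts ∩ D₂.verts = {x})
      (hV : D.verts = D₁.verts ∪ D₂.verts)
      (hA : D.arcs = D₁.arcs ∪ D₂.arcs)
      (hF₁ : ∀ k : Fin s, ∀ v ∈ D₁.verts, v ≠ x → F k v = F₁ k v)
      (hF₂ : ∀ k : Fin s, ∀ v ∈ D₂.verts, v ≠ x → F k v = F₂ k v)
      (hFx : ∀ k : Fin s, F k x = ((F₁ k x).1 + (F₂ k x).1, (F₁ k x).2 + (F₂ k x).2)) :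
      IsHardPair s D F

/-- The sequence of functions of the pair reduced from `(D,F)` by a colouring `α` of
`X ⊆ V(D)`: the budget of colour `i` at `u` decreases by the number of in- and out-neighbours
of `u` inside `X` coloured `i` (truncated at `0`). -/
def reduceF (D : Digraph') {s : ℕ} (F : Fin s → ℕ → ℕ × ℕ) (X : Finset ℕ) (α : ℕ → Fin s) :
    Fin s → ℕ → ℕ × ℕ :=
  fun i u =>
    ((F i u).1 - ((D.inNbrs u ∩ X).filter fun w => α w = i).card,
     (F i u).2 - ((D.outNbrs u ∩ X).filter fun w => α w = i).card)

/-- `B` is a block of `D`: a maximal biconnected subdigraph. -/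
def IsBlock (B D : Digraph') : Prop :=
  B.IsSubdigraph D ∧ B.Biconnected ∧
    ∀ B' : Digraph', B'.IsSubdigraph D → B'.Biconnected → B.IsSubdigraph B' → B' = B

/-- `x` is a cut-vertex of `D`: `D − x` is disconnected. -/
def CutVertex (D : Digraph') (x : ℕ) : Prop :=
  x ∈ D.verts ∧ (D.del {x}).verts.Nonempty ∧ ¬ (D.del {x}).Connected

/-- `B` is an end-block of `D` whose unique cut-vertex (of `D`) in `B` is `x`. -/
def IsEndBlockAt (B D : Digraph') (x : ℕ) : Prop :=
  IsBlock B D ∧ x ∈ B.verts ∧ D.CutVertex x ∧ ∀ y ∈ B.verts, D.CutVertex y → y = x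

/-- `B` is a monochromatic hard end-block with cut-vertex `x`, for colour `c`. -/
def MonoHardEndBlock {s : ℕ} (F : Fin s → ℕ → ℕ × ℕ) (B : Digraph') (x : ℕ) (c : Fin s) : Prop :=
  B.inDeg x ≤ (F c x).1 ∧ B.outDeg x ≤ (F c x).2 ∧
    ∀ v ∈ B.verts, v ≠ x →
      F c v = (B.inDeg v, B.outDeg v) ∧ ∀ k : Fin s, k ≠ c → F k v = (0, 0)

/-- `B` is a bicycle hard end-block with cut-vertex `x`. -/
def BicycleHardEndBlock {s : ℕ} (F : Fin s → ℕ → ℕ × ℕ) (B : Digraph') (x : ℕ) : Prop :=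
  B.BidirectedOddCycle ∧
    ∃ i j : Fin s, i ≠ j ∧
      1 ≤ (F i x).1 ∧ 1 ≤ (F i x).2 ∧ 1 ≤ (F j x).1 ∧ 1 ≤ (F j x).2 ∧
      ∀ v ∈ B.verts, v ≠ x →
        F i v = (1, 1) ∧ F j v = (1, 1) ∧ ∀ k : Fin s, k ≠ i → k ≠ j → F k v = (0, 0)

/-- `B` is a complete hard end-block with cut-vertex `x`. -/
def CompleteHardEndBlock {s : ℕ} (F : Fin s → ℕ → ℕ × ℕ) (B : Digraph') (x : ℕ) : Prop :=
  B.BidirectedComplete ∧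
    (∀ k : Fin s, ∀ u ∈ B.verts, u ≠ x → ∀ v ∈ B.verts, v ≠ x → F k u = F k v) ∧
    (∀ k : Fin s, ∀ v ∈ B.verts, v ≠ x → (F k v).1 = (F k v).2) ∧
    (∀ k : Fin s, ∀ u ∈ B.verts, u ≠ x → (F k u).1 ≤ (F k x).1 ∧ (F k u).2 ≤ (F k x).2)

/-- `B` is a hard end-block with cut-vertex `x`. -/
def HardEndBlock {s : ℕ} (F : Fin s → ℕ → ℕ × ℕ) (B : Digraph') (x : ℕ) : Prop :=
  (∃ c : Fin s, MonoHardEndBlock F B x c) ∨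
    BicycleHardEndBlock F B x ∨ CompleteHardEndBlock F B x

/-- `(D',F')` is the contraction of `(D,F)` with respect to the hard end-block `B` with
cut-vertex `x`, where `u` is a vertex of `B` other than `x`. -/
def IsContraction (D : Digraph') {s : ℕ} (F : Fin s → ℕ → ℕ × ℕ) (B : Digraph') (x u : ℕ)
    (D' : Digraph') (F' : Fin s → ℕ → ℕ × ℕ) : Prop :=
  D' = D.del (B.verts \ {x}) ∧
  (∀ k : Fin s, ∀ v ∈ D'.verts, v ≠ x → F' k v = F k v) ∧
  ((∃ c : Fin s, MonoHardEndBlock F B x c ∧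
      F' c x = ((F c x).1 - B.inDeg x, (F c x).2 - B.outDeg x) ∧
      ∀ k : Fin s, k ≠ c → F' k x = F k x) ∨
   ((¬ ∃ c : Fin s, MonoHardEndBlock F B x c) ∧
      ∀ k : Fin s, F' k x = ((F k x).1 - (F k u).1, (F k x).2 - (F k u).2)))

/-- Property (E): all the functions exceed `1` in the relevant coordinate at every vertex
having an in-(resp. out-)neighbour. -/
def PropE (D : Digraph') {s : ℕ} (F : Fin s → ℕ → ℕ × ℕ) : Prop :=
  ∀ x ∈ D.verts, ∀ c : Fin s,
    (0 < D.inDeg x → 1 ≤ (F c x).1) ∧ (0 < D.outDeg x → 1 ≤ (F c x).2)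

/-- `C` is a directed cycle: connected, and every vertex has in- and out-degree one. -/
def IsDirectedCycle (C : Digraph') : Prop :=
  C.Connected ∧ ∀ v ∈ C.verts, C.inDeg v = 1 ∧ C.outDeg v = 1

/-- `D` is acyclic: it contains no directed cycle. -/
def AcyclicD (D : Digraph') : Prop :=
  ¬ ∃ C : Digraph', C.IsSubdigraph D ∧ C.IsDirectedCycle

/-- `α` is a `k`-dicolouring of `D`: every colour class induces an acyclic subdigraph. -/
def IsKDicolouring (D : Digraph') (k : ℕ) (α : ℕ → Fin k) : Prop :=
  ∀ i : Fin k, AcyclicD (D.induce (D.verts.filter fun v => α v = i))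

/-- The dichromatic number of `D`. -/
noncomputable def dichromatic (D : Digraph') : ℕ :=
  sInf {k : ℕ | ∃ α : ℕ → Fin k, D.IsKDicolouring k α}

end Digraph'

open Digraph'

namespace Digraph'

variable {D H : Digraph'}

/-- The multiplicity (`0` or `1`) of the arc `(u, w)` in `D`. -/
noncomputable def arcCount (D : Digraph') (u w : ℕ) : ℕ := if (u, w) ∈ D.arcs then 1 else 0

@[simp]
theorem mem_inNbrs {u w : ℕ} : w ∈ D.inNbrs u ↔ (w, u) ∈ D.arcs := by
  simp [inNbrs]

@[simp]
theorem mem_outNbrs {u w : ℕ} : w ∈ D.outNbrs u ↔ (u, w) ∈ D.arcs := by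
  simp [outNbrs]

theorem card_inNbrs (D : Digraph') (u : ℕ) : (D.inNbrs u).card = D.inDeg u := by
  refine Finset.card_image_of_injOn ?_
  rintro ⟨a, b⟩ ha ⟨a', b'⟩ ha' h
  simp_all

theorem card_outNbrs (D : Digraph') (u : ℕ) : (D.outNbrs u).card = D.outDeg u := by
  refine Finset.card_image_of_injOn ?_
  rintro ⟨a, b⟩ ha ⟨a', b'⟩ ha' h
  simp_all

@[simp]
theorem verts_del (D : Digraph') (X : Finset ℕ) : (D.del X).verts = D.verts \ X := by
  ext; simp [del, induce]

@[simp]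
theorem mem_arcs_del {X : Finset ℕ} {u w : ℕ} :
    (u, w) ∈ (D.del X).arcs ↔ (u, w) ∈ D.arcs ∧ u ∉ X ∧ w ∉ X := by
  simp only [del, induce, Finset.mem_filter, Finset.mem_sdiff]
  constructor
  · rintro ⟨h, h₁, h₂⟩
    exact ⟨h, h₁.2, h₂.2⟩
  · rintro ⟨h, h₁, h₂⟩
    exact ⟨h, ⟨D.mem_fst _ h, h₁⟩, ⟨D.mem_snd _ h, h₂⟩⟩

theorem inDeg_eq_inDeg_del_add {u v : ℕ} (huv : u ≠ v) :
    D.inDeg u = (D.del {v}).inDeg u + D.arcCount v u := by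
  rw [← card_inNbrs, ← card_inNbrs, arcCount]
  have h : (D.del {v}).inNbrs u = (D.inNbrs u).erase v := by
    ext w
    simp [huv, and_comm]
  rw [h, Finset.card_erase_eq_ite]
  split_ifs with h₁ h₂ h₂
  · have := Finset.card_pos.mpr ⟨v, h₁⟩
    omega
  · simp_all
  · simp_all
  · rfl

theorem outDeg_eq_outDeg_del_add {u v : ℕ} (huv : u ≠ v) :
    D.outDeg u = (D.del {v}).outDeg u + D.arcCount u v := by
  rw [← card_outNbrs, ← card_outNbrs, arcCount]
  have h : (D.del {v}).outNbrs u = (D.outNbrs u).erase v := by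
    ext w
    simp [huv, and_comm]
  rw [h, Finset.card_erase_eq_ite]
  split_ifs with h₁ h₂ h₂
  · have := Finset.card_pos.mpr ⟨v, h₁⟩
    omega
  · simp_all
  · simp_all
  · rfl

theorem reduceF_singleton_self {s : ℕ} (F : Fin s → ℕ → ℕ × ℕ) (v u : ℕ) (c : Fin s) :
    D.reduceF F {v} (fun _ => c) c u =
      ((F c u).1 - D.arcCount v u, (F c u).2 - D.arcCount u v) := by
  have h₁ : (D.inNbrs u ∩ {v}).card = D.arcCount v u := by
    by_cases h : (v, u) ∈ D.arcs <;> simp [arcCount, h]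
  have h₂ : (D.outNbrs u ∩ {v}).card = D.arcCount u v := by
    by_cases h : (u, v) ∈ D.arcs <;> simp [arcCount, h]
  simp [reduceF, h₁, h₂]

theorem reduceF_singleton_of_ne {s : ℕ} (F : Fin s → ℕ → ℕ × ℕ) (v u : ℕ) {c k : Fin s}
    (hk : k ≠ c) : D.reduceF F {v} (fun _ => c) k u = F k u := by
  simp [reduceF, hk.symm]

theorem IsSubdigraph.inDeg_lt (hH : H.IsSubdigraph D) {u w : ℕ} (hw : w ∉ H.verts)
    (h : (w, u) ∈ D.arcs) : H.inDeg u < D.inDeg u := by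
  rw [← card_inNbrs, ← card_inNbrs]
  refine Finset.card_lt_card ((Finset.ssubset_iff_of_subset fun x hx => ?_).mpr
    ⟨w, mem_inNbrs.mpr h, fun h' => hw (H.mem_fst _ (mem_inNbrs.mp h'))⟩)
  exact mem_inNbrs.mpr (hH.2 (mem_inNbrs.mp hx))

theorem IsSubdigraph.outDeg_lt (hH : H.IsSubdigraph D) {u w : ℕ} (hw : w ∉ H.verts)
    (h : (u, w) ∈ D.arcs) : H.outDeg u < D.outDeg u := by
  rw [← card_outNbrs, ← card_outNbrs]
  refine Finset.card_lt_card ((Finset.ssubset_iff_of_subset fun x hx => ?_).mpr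
    ⟨w, mem_outNbrs.mpr h, fun h' => hw (H.mem_snd _ (mem_outNbrs.mp h'))⟩)
  exact mem_outNbrs.mpr (hH.2 (mem_outNbrs.mp hx))

/-- A vertex of a subdigraph missing one of its neighbours has smaller in- or out-degree. -/
theorem IsSubdigraph.deg_lt_of_ugAdj (hH : H.IsSubdigraph D) {u w : ℕ} (hw : w ∉ H.verts)
    (h : D.ugAdj u w) : H.inDeg u < D.inDeg u ∨ H.outDeg u < D.outDeg u :=
  h.2.2.symm.imp (hH.inDeg_lt hw) (hH.outDeg_lt hw)

theorem inDeg_lt_card {u : ℕ} (hu : u ∈ D.verts) : D.inDeg u < D.verts.card := by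
  rw [← card_inNbrs]
  refine Finset.card_lt_card ((Finset.ssubset_iff_of_subset fun x hx => ?_).mpr
    ⟨u, hu, fun h => D.no_loops _ (mem_inNbrs.mp h) rfl⟩)
  exact D.mem_fst _ (mem_inNbrs.mp hx)

theorem outDeg_lt_card {u : ℕ} (hu : u ∈ D.verts) : D.outDeg u < D.verts.card := by
  rw [← card_outNbrs]
  refine Finset.card_lt_card ((Finset.ssubset_iff_of_subset fun x hx => ?_).mpr
    ⟨u, hu, fun h => D.no_loops _ (mem_outNbrs.mp h) rfl⟩)
  exact D.mem_snd _ (mem_outNbrs.mp hx)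

theorem BidirectedComplete.inDeg_eq (hD : D.BidirectedComplete) {u : ℕ} (hu : u ∈ D.verts) :
    D.inDeg u = D.verts.card - 1 := by
  rw [← card_inNbrs, ← Finset.card_erase_of_mem hu]
  congr 1
  ext w
  rw [mem_inNbrs, Finset.mem_erase]
  exact ⟨fun h => ⟨D.no_loops _ h, D.mem_fst _ h⟩, fun h => hD w h.2 u hu h.1⟩

theorem BidirectedComplete.outDeg_eq (hD : D.BidirectedComplete) {u : ℕ} (hu : u ∈ D.verts) :
    D.outDeg u = D.verts.card - 1 := by
  rw [← card_outNbrs, ← Finset.card_erase_of_mem hu]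
  congr 1
  ext w
  rw [mem_outNbrs, Finset.mem_erase]
  exact ⟨fun h => ⟨(D.no_loops _ h).symm, D.mem_snd _ h⟩, fun h => hD u hu w h.2 h.1.symm⟩

/-- A nonempty proper vertex subset of a connected digraph is left by some edge. -/
theorem Connected.exists_ugAdj (hD : D.Connected) {S : Finset ℕ} {u w : ℕ} (hu : u ∈ S)
    (huD : u ∈ D.verts) (hwD : w ∈ D.verts) (hw : w ∉ S) :
    ∃ x ∈ S, ∃ y ∉ S, D.ugAdj x y := by
  by_contra! hS
  have key : ∀ z, Relation.ReflTransGen D.ugAdj u z → z ∈ S := by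
    intro z hz
    induction hz with
    | refl => exact hu
    | tail _ hyz ih => by_contra hz; exact hS _ ih _ hz hyz
  exact hw (key w (hD.2 u huD w hwD))

theorem Connected.exists_nbr (hD : D.Connected) {u w : ℕ} (hu : u ∈ D.verts) (hw : w ∈ D.verts)
    (hwu : w ≠ u) : ∃ y, D.ugAdj u y := by
  obtain ⟨x, hx, y, -, hxy⟩ :=
    hD.exists_ugAdj (Finset.mem_singleton_self u) hu hw (by simpa using hwu)
  rw [Finset.mem_singleton] at hx
  exact ⟨y, hx ▸ hxy⟩

theorem ugAdj.ne {u w : ℕ} (h : D.ugAdj u w) : u ≠ w := by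
  rcases h.2.2 with h | h
  · exact D.no_loops _ h
  · exact (D.no_loops _ h).symm

theorem ugAdj.mem_ugNbrs {u w : ℕ} (h : D.ugAdj u w) : w ∈ D.ugNbrs u := by
  simpa [ugNbrs] using h.2.2.symm

/-- In a biconnected digraph on at least three vertices every vertex has two neighbours. -/
theorem Biconnected.exists_two_nbrs (hD : D.Biconnected) (h3 : 3 ≤ D.verts.card) {u : ℕ}
    (hu : u ∈ D.verts) : ∃ x y, x ≠ y ∧ D.ugAdj u x ∧ D.ugAdj u y := by
  obtain ⟨w, hw, hwu⟩ := Finset.exists_mem_ne (by omega : 1 < D.verts.card) u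
  obtain ⟨x, hx⟩ := hD.2.1.exists_nbr hu hw hwu
  have hux : u ∈ (D.del {x}).verts := by simp [hu, hx.ne]
  have hcard : 1 < (D.del {x}).verts.card := by
    rw [verts_del, Finset.card_sdiff_of_subset (by simpa using hx.2.1), Finset.card_singleton]
    omega
  obtain ⟨w', hw', hwu'⟩ := Finset.exists_mem_ne hcard u
  obtain ⟨y, hy⟩ := (hD.2.2 x hx.2.1).exists_nbr hux hw' hwu'
  have hyx : y ∈ D.verts ∧ y ≠ x := by simpa using hy.2.1
  exact ⟨x, y, hyx.2.symm, hx, hu, hyx.1, hy.2.2.imp (fun h => (mem_arcs_del.mp h).1)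
    fun h => (mem_arcs_del.mp h).1⟩

theorem Biconnected.isCycleUG (hD : D.Biconnected) (h3 : 3 ≤ D.verts.card)
    (h : ∀ u ∈ D.verts, (D.ugNbrs u).card ≤ 2) : D.IsCycleUG := by
  refine ⟨hD.2.1, fun u hu => le_antisymm (h u hu) ?_⟩
  obtain ⟨x, y, hxy, hx, hy⟩ := hD.exists_two_nbrs h3 hu
  exact Finset.one_lt_card.mpr ⟨x, hx.mem_ugNbrs, y, hy.mem_ugNbrs, hxy⟩

theorem card_ugNbrs_lt_card {u : ℕ} (hu : u ∈ D.verts) : (D.ugNbrs u).card < D.verts.card := by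
  refine Finset.card_lt_card ((Finset.ssubset_iff_of_subset fun x hx => ?_).mpr ⟨u, hu, ?_⟩)
  · simp only [ugNbrs, Finset.mem_union, mem_inNbrs, mem_outNbrs] at hx
    exact hx.elim (D.mem_fst _) (D.mem_snd _)
  · simp only [ugNbrs, Finset.mem_union, mem_inNbrs, mem_outNbrs, or_self]
    exact fun h => D.no_loops _ h rfl

theorem arcCount_le_one (D : Digraph') (u w : ℕ) : D.arcCount u w ≤ 1 := by
  unfold arcCount; split_ifs <;> simp

theorem ugAdj.arcCount_pos {u w : ℕ} (h : D.ugAdj u w) :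
    0 < D.arcCount u w ∨ 0 < D.arcCount w u := by
  rcases h.2.2 with h | h <;> simp [arcCount, h]

/-- The non-inductive hard pairs, where a bicycle is only remembered through its shape. -/
def BaseHard (s : ℕ) (D : Digraph') (F : Fin s → ℕ → ℕ × ℕ) : Prop :=
  (∃ i, (∀ v ∈ D.verts, F i v = (D.inDeg v, D.outDeg v)) ∧
    ∀ k, k ≠ i → ∀ v ∈ D.verts, F k v = (0, 0)) ∨
  D.IsCycleUG ∨
  (D.BidirectedComplete ∧ (∀ k, ∀ u ∈ D.verts, ∀ v ∈ D.verts, F k u = F k v) ∧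
    (∀ k, ∀ v ∈ D.verts, (F k v).1 = (F k v).2) ∧
    ∀ v ∈ D.verts, ∑ k, (F k v).2 = D.verts.card - 1)

theorem BaseHard.congr {s : ℕ} {F G : Fin s → ℕ → ℕ × ℕ} (h : BaseHard s D F)
    (hFG : ∀ k, ∀ v ∈ D.verts, G k v = F k v) : BaseHard s D G := by
  rcases h with ⟨i, hi, hk⟩ | h | ⟨hD, hc, hs, hsum⟩
  · exact Or.inl ⟨i, fun v hv => (hFG i v hv).trans (hi v hv),
      fun k hki v hv => (hFG k v hv).trans (hk k hki v hv)⟩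
  · exact Or.inr (Or.inl h)
  · refine Or.inr (Or.inr ⟨hD, fun k u hu v hv => ?_, fun k v hv => ?_, fun v hv => ?_⟩)
    · rw [hFG k u hu, hFG k v hv, hc k u hu v hv]
    · rw [hFG k v hv, hs k v hv]
    · rw [← hsum v hv]
      exact Finset.sum_congr rfl fun k _ => by rw [hFG k v hv]

theorem IsHardPair.eq_zero_of_verts_eq_singleton {s : ℕ} {F : Fin s → ℕ → ℕ × ℕ}
    (h : IsHardPair s D F) {x : ℕ} (hx : D.verts = {x}) (k : Fin s) : F k x = (0, 0) := by
  induction h with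
  | mono i hbi _ _ =>
    have := hbi.1
    simp [hx] at this
  | bicycle i j hij hD _ _ _ =>
    have h₁ := hD.2.1.2 x (by simp [hx])
    have h₂ := card_ugNbrs_lt_card (u := x) (by rw [hx]; simp)
    rw [h₁, hx] at h₂
    simp at h₂
  | complete hD hconst hsym hsum =>
    have hxm := hx ▸ Finset.mem_singleton_self x
    have h₁ := hsum x hxm
    rw [hx, Finset.card_singleton, Nat.sub_self, Finset.sum_eq_zero_iff] at h₁
    have h₂ := h₁ k (Finset.mem_univ k)
    exact Prod.ext ((hsym k x hxm).trans h₂) h₂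
  | join D₁ D₂ F₁ F₂ y _ _ hy hV _ _ _ hFx ih₁ ih₂ =>
    have hym : y ∈ D₁.verts ∩ D₂.verts := hy ▸ Finset.mem_singleton_self y
    rw [Finset.mem_inter] at hym
    have hyx : y = x := by
      have : y ∈ ({x} : Finset ℕ) := by rw [← hx, hV]; simp [hym.1]
      simpa using this
    subst hyx
    have hs₁ : D₁.verts = {y} :=
      (Finset.Nonempty.subset_singleton_iff ⟨y, hym.1⟩).mp
        (by rw [← hx, hV]; exact Finset.subset_union_left)
    have hs₂ : D₂.verts = {y} :=
      (Finset.Nonempty.subset_singleton_iff ⟨y, hym.2⟩).mp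
        (by rw [← hx, hV]; exact Finset.subset_union_right)
    simp [hFx k, ih₁ hs₁, ih₂ hs₂]

theorem eq_of_verts_eq_of_arcs_eq (hV : D.verts = H.verts) (hA : D.arcs = H.arcs) : D = H := by
  cases D; cases H; simp_all

theorem arcs_eq_empty_of_verts_eq_singleton {x : ℕ} (hx : D.verts = {x}) : D.arcs = ∅ := by
  refine Finset.eq_empty_of_forall_notMem fun a ha => D.no_loops a ha ?_
  have h₁ := D.mem_fst a ha
  have h₂ := D.mem_snd a ha
  simp_all

/-- Gluing two digraphs, each having a further vertex, at a vertex is never biconnected. -/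
theorem not_biconnected_of_glue {D₁ D₂ : Digraph'} {x y₁ y₂ : ℕ}
    (hx : D₁.verts ∩ D₂.verts = {x}) (hV : D.verts = D₁.verts ∪ D₂.verts)
    (hA : D.arcs = D₁.arcs ∪ D₂.arcs) (hy₁ : y₁ ∈ D₁.verts) (hy₁x : y₁ ≠ x)
    (hy₂ : y₂ ∈ D₂.verts) (hy₂x : y₂ ≠ x) : ¬ D.Biconnected := by
  intro hD
  have hmem : ∀ z, z ∈ D₁.verts → z ∈ D₂.verts → z = x := fun z h₁ h₂ => by
    simpa [hx] using Finset.mem_inter.mpr ⟨h₁, h₂⟩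
  have hxm : x ∈ D₁.verts ∩ D₂.verts := hx ▸ Finset.mem_singleton_self x
  have hxD : x ∈ D.verts := by rw [hV]; exact Finset.mem_union_left _ (Finset.mem_inter.mp hxm).1
  obtain ⟨u, hu, w, hw, huw⟩ := (hD.2.2 x hxD).exists_ugAdj (S := D₁.verts) (w := y₂) hy₁
    (by simp [hV, hy₁, hy₁x]) (by simp [hV, hy₂, hy₂x]) fun h => hy₂x (hmem _ h hy₂)
  have hux : u ≠ x := by have := huw.1; simp at this; exact this.2
  rcases huw.2.2 with h | h
  · rcases Finset.mem_union.mp (hA ▸ (mem_arcs_del.mp h).1) with h | h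
    · exact hw (D₁.mem_snd _ h)
    · exact hux (hmem u hu (D₂.mem_fst _ h))
  · rcases Finset.mem_union.mp (hA ▸ (mem_arcs_del.mp h).1) with h | h
    · exact hw (D₁.mem_fst _ h)
    · exact hux (hmem u hu (D₂.mem_snd _ h))

/-- A biconnected hard pair is not a proper join. -/
theorem IsHardPair.baseHard {s : ℕ} {F : Fin s → ℕ → ℕ × ℕ} (h : IsHardPair s D F)
    (hD : D.Biconnected) : BaseHard s D F := by
  induction h with
  | mono i _ hi hk => exact Or.inl ⟨i, hi, hk⟩
  | bicycle _ _ _ hc _ _ _ => exact Or.inr (Or.inl hc.2.1)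
  | complete hc hconst hsym hsum => exact Or.inr (Or.inr ⟨hc, hconst, hsym, hsum⟩)
  | @join D F D₁ D₂ F₁ F₂ x h₁ h₂ hx hV hA hF₁ hF₂ hFx ih₁ ih₂ =>
    have hxm : x ∈ D₁.verts ∧ x ∈ D₂.verts :=
      Finset.mem_inter.mp (hx ▸ Finset.mem_singleton_self x)
    by_cases hs₁ : D₁.verts = {x}
    · obtain rfl : D = D₂ := eq_of_verts_eq_of_arcs_eq (by rw [hV, hs₁]; simp [hxm.2])
        (by rw [hA, arcs_eq_empty_of_verts_eq_singleton hs₁, Finset.empty_union])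
      refine (ih₂ hD).congr fun k u hu => ?_
      by_cases hux : u = x
      · subst hux
        simp [hFx k, h₁.eq_zero_of_verts_eq_singleton hs₁ k]
      · exact hF₂ k u hu hux
    by_cases hs₂ : D₂.verts = {x}
    · obtain rfl : D = D₁ := eq_of_verts_eq_of_arcs_eq (by rw [hV, hs₂]; simp [hxm.1])
        (by rw [hA, arcs_eq_empty_of_verts_eq_singleton hs₂, Finset.union_empty])
      refine (ih₁ hD).congr fun k u hu => ?_
      by_cases hux : u = x
      · subst hux
        simp [hFx k, h₂.eq_zero_of_verts_eq_singleton hs₂ k]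
      · exact hF₁ k u hu hux
    have key : ∀ S : Finset ℕ, x ∈ S → S ≠ {x} → ∃ y ∈ S, y ≠ x := fun S hS hne => by
      by_contra! h
      exact hne (Finset.eq_singleton_iff_unique_mem.mpr ⟨hS, h⟩)
    obtain ⟨y₁, hy₁, hy₁x⟩ := key _ hxm.1 hs₁
    obtain ⟨y₂, hy₂, hy₂x⟩ := key _ hxm.2 hs₂
    exact absurd hD (not_biconnected_of_glue hx hV hA hy₁ hy₁x hy₂ hy₂x)

/-- Dicolourability from a bipartition of the vertex set. -/
theorem dicolourable_of_bipartition {F : Fin 2 → ℕ → ℕ × ℕ} {c c' : Fin 2} (hcc' : c' ≠ c)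
    (S : Finset ℕ)
    (hS : ∀ H : Digraph', H.IsSubdigraph D → H.verts ⊆ S → H.verts.Nonempty →
      ∃ u ∈ H.verts, H.inDeg u < (F c u).1 ∨ H.outDeg u < (F c u).2)
    (hS' : ∀ H : Digraph', H.IsSubdigraph D → H.verts ⊆ D.verts \ S → H.verts.Nonempty →
      ∃ u ∈ H.verts, H.inDeg u < (F c' u).1 ∨ H.outDeg u < (F c' u).2) :
    D.Dicolourable 2 F := by
  refine ⟨fun u => if u ∈ S then c else c', fun i H hH hne => ?_⟩
  have hsub : H.IsSubdigraph D :=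
    ⟨hH.1.trans Finset.inter_subset_left, hH.2.trans (Finset.filter_subset _ _)⟩
  have hcol : ∀ u ∈ H.verts, (if u ∈ S then c else c') = i := fun u hu =>
    (Finset.mem_filter.mp (Finset.mem_inter.mp (hH.1 hu)).2).2
  obtain rfl | rfl : i = c ∨ i = c' := by omega
  · refine hS H hsub (fun u hu => ?_) hne
    by_contra huS
    exact hcc' (by simpa [huS] using hcol u hu)
  · refine hS' H hsub (fun u hu => Finset.mem_sdiff.mpr ⟨hsub.1 hu, fun huS => ?_⟩) hne
    exact hcc' (by simpa [huS] using (hcol u hu).symm)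

/-- If colour `c` is only available at `v` and on the edges at `v`, and colour `c'` is exactly the
degree in `D − v`, then colouring `v` and one of its neighbours with `c` gives a dicolouring. -/
theorem dicolourable_of_star {F : Fin 2 → ℕ → ℕ × ℕ} {c c' : Fin 2} (hcc' : c' ≠ c) {v x y : ℕ}
    (hcon : (D.del {v}).Connected) (hxy : x ≠ y) (hx : D.ugAdj v x) (hy : D.ugAdj v y)
    (hFv : F c v = (D.inDeg v, D.outDeg v))
    (hF : ∀ u ∈ D.verts, u ≠ v → F c' u = ((D.del {v}).inDeg u, (D.del {v}).outDeg u) ∧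
      F c u = (D.arcCount v u, D.arcCount u v)) :
    D.Dicolourable 2 F := by
  refine dicolourable_of_bipartition hcc' {v, x} (fun H hH hsub hne => ?_)
    fun H hH hsub hne => ?_
  · by_cases hvH : v ∈ H.verts
    · refine ⟨v, hvH, ?_⟩
      rw [hFv]
      refine hH.deg_lt_of_ugAdj (fun h => ?_) hy
      have := hsub h
      simp [hy.ne.symm, hxy.symm] at this
    · have hHx : H.verts = {x} := by
        refine Finset.eq_singleton_iff_nonempty_unique_mem.mpr ⟨hne, fun u hu => ?_⟩
        have := hsub hu
        simp only [Finset.mem_insert, Finset.mem_singleton] at this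
        exact this.resolve_left fun h => hvH (h ▸ hu)
      have hxH : x ∈ H.verts := by simp [hHx]
      have h₁ := inDeg_lt_card hxH
      have h₂ := outDeg_lt_card hxH
      rw [hHx, Finset.card_singleton] at h₁ h₂
      refine ⟨x, hxH, ?_⟩
      rw [(hF x hx.2.1 hx.ne.symm).2]
      have := hx.arcCount_pos
      simp only
      omega
  · have hmem : ∀ u ∈ H.verts, u ∈ D.verts ∧ u ≠ v ∧ u ≠ x := fun u hu => by
      simpa using hsub hu
    have hH' : H.IsSubdigraph (D.del {v}) := by
      refine ⟨fun u hu => by simpa using ⟨(hmem u hu).1, (hmem u hu).2.1⟩, ?_⟩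
      rintro ⟨a, b⟩ hab
      exact mem_arcs_del.mpr ⟨hH.2 hab, by simpa using (hmem a (H.mem_fst _ hab)).2.1,
        by simpa using (hmem b (H.mem_snd _ hab)).2.1⟩
    obtain ⟨u, hu⟩ := hne
    obtain ⟨a, ha, b, hb, hab⟩ := hcon.exists_ugAdj hu (hH'.1 hu)
      (w := x) (by simpa using ⟨hx.2.1, hx.ne.symm⟩) fun h => (hmem x h).2.2 rfl
    refine ⟨a, ha, ?_⟩
    rw [(hF a (hmem a ha).1 (hmem a ha).2.1).1]
    exact hH'.deg_lt_of_ugAdj hb hab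

theorem exists_deg_lt_of_card_le {f : ℕ → ℕ × ℕ} {b : ℕ} (hne : H.verts.Nonempty)
    (hb : H.verts.card ≤ b) (hf : ∀ u ∈ H.verts, b ≤ (f u).1) :
    ∃ u ∈ H.verts, H.inDeg u < (f u).1 ∨ H.outDeg u < (f u).2 := by
  obtain ⟨u, hu⟩ := hne
  exact ⟨u, hu, Or.inl ((inDeg_lt_card hu).trans_le (hb.trans (hf u hu)))⟩

/-- Dicolouring when, away from `v`, colour `c'` has a constant budget and colour `c` a constant
budget increased on the edges at `v`. -/
theorem dicolourable_of_const_add_star {F : Fin 2 → ℕ → ℕ × ℕ} {c c' : Fin 2} (hcc' : c' ≠ c)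
    {v x y a b : ℕ} (hxy : x ≠ y) (hx : D.ugAdj v x) (hy : D.ugAdj v y)
    (hFv : F c v = (D.inDeg v, D.outDeg v)) (hb : 0 < b) (hab : a + b + 1 = (D.del {v}).verts.card)
    (hF : ∀ u ∈ D.verts, u ≠ v → F c u = (a + D.arcCount v u, a + D.arcCount u v) ∧
      F c' u = (b, b)) :
    D.Dicolourable 2 F := by
  have hv := hx.1
  rw [verts_del, Finset.sdiff_singleton_eq_erase] at hab
  have hxm : ({x} : Finset ℕ) ⊆ (D.verts.erase v).erase y := by
    simp [hxy, hx.ne.symm, hx.2.1]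
  have hym : y ∈ D.verts.erase v := by simp [hy.ne.symm, hy.2.1]
  obtain ⟨S, hxS, hS, hcard⟩ := Finset.exists_subsuperset_card_eq hxm (n := a + 1)
    (by simp) (by rw [Finset.card_erase_of_mem hym]; omega)
  have hS' : ∀ u ∈ S, u ≠ y ∧ u ≠ v ∧ u ∈ D.verts := fun u hu => by simpa using hS hu
  refine dicolourable_of_bipartition hcc' (insert v S) (fun H hH hsub hne => ?_)
    fun H hH hsub hne => ?_
  · by_cases hvH : v ∈ H.verts
    · refine ⟨v, hvH, ?_⟩
      rw [hFv]
      refine hH.deg_lt_of_ugAdj (fun h => ?_) hy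
      rcases Finset.mem_insert.mp (hsub h) with h | h
      · exact hy.ne h.symm
      · exact (hS' y h).1 rfl
    have hHS : H.verts ⊆ S := fun u hu =>
      (Finset.mem_insert.mp (hsub hu)).resolve_left fun h => hvH (h ▸ hu)
    by_cases hxH : x ∈ H.verts
    · refine ⟨x, hxH, ?_⟩
      rw [(hF x hx.2.1 hx.ne.symm).1]
      have h₁ := inDeg_lt_card hxH
      have h₂ := outDeg_lt_card hxH
      have h₃ := Finset.card_le_card hHS
      have h₄ := hx.arcCount_pos
      simp only
      omega
    · have hlt : H.verts.card < S.card := Finset.card_lt_card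
        ((Finset.ssubset_iff_of_subset hHS).mpr ⟨x, hxS (Finset.mem_singleton_self x), hxH⟩)
      refine exists_deg_lt_of_card_le (b := a) hne (by omega) fun u hu => ?_
      have := hS' u (hHS hu)
      rw [(hF u this.2.2 this.2.1).1]
      exact Nat.le_add_right _ _
  · have hsub' : H.verts ⊆ D.verts.erase v \ S := fun u hu => by
      have := hsub hu
      simp only [Finset.mem_sdiff, Finset.mem_insert, not_or, Finset.mem_erase] at this ⊢
      tauto
    have hle := Finset.card_le_card hsub'
    rw [Finset.card_sdiff_of_subset (hS.trans (Finset.erase_subset _ _))] at hle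
    refine exists_deg_lt_of_card_le (b := b) hne (by omega) fun u hu => ?_
    have := hsub' hu
    simp only [Finset.mem_sdiff, Finset.mem_erase] at this
    rw [(hF u this.1.2 this.1.1).2]

/-- Dicolouring when the budgets are constant away from `v`, where colour `c` has a surplus. -/
theorem dicolourable_of_surplus {F : Fin 2 → ℕ → ℕ × ℕ} {c c' : Fin 2} (hcc' : c' ≠ c)
    {v p q : ℕ} (hv : v ∈ D.verts) (hpq : p + q + 1 = D.verts.card)
    (hF : ∀ u ∈ D.verts, u ≠ v → F c u = (p, p) ∧ F c' u = (q, q))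
    (hFv : p < (F c v).1 ∨ p < (F c v).2) :
    D.Dicolourable 2 F := by
  have hce := Finset.card_erase_of_mem hv
  obtain ⟨S, hS, hcard⟩ := Finset.exists_subset_card_eq (s := D.verts.erase v) (n := p) (by omega)
  have hS' : ∀ u ∈ S, u ≠ v ∧ u ∈ D.verts := fun u hu => by simpa using hS hu
  refine dicolourable_of_bipartition hcc' (insert v S) (fun H hH hsub hne => ?_)
    fun H hH hsub hne => ?_
  · by_cases hvH : v ∈ H.verts
    · refine ⟨v, hvH, ?_⟩
      have h₁ := inDeg_lt_card hvH
      have h₂ := outDeg_lt_card hvH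
      have h₃ := (Finset.card_le_card hsub).trans (Finset.card_insert_le v S)
      omega
    · have hHS : H.verts ⊆ S := fun u hu =>
        (Finset.mem_insert.mp (hsub hu)).resolve_left fun h => hvH (h ▸ hu)
      refine exists_deg_lt_of_card_le (b := p) hne (hcard ▸ Finset.card_le_card hHS) fun u hu => ?_
      have := hS' u (hHS hu)
      rw [(hF u this.2 this.1).1]
  · have hsub' : H.verts ⊆ D.verts.erase v \ S := fun u hu => by
      have := hsub hu
      simp only [Finset.mem_sdiff, Finset.mem_insert, not_or, Finset.mem_erase] at this ⊢
      tauto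
    have hle := Finset.card_le_card hsub'
    rw [Finset.card_sdiff_of_subset hS] at hle
    refine exists_deg_lt_of_card_le (b := q) hne (by omega) fun u hu => ?_
    have := hsub' hu
    simp only [Finset.mem_sdiff, Finset.mem_erase] at this
    rw [(hF u this.1.2 this.1.1).2]

theorem sum_fin_two_of_ne {c c' : Fin 2} (hcc' : c' ≠ c) (g : Fin 2 → ℕ) :
    ∑ i, g i = g c + g c' := by
  rw [Fin.sum_univ_two]
  obtain ⟨rfl, rfl⟩ | ⟨rfl, rfl⟩ : (c = 0 ∧ c' = 1) ∨ (c = 1 ∧ c' = 0) := by omega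
  · rfl
  · exact Nat.add_comm _ _

/-- The budgets of a tight pair all of whose vertices but `v` only have colour `c`. -/
def MonoOff (D : Digraph') (F : Fin 2 → ℕ → ℕ × ℕ) (v : ℕ) (c c' : Fin 2) : Prop :=
  ∀ u ∈ D.verts, u ≠ v → F c' u = (0, 0) ∧ F c u = (D.inDeg u, D.outDeg u)

/-- Away from `v`, colour `c'` has the degrees of `D − v` and colour `c` the edges at `v`. -/
def StarOff (D : Digraph') (F : Fin 2 → ℕ → ℕ × ℕ) (v : ℕ) (c c' : Fin 2) : Prop :=
  ∀ u ∈ D.verts, u ≠ v → F c' u = ((D.del {v}).inDeg u, (D.del {v}).outDeg u) ∧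
    F c u = (D.arcCount v u, D.arcCount u v)

/-- `D − v` is complete and, away from `v`, colour `c'` has a constant budget and colour `c` a
constant budget increased on the edges at `v`. -/
def CompleteOff (D : Digraph') (F : Fin 2 → ℕ → ℕ × ℕ) (v : ℕ) (c c' : Fin 2) : Prop :=
  (D.del {v}).BidirectedComplete ∧ ∃ a b, a + b + 1 = (D.del {v}).verts.card ∧
    ∀ u ∈ D.verts, u ≠ v → F c u = (a + D.arcCount v u, a + D.arcCount u v) ∧ F c' u = (b, b)

theorem Tight.add_eq {F : Fin 2 → ℕ → ℕ × ℕ} (ht : D.Tight 2 F) {c c' : Fin 2} (hcc' : c' ≠ c)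
    {u : ℕ} (hu : u ∈ D.verts) :
    (F c u).1 + (F c' u).1 = D.inDeg u ∧ (F c u).2 + (F c' u).2 = D.outDeg u := by
  have := ht u hu
  rwa [sum_fin_two_of_ne hcc', sum_fin_two_of_ne hcc'] at this

/-- The shape of a tight pair for which colouring `v` with `c` leaves a hard pair. -/
theorem shape_of_hard_reduce {F : Fin 2 → ℕ → ℕ × ℕ} (ht : D.Tight 2 F) {c c' : Fin 2}
    (hcc' : c' ≠ c) {v : ℕ} (hbi : (D.del {v}).Biconnected) (hnc : ¬ (D.del {v}).IsCycleUG)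
    (h : IsHardPair 2 (D.del {v}) (D.reduceF F {v} (fun _ => c))) :
    MonoOff D F v c c' ∨ StarOff D F v c c' ∨ CompleteOff D F v c c' := by
  have hmem : ∀ u ∈ D.verts, u ≠ v → u ∈ (D.del {v}).verts := fun u hu huv => by simp [hu, huv]
  rcases h.baseHard hbi with ⟨i, hi, hk⟩ | h | ⟨hD, hc, hs, hsum⟩
  · obtain rfl | rfl : i = c ∨ i = c' := by omega
    · refine Or.inl fun u hu huv => ?_
      have h₁ := hk c' hcc' u (hmem u hu huv)
      rw [reduceF_singleton_of_ne F v u hcc'] at h₁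
      have h₂ := ht.add_eq hcc' hu
      rw [h₁] at h₂
      exact ⟨h₁, Prod.ext h₂.1 h₂.2⟩
    · refine Or.inr (Or.inl fun u hu huv => ?_)
      have h₁ := hi u (hmem u hu huv)
      rw [reduceF_singleton_of_ne F v u hcc'] at h₁
      have h₂ := ht.add_eq hcc' hu
      rw [inDeg_eq_inDeg_del_add huv, outDeg_eq_outDeg_del_add huv, h₁] at h₂
      exact ⟨h₁, Prod.ext (by simp only at h₂ ⊢; omega) (by simp only at h₂ ⊢; omega)⟩
  · exact absurd h hnc
  · refine Or.inr (Or.inr ⟨hD, ?_⟩)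
    obtain ⟨w, hw⟩ := hbi.2.1.1
    have hpos := Finset.card_pos.mpr ⟨w, hw⟩
    have hsumw := hsum w hw
    rw [sum_fin_two_of_ne hcc'] at hsumw
    refine ⟨_, _, by rw [hsumw]; omega, fun u hu huv => ?_⟩
    have hu' := hmem u hu huv
    have h₁ := hc c u hu' w hw
    have h₂ := hc c' u hu' w hw
    have h₃ := hs c u hu'
    have h₄ := hs c' u hu'
    rw [← h₁, ← h₂] at hsumw ⊢
    rw [reduceF_singleton_of_ne F v u hcc', reduceF_singleton_self] at *
    have h₅ := ht.add_eq hcc' hu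
    rw [inDeg_eq_inDeg_del_add huv, outDeg_eq_outDeg_del_add huv, hD.inDeg_eq hu',
      hD.outDeg_eq hu'] at h₅
    simp only at h₃ h₄ hsumw ⊢
    exact ⟨Prod.ext (by simp only; omega) (by simp only; omega), Prod.ext h₄ rfl⟩

theorem StarOff.completeOff {F : Fin 2 → ℕ → ℕ × ℕ} {c c' : Fin 2} {v : ℕ}
    (h : StarOff D F v c c') (hD : (D.del {v}).BidirectedComplete)
    (hne : (D.del {v}).verts.Nonempty) : CompleteOff D F v c c' := by
  have hpos := Finset.card_pos.mpr hne
  refine ⟨hD, 0, (D.del {v}).verts.card - 1, by omega, fun u hu huv => ?_⟩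
  have hu' : u ∈ (D.del {v}).verts := by simp [hu, huv]
  obtain ⟨h₁, h₂⟩ := h u hu huv
  rw [h₁, h₂, hD.inDeg_eq hu', hD.outDeg_eq hu']
  simp

theorem isHardPair_of_monoOff {F : Fin 2 → ℕ → ℕ × ℕ} {c c' : Fin 2} (hcc' : c' ≠ c) {v : ℕ}
    (hD : D.Biconnected) (h : MonoOff D F v c c') (hFv : F c' v = (0, 0))
    (hFv' : F c v = (D.inDeg v, D.outDeg v)) : IsHardPair 2 D F := by
  refine IsHardPair.mono c hD (fun u hu => ?_) fun k hk u hu => ?_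
  · by_cases huv : u = v
    · rw [huv, hFv']
    · exact (h u hu huv).2
  · obtain rfl : k = c' := by omega
    by_cases huv : u = v
    · rw [huv, hFv]
    · exact (h u hu huv).1

/-- The case where only one colour is available at `v`. -/
theorem dicolourable_of_shape_of_eq_zero {F : Fin 2 → ℕ → ℕ × ℕ} (ht : D.Tight 2 F)
    (hnh : ¬ IsHardPair 2 D F) {c c' : Fin 2} (hcc' : c' ≠ c) {v : ℕ} (hv : v ∈ D.verts)
    (hbi : D.Biconnected) (h3 : 3 ≤ D.verts.card) (hcon : (D.del {v}).Connected)
    (hFv : F c' v = (0, 0))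
    (h : MonoOff D F v c c' ∨ StarOff D F v c c' ∨ CompleteOff D F v c c') :
    D.Dicolourable 2 F := by
  have hFv' : F c v = (D.inDeg v, D.outDeg v) := by
    have := ht.add_eq hcc' hv
    rw [hFv] at this
    exact Prod.ext this.1 this.2
  obtain ⟨x, y, hxy, hx, hy⟩ := hbi.exists_two_nbrs h3 hv
  rcases h with h | h | ⟨_, a, b, hab, h⟩
  · exact absurd (isHardPair_of_monoOff hcc' hbi h hFv hFv') hnh
  · exact dicolourable_of_star hcc' hcon hxy hx hy hFv' h
  · rcases Nat.eq_zero_or_pos b with rfl | hb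
    · refine absurd (isHardPair_of_monoOff hcc' hbi (fun u hu huv => ?_) hFv hFv') hnh
      have := ht.add_eq hcc' hu
      rw [(h u hu huv).2] at this
      exact ⟨(h u hu huv).2, Prod.ext this.1 this.2⟩
    · exact dicolourable_of_const_add_star hcc' hxy hx hy hFv' hb hab h

/-- Complete digraphs with budgets constant away from `v`. -/
theorem dicolourable_of_complete {F : Fin 2 → ℕ → ℕ × ℕ} (ht : D.Tight 2 F)
    (hnh : ¬ IsHardPair 2 D F) {c c' : Fin 2} (hcc' : c' ≠ c) {v p q : ℕ} (hv : v ∈ D.verts)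
    (hD : D.BidirectedComplete) (hpq : p + q + 1 = D.verts.card)
    (hF : ∀ u ∈ D.verts, u ≠ v → F c u = (p, p) ∧ F c' u = (q, q)) :
    D.Dicolourable 2 F := by
  have hsum := ht.add_eq hcc' hv
  rw [hD.inDeg_eq hv, hD.outDeg_eq hv] at hsum
  by_cases h₁ : p < (F c v).1 ∨ p < (F c v).2
  · exact dicolourable_of_surplus hcc' hv hpq hF h₁
  by_cases h₂ : q < (F c' v).1 ∨ q < (F c' v).2
  · exact dicolourable_of_surplus hcc'.symm hv (by omega) (fun u hu huv => (hF u hu huv).symm) h₂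
  have hall : ∀ u ∈ D.verts, F c u = (p, p) ∧ F c' u = (q, q) := fun u hu => by
    by_cases huv : u = v
    · subst huv
      exact ⟨Prod.ext (by simp only; omega) (by simp only; omega),
        Prod.ext (by simp only; omega) (by simp only; omega)⟩
    · exact hF u hu huv
  have hk : ∀ k : Fin 2, k = c ∨ k = c' := fun k => by omega
  refine absurd
    (IsHardPair.complete hD (fun k u hu w hw => ?_) (fun k u hu => ?_) fun u hu => ?_) hnh
  · rcases hk k with rfl | rfl
    · rw [(hall u hu).1, (hall w hw).1]
    · rw [(hall u hu).2, (hall w hw).2]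
  · rcases hk k with rfl | rfl
    · rw [(hall u hu).1]
    · rw [(hall u hu).2]
  · rw [sum_fin_two_of_ne hcc', (hall u hu).1, (hall u hu).2]
    simp only
    omega

theorem dicolourable_of_completeOff {F : Fin 2 → ℕ → ℕ × ℕ} (ht : D.Tight 2 F)
    (hnh : ¬ IsHardPair 2 D F) {c c' : Fin 2} (hcc' : c' ≠ c) {v x : ℕ} (hx : D.ugAdj v x)
    (h : CompleteOff D F v c c') (h' : CompleteOff D F v c' c) : D.Dicolourable 2 F := by
  obtain ⟨hD, a, b, hab, h⟩ := h
  obtain ⟨-, a', b', hab', h'⟩ := h'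
  have hpos := hx.arcCount_pos
  have harc : ∀ u ∈ D.verts, u ≠ v → D.arcCount v u = 1 ∧ D.arcCount u v = 1 := by
    have key : ∀ u ∈ D.verts, u ≠ v → a + D.arcCount v u = b' ∧ a + D.arcCount u v = b' :=
      fun u hu huv => Prod.ext_iff.mp ((h u hu huv).1.symm.trans (h' u hu huv).2)
    intro u hu huv
    have h₁ := key x hx.2.1 hx.ne.symm
    have h₂ := key u hu huv
    have h₃ := D.arcCount_le_one v x
    have h₄ := D.arcCount_le_one x v
    omega
  have harc' : ∀ u w, D.arcCount u w = 1 → (u, w) ∈ D.arcs := fun u w huw => by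
    by_contra hn
    simp [arcCount, hn] at huw
  have hDc : D.BidirectedComplete := fun u hu w hw huw => by
    by_cases huv : u = v
    · subst huv
      exact harc' _ _ (harc w hw huw.symm).1
    · by_cases hwv : w = v
      · subst hwv
        exact harc' _ _ (harc u hu huv).2
      · exact (mem_arcs_del.mp (hD u (by simp [hu, huv]) w (by simp [hw, hwv]) huw)).1
  have hcard : (D.del {v}).verts.card + 1 = D.verts.card := by
    rw [verts_del, Finset.sdiff_singleton_eq_erase, Finset.card_erase_add_one hx.1]
  refine dicolourable_of_complete ht hnh hcc' hx.1 hDc (p := a + 1) (q := b) (by omega)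
    fun u hu huv => ⟨?_, (h u hu huv).2⟩
  rw [(h u hu huv).1, (harc u hu huv).1, (harc u hu huv).2]

theorem arcCount_le_of_shape {F : Fin 2 → ℕ → ℕ × ℕ} {c c' : Fin 2} {v u : ℕ}
    (h : MonoOff D F v c c' ∨ StarOff D F v c c' ∨ CompleteOff D F v c c') (hu : u ∈ D.verts)
    (huv : u ≠ v) : D.arcCount v u ≤ (F c u).1 ∧ D.arcCount u v ≤ (F c u).2 := by
  rcases h with h | h | ⟨_, a, b, _, h⟩
  · rw [(h u hu huv).2, inDeg_eq_inDeg_del_add huv, outDeg_eq_outDeg_del_add huv]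
    simp
  · rw [(h u hu huv).2]
    simp
  · rw [(h u hu huv).1]
    simp

theorem not_monoOff_of_shape {F : Fin 2 → ℕ → ℕ × ℕ} {c c' : Fin 2} {v x : ℕ} (hx : D.ugAdj v x)
    (h : MonoOff D F v c c' ∨ StarOff D F v c c' ∨ CompleteOff D F v c c') :
    ¬ MonoOff D F v c' c := fun h' => by
  have h₁ := arcCount_le_of_shape h hx.2.1 hx.ne.symm
  rw [(h' x hx.2.1 hx.ne.symm).1] at h₁
  have := hx.arcCount_pos
  simp only at h₁
  omega

theorem isCycleUG_of_starOff {F : Fin 2 → ℕ → ℕ × ℕ} {c c' : Fin 2} {v : ℕ}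
    (hbi : (D.del {v}).Biconnected) (h3 : 3 ≤ (D.del {v}).verts.card)
    (h : StarOff D F v c c') (h' : StarOff D F v c' c) : (D.del {v}).IsCycleUG := by
  refine hbi.isCycleUG h3 fun u hu => ?_
  obtain ⟨hu, huv⟩ : u ∈ D.verts ∧ u ≠ v := by simpa using hu
  have h₁ := Prod.ext_iff.mp ((h u hu huv).1.symm.trans (h' u hu huv).2)
  have h₂ := D.arcCount_le_one v u
  have h₃ := D.arcCount_le_one u v
  have h₄ := Finset.card_union_le ((D.del {v}).inNbrs u) ((D.del {v}).outNbrs u)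
  rw [card_inNbrs, card_outNbrs] at h₄
  simp only at h₁
  exact h₄.trans (by omega)

end Digraph'

/-- **Lemma (colouring the centre of a star).** Let `(D,F=(f₁,f₂))` be a valid tight non-hard
pair and `v ∈ V(D)` be such that both `D` and `D − v` are biconnected while neither `UG(D)`
nor `UG(D − v)` is a cycle. Then either there is a colour `c` such that colouring `v` with `c`
is safe (`f_c(v) ≠ (0,0)`, `D − v` connected, and the reduced pair is hard iff `(D,F)` is),
or `D` is `F`-dicolourable. -/
theorem safe_colour_or_dicolourable
    (D : Digraph') (F : Fin 2 → ℕ → ℕ × ℕ)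
    (hvalid : D.ValidPair 2 F) (htight : D.Tight 2 F)
    (hnothard : ¬ IsHardPair 2 D F)
    (v : ℕ) (hv : v ∈ D.verts)
    (hbi : D.Biconnected) (hbi' : (D.del {v}).Biconnected)
    (hnc : ¬ D.IsCycleUG) (hnc' : ¬ (D.del {v}).IsCycleUG) :
    (∃ c : Fin 2, F c v ≠ (0, 0) ∧ (D.del {v}).Connected ∧
      (IsHardPair 2 (D.del {v}) (D.reduceF F {v} (fun _ => c)) ↔ IsHardPair 2 D F)) ∨
    D.Dicolourable 2 F := by
  have hcard : (D.del {v}).verts.card + 1 = D.verts.card := by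
    rw [verts_del, Finset.sdiff_singleton_eq_erase, Finset.card_erase_add_one hv]
  have h2 := hbi'.1
  have h3 : 3 ≤ (D.del {v}).verts.card := by
    by_contra hlt
    refine hnc (hbi.isCycleUG (by omega) fun u hu => ?_)
    have := card_ugNbrs_lt_card hu
    omega
  by_contra! hcon
  obtain ⟨hsafe, hnd⟩ := hcon
  have hshape : ∀ c c' : Fin 2, c' ≠ c → F c v ≠ (0, 0) →
      MonoOff D F v c c' ∨ StarOff D F v c c' ∨ CompleteOff D F v c c' := fun c c' hcc' hc => by
    refine shape_of_hard_reduce htight hcc' hbi' hnc' ?_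
    rcases hsafe c hc hbi'.2.1 with h | h
    · exact h.1
    · exact absurd h.2 hnothard
  have hzero : ∀ c c' : Fin 2, c' ≠ c → F c v ≠ (0, 0) → F c' v ≠ (0, 0) :=
    fun c c' hcc' hc hc' => hnd (dicolourable_of_shape_of_eq_zero htight hnothard hcc' hv hbi
      (by omega) hbi'.2.1 hc' (hshape c c' hcc' hc))
  obtain ⟨x, -, -, hx, -⟩ := hbi.exists_two_nbrs (by omega) hv
  have h01 : (1 : Fin 2) ≠ 0 := by decide
  have hne : F 0 v ≠ (0, 0) := by
    intro h0
    by_cases h1 : F 1 v = (0, 0)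
    · have hsum := htight.add_eq h01 hv
      rw [h0, h1] at hsum
      have hsub : IsSubdigraph ⟨∅, ∅, by simp, by simp, by simp⟩ D := ⟨by simp, by simp⟩
      have := hsub.deg_lt_of_ugAdj (by simp) hx
      simp only at hsum
      omega
    · exact hzero 1 0 h01.symm h1 h0
  have s₀ := hshape 0 1 h01 hne
  have s₁ := hshape 1 0 h01.symm (hzero 0 1 h01 hne)
  have t₀ := s₀.resolve_left (not_monoOff_of_shape hx s₁)
  have t₁ := s₁.resolve_left (not_monoOff_of_shape hx s₀)
  have hne' := hbi'.2.1.1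
  rcases t₀ with t₀ | t₀ <;> rcases t₁ with t₁ | t₁
  · exact hnc' (isCycleUG_of_starOff hbi' h3 t₀ t₁)
  · exact hnd (dicolourable_of_completeOff htight hnothard h01 hx (t₀.completeOff t₁.1 hne') t₁)
  · exact hnd (dicolourable_of_completeOff htight hnothard h01 hx t₀ (t₁.completeOff t₀.1 hne'))
  · exact hnd (dicolourable_of_completeOff htight hnothard h01 hx t₀ t₁)
end

section
/- Let (D,F = (f₁,f₂)) be a valid pair that is not a hard pair. Then D is F-dicolourable. -/
open scoped Classical

open Digraph'

namespace DegenerateColouring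

/-- Adjacency in the underlying graph. A digraph is encoded by `R : Bool → ℕ → ℕ → Prop`, where
`R true u v` says that `uv` is an arc and `R false u v` says that `vu` is an arc. -/
def Adj (R : Bool → ℕ → ℕ → Prop) (u v : ℕ) : Prop := ∃ b, R b u v

/-- The two relations `R true` and `R false` are converse to each other and loopless. -/
structure IsArcRel (R : Bool → ℕ → ℕ → Prop) : Prop where
  symm : ∀ b u v, R b u v → R (!b) v u
  irrefl : ∀ b u, ¬ R b u u

/-- The in-degree (`b = true`) or out-degree (`b = false`) of `v` towards `S`. -/
noncomputable def deg (R : Bool → ℕ → ℕ → Prop) (S : Finset ℕ) (v : ℕ) (b : Bool) : ℕ :=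
  (S.filter fun u => R b u v).card

/-- The degree of `v` towards the vertices of `S` coloured `c`. -/
noncomputable def colDeg (R : Bool → ℕ → ℕ → Prop) (γ : ℕ → Fin 2) (c : Fin 2) (S : Finset ℕ)
    (v : ℕ) (b : Bool) : ℕ :=
  (S.filter fun u => R b u v ∧ γ u = c).card

/-- `γ` colours the subdigraph induced by `S` with strictly bidegenerate colour classes. -/
def Good (R : Bool → ℕ → ℕ → Prop) (f : Fin 2 → ℕ → Bool → ℕ) (S : Finset ℕ)
    (γ : ℕ → Fin 2) : Prop :=
  ∀ c, ∀ T ⊆ S, T.Nonempty → (∀ v ∈ T, γ v = c) → ∃ v ∈ T, ∃ b, deg R T v b < f c v b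

/-- The budgets left once the vertices of `S` have been coloured by `γ`. -/
noncomputable def red (R : Bool → ℕ → ℕ → Prop) (f : Fin 2 → ℕ → Bool → ℕ) (S : Finset ℕ)
    (γ : ℕ → Fin 2) : Fin 2 → ℕ → Bool → ℕ :=
  fun c v b => f c v b - colDeg R γ c S v b

/-- The subdigraph induced by `S` is connected. -/
def Conn (R : Bool → ℕ → ℕ → Prop) (S : Finset ℕ) : Prop :=
  S.Nonempty ∧ ∀ u ∈ S, ∀ v ∈ S,
    Relation.ReflTransGen (fun p q => p ∈ S ∧ q ∈ S ∧ Adj R p q) u v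

/-- The budgets dominate the degrees inside `S`. -/
def Valid (R : Bool → ℕ → ℕ → Prop) (f : Fin 2 → ℕ → Bool → ℕ) (S : Finset ℕ) : Prop :=
  ∀ v ∈ S, ∀ b, deg R S v b ≤ f 0 v b + f 1 v b

/-- A connected valid pair that cannot be coloured. -/
structure Crit (R : Bool → ℕ → ℕ → Prop) (f : Fin 2 → ℕ → Bool → ℕ) (S : Finset ℕ) : Prop where
  conn : Conn R S
  valid : Valid R f S
  not_good : ∀ γ, ¬ Good R f S γ

variable {R : Bool → ℕ → ℕ → Prop} {f f' : Fin 2 → ℕ → Bool → ℕ} {S T : Finset ℕ}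
  {γ γ' : ℕ → Fin 2}

theorem IsArcRel.adj_symm (hR : IsArcRel R) {u v : ℕ} (h : Adj R u v) : Adj R v u := by
  obtain ⟨b, hb⟩ := h
  exact ⟨!b, hR.symm b u v hb⟩

theorem IsArcRel.not_iff (hR : IsArcRel R) (b : Bool) (u v : ℕ) : R (!b) u v ↔ R b v u := by
  constructor
  · intro h
    simpa using hR.symm _ _ _ h
  · exact hR.symm _ _ _

theorem IsArcRel.adj_ne (hR : IsArcRel R) {u v : ℕ} (h : Adj R u v) : u ≠ v := by
  rintro rfl
  obtain ⟨b, hb⟩ := h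
  exact hR.irrefl b u hb

theorem deg_mono (h : S ⊆ T) (v : ℕ) (b : Bool) : deg R S v b ≤ deg R T v b :=
  Finset.card_le_card (Finset.filter_subset_filter _ h)

theorem deg_union_le (S T : Finset ℕ) (v : ℕ) (b : Bool) :
    deg R (S ∪ T) v b ≤ deg R S v b + deg R T v b := by
  unfold deg
  rw [Finset.filter_union]
  exact Finset.card_union_le _ _

theorem deg_union (h : Disjoint S T) (v : ℕ) (b : Bool) :
    deg R (S ∪ T) v b = deg R S v b + deg R T v b := by
  unfold deg
  rw [Finset.filter_union]
  exact Finset.card_union_of_disjoint (Finset.disjoint_filter_filter h)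

theorem colDeg_zero_add_one (γ : ℕ → Fin 2) (S : Finset ℕ) (v : ℕ) (b : Bool) :
    colDeg R γ 0 S v b + colDeg R γ 1 S v b = deg R S v b := by
  unfold colDeg deg
  rw [← Finset.card_union_of_disjoint]
  · congr 1
    ext u
    simp only [Finset.mem_union, Finset.mem_filter]
    have := Fin.exists_fin_two.1 ⟨γ u, rfl⟩
    tauto
  · rw [Finset.disjoint_left]
    intro u hu hu'
    simp only [Finset.mem_filter] at hu hu'
    have := hu.2.2.symm.trans hu'.2.2
    exact absurd this (by decide)

theorem deg_le_colDeg {c : Fin 2} (hTS : T ⊆ S) (hT : ∀ v ∈ T, γ v = c) (v : ℕ) (b : Bool) :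
    deg R T v b ≤ colDeg R γ c S v b := by
  refine Finset.card_le_card fun u hu => ?_
  simp only [Finset.mem_filter] at hu ⊢
  exact ⟨hTS hu.1, hu.2, hT u hu.1⟩

theorem deg_erase_self (hR : IsArcRel R) (S : Finset ℕ) (v : ℕ) (b : Bool) :
    deg R (S.erase v) v b = deg R S v b := by
  unfold deg
  congr 1
  ext u
  simp only [Finset.mem_filter, Finset.mem_erase]
  constructor
  · tauto
  · rintro ⟨h1, h2⟩
    refine ⟨⟨?_, h1⟩, h2⟩
    rintro rfl
    exact hR.irrefl b u h2

theorem colDeg_erase_self (hR : IsArcRel R) (γ : ℕ → Fin 2) (c : Fin 2) (S : Finset ℕ) (v : ℕ)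
    (b : Bool) : colDeg R γ c (S.erase v) v b = colDeg R γ c S v b := by
  unfold colDeg
  congr 1
  ext u
  simp only [Finset.mem_filter, Finset.mem_erase]
  constructor
  · tauto
  · rintro ⟨h1, h2⟩
    refine ⟨⟨?_, h1⟩, h2⟩
    rintro rfl
    exact hR.irrefl b u h2.1

theorem colDeg_eq_zero {c : Fin 2} {v : ℕ} (h : ∀ u ∈ S, ¬ Adj R u v) (b : Bool) :
    colDeg R γ c S v b = 0 := by
  unfold colDeg
  rw [Finset.card_eq_zero, Finset.filter_eq_empty_iff]
  exact fun u hu hh => h u hu ⟨b, hh.1⟩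

theorem Good.mono (h : Good R f T γ) (hST : S ⊆ T) : Good R f S γ :=
  fun c U hU => h c U (hU.trans hST)

theorem Good.congr (h : Good R f S γ) (hγ : ∀ v ∈ S, γ v = γ' v)
    (hf : ∀ c, ∀ v ∈ S, ∀ b, f c v b ≤ f' c v b) : Good R f' S γ' := by
  intro c U hU hne hc
  obtain ⟨v, hv, b, hb⟩ := h c U hU hne fun v hv => (hγ v (hU hv)).trans (hc v hv)
  exact ⟨v, hv, b, hb.trans_le (hf c v (hU hv) b)⟩

theorem good_singleton (hR : IsArcRel R) {x : ℕ} {b : Bool} (h : 0 < f (γ x) x b) :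
    Good R f {x} γ := by
  intro c U hU hne hc
  obtain rfl := (Finset.subset_singleton_iff.1 hU).resolve_left hne.ne_empty
  refine ⟨x, by simp, b, ?_⟩
  rw [← hc x (by simp)]
  suffices deg R {x} x b = 0 by omega
  unfold deg
  rw [Finset.card_eq_zero, Finset.filter_eq_empty_iff]
  intro u hu
  rw [Finset.mem_singleton] at hu
  subst hu
  exact hR.irrefl b u

/-- Colour `S` first and then `T`, within the budgets left by `S`. -/
theorem Good.union (hS : Good R f S γ) (hT : Good R (red R f S γ) T γ') :
    Good R f (S ∪ T) (fun v => if v ∈ S then γ v else γ' v) := by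
  intro c U hU hne hc
  beta_reduce at hc
  by_cases hUT : (U \ S).Nonempty
  · obtain ⟨v, hv, b, hb⟩ := hT c (U \ S)
      (fun u hu => by
        rw [Finset.mem_sdiff] at hu
        exact (Finset.mem_union.1 (hU hu.1)).resolve_left hu.2) hUT
      (fun u hu => by
        rw [Finset.mem_sdiff] at hu
        have := hc u hu.1
        rwa [if_neg hu.2] at this)
    rw [Finset.mem_sdiff] at hv
    refine ⟨v, hv.1, b, ?_⟩
    have h1 : deg R U v b ≤ deg R (U \ S) v b + deg R (U ∩ S) v b := by
      conv_lhs => rw [← Finset.sdiff_union_inter U S]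
      exact deg_union_le _ _ _ _
    have h2 : deg R (U ∩ S) v b ≤ colDeg R γ c S v b := by
      refine deg_le_colDeg Finset.inter_subset_right (fun u hu => ?_) v b
      rw [Finset.mem_inter] at hu
      have := hc u hu.1
      rwa [if_pos hu.2] at this
    unfold red at hb
    omega
  · have hUS : U ⊆ S := by
      rw [Finset.not_nonempty_iff_eq_empty, Finset.sdiff_eq_empty_iff_subset] at hUT
      exact hUT
    refine hS c U hUS hne fun v hv => ?_
    have := hc v hv
    rwa [if_pos (hUS hv)] at this

theorem conn_insert (hR : IsArcRel R) (hS : Conn R S) {u w : ℕ} (hu : u ∈ S) (h : Adj R u w) :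
    Conn R (insert w S) := by
  refine ⟨⟨w, by simp⟩, ?_⟩
  have hmono : ∀ p ∈ S, ∀ q ∈ S, Relation.ReflTransGen
      (fun p q => p ∈ insert w S ∧ q ∈ insert w S ∧ Adj R p q) p q := fun p hp q hq =>
    Relation.ReflTransGen.mono (fun a b hab =>
      ⟨Finset.mem_insert_of_mem hab.1, Finset.mem_insert_of_mem hab.2.1, hab.2.2⟩)
      _ _ (hS.2 p hp q hq)
  have hto : ∀ p ∈ insert w S, Relation.ReflTransGen
      (fun p q => p ∈ insert w S ∧ q ∈ insert w S ∧ Adj R p q) p u := by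
    intro p hp
    rcases Finset.mem_insert.1 hp with rfl | hp
    · exact .single ⟨by simp, Finset.mem_insert_of_mem hu, hR.adj_symm h⟩
    · exact hmono p hp u hu
  have hfrom : ∀ p ∈ insert w S, Relation.ReflTransGen
      (fun p q => p ∈ insert w S ∧ q ∈ insert w S ∧ Adj R p q) u p := by
    intro p hp
    rcases Finset.mem_insert.1 hp with rfl | hp
    · exact .single ⟨Finset.mem_insert_of_mem hu, by simp, h⟩
    · exact hmono u hu p hp
  exact fun p hp q hq => (hto p hp).trans (hfrom q hq)

/-- In a connected digraph there is an edge leaving each proper nonempty set of vertices. -/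
theorem Conn.exists_adj (hS : Conn R S) (hTS : T ⊆ S) (hne : T.Nonempty) (hT : T ≠ S) :
    ∃ u ∈ T, ∃ w ∈ S, w ∉ T ∧ Adj R u w := by
  by_contra! hcon
  obtain ⟨u, hu⟩ := hne
  refine hT (hTS.antisymm fun v hv => ?_)
  induction hS.2 u (hTS hu) v hv with
  | refl => exact hu
  | tail _ hbc ih =>
    by_contra hc
    exact hcon _ (ih hbc.1) _ hbc.2.1 hc hbc.2.2

theorem Conn.exists_erase (hR : IsArcRel R) (hS : Conn R S) {x : ℕ} (hx : x ∈ S)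
    (hne : S ≠ {x}) : ∃ z ∈ S, z ≠ x ∧ Conn R (S.erase z) := by
  obtain ⟨T, hT, hmax⟩ := Finset.exists_max_image
    (S.powerset.filter fun T => x ∈ T ∧ T ≠ S ∧ Conn R T) Finset.card
    ⟨{x}, by
      simp only [Finset.mem_filter, Finset.mem_powerset, Finset.singleton_subset_iff,
        Finset.mem_singleton, true_and]
      refine ⟨hx, hne.symm, by simp, fun u hu v hv => ?_⟩
      rw [Finset.mem_singleton] at hu hv
      rw [hu, hv]⟩
  simp only [Finset.mem_filter, Finset.mem_powerset] at hT hmax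
  obtain ⟨hTS, hxT, hTne, hTc⟩ := hT
  obtain ⟨u, hu, w, hw, hwT, hadj⟩ := hS.exists_adj hTS ⟨x, hxT⟩ hTne
  have hins : insert w T = S := by
    by_contra hcon
    have := hmax (insert w T) ⟨Finset.insert_subset hw hTS, Finset.mem_insert_of_mem hxT, hcon,
      conn_insert hR hTc hu hadj⟩
    rw [Finset.card_insert_of_notMem hwT] at this
    omega
  refine ⟨w, hw, fun h => hwT (h ▸ hxT), ?_⟩
  rwa [← hins, Finset.erase_insert hwT]

theorem Conn.exists_adj_of_mem (hR : IsArcRel R) (hS : Conn R S) {x : ℕ} (hx : x ∈ S)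
    (hne : S ≠ {x}) : ∃ u ∈ S, Adj R u x := by
  obtain ⟨u, hu, w, hw, -, h⟩ := hS.exists_adj (T := {x}) (by simpa using hx) (by simp) hne.symm
  rw [Finset.mem_singleton] at hu
  subst hu
  exact ⟨w, hw, hR.adj_symm h⟩

/-- Colouring a single vertex `z` keeps the pair valid. -/
theorem valid_red_singleton (hv : ∀ v ∈ S, ∀ b, deg R S v b ≤ f 0 v b + f 1 v b) {z : ℕ}
    (hz : z ∈ S) : Valid R (red R f {z} γ) (S.erase z) := by
  intro v hvS b
  have h1 := hv v (Finset.mem_of_mem_erase hvS) b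
  have h2 : deg R S v b = deg R {z} v b + deg R (S.erase z) v b := by
    rw [← deg_union (by simp)]
    congr 1
    rw [← Finset.insert_eq, Finset.insert_erase hz]
  have h3 := colDeg_zero_add_one (R := R) γ {z} v b
  unfold red
  omega

/-- A connected valid pair with a strict inequality at some vertex can be coloured. -/
theorem exists_good_of_lt (hR : IsArcRel R) : ∀ (n : ℕ) (S : Finset ℕ)
    (f : Fin 2 → ℕ → Bool → ℕ), S.card = n → Conn R S → Valid R f S → ∀ x ∈ S, ∀ b,
      deg R S x b < f 0 x b + f 1 x b → ∃ γ, Good R f S γ := by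
  intro n
  induction n with
  | zero =>
    intro S f hn hc
    exact absurd (Finset.card_eq_zero.1 hn) hc.1.ne_empty
  | succ n ih =>
    intro S f hn hc hv x hx b hlt
    have hpos : ∀ z b', 0 < f 0 z b' + f 1 z b' → ∃ c, 0 < f c z b' := by
      intro z b' h
      by_cases h0 : 0 < f 0 z b'
      · exact ⟨0, h0⟩
      · exact ⟨1, by omega⟩
    by_cases hS : S = {x}
    · subst hS
      obtain ⟨c, hcx⟩ := hpos x b (by omega)
      exact ⟨fun _ => c, good_singleton hR hcx⟩
    · obtain ⟨z, hz, hzx, hzc⟩ := hc.exists_erase hR hx hS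
      obtain ⟨u, hu, b', hub⟩ := hc.exists_adj_of_mem hR hz (by
        rintro rfl
        exact hzx (Finset.mem_singleton.1 hx).symm)
      have hdz : 0 < deg R S z b' := Finset.card_pos.2 ⟨u, by simp [hu, hub]⟩
      obtain ⟨c, hcz⟩ := hpos z b' (hdz.trans_le (hv z hz b'))
      have hx' : deg R (S.erase z) x b < red R f {z} (fun _ => c) 0 x b +
          red R f {z} (fun _ => c) 1 x b := by
        have h2 : deg R S x b = deg R {z} x b + deg R (S.erase z) x b := by
          rw [← deg_union (by simp)]
          congr 1
          rw [← Finset.insert_eq, Finset.insert_erase hz]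
        have h3 := colDeg_zero_add_one (R := R) (fun _ => c) {z} x b
        unfold red
        omega
      obtain ⟨γ, hγ⟩ := ih (S.erase z) (red R f {z} fun _ => c)
        (by rw [Finset.card_erase_of_mem hz]; omega) hzc (valid_red_singleton hv hz) x
        (Finset.mem_erase.2 ⟨hzx.symm, hx⟩) b hx'
      have := (good_singleton (γ := fun _ => c) hR hcz).union hγ
      rw [← Finset.insert_eq, Finset.insert_erase hz] at this
      exact ⟨_, this⟩

/-- Deleting a vertex from a connected pair, valid at all other vertices, leaves a colourable
pair. -/
theorem exists_good_erase (hR : IsArcRel R) (hc : Conn R S) {x : ℕ} (hx : x ∈ S)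
    (hv : ∀ v ∈ S, v ≠ x → ∀ b, deg R S v b ≤ f 0 v b + f 1 v b) :
    ∃ γ, Good R f (S.erase x) γ := by
  obtain ⟨γ, hγ⟩ := exists_good_of_lt hR S.card S
    (fun c v b => if v = x then deg R S x b + 1 else f c v b) rfl hc
    (fun v hvS b => by
      by_cases h : v = x
      · subst h
        simp only [if_true]
        omega
      · simpa only [if_neg h] using hv v hvS h b) x hx true (by simp only [if_true]; omega)
  refine ⟨γ, (hγ.mono (Finset.erase_subset x S)).congr (fun _ _ => rfl) fun c v hvS b => ?_⟩
  rw [if_neg (Finset.ne_of_mem_erase hvS)]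

theorem Crit.sum_eq (hR : IsArcRel R) (h : Crit R f S) {v : ℕ} (hv : v ∈ S) (b : Bool) :
    f 0 v b + f 1 v b = deg R S v b := by
  refine le_antisymm (not_lt.1 fun hlt => ?_) (h.valid v hv b)
  obtain ⟨γ, hγ⟩ := exists_good_of_lt hR S.card S f rfl h.conn h.valid v hv b hlt
  exact h.not_good γ hγ

/-- In a colouring of a critical pair minus `x`, the budgets at `x` are used up exactly. -/
theorem Crit.colDeg_eq (hR : IsArcRel R) (h : Crit R f S) {x : ℕ} (hx : x ∈ S)
    (hγ : Good R f (S.erase x) γ) (c : Fin 2) (b : Bool) : colDeg R γ c S x b = f c x b := by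
  have hle : ∀ c, f c x b ≤ colDeg R γ c S x b := by
    intro c
    by_contra! hlt
    have := hγ.union (γ' := fun _ => c) (T := {x}) (good_singleton hR (b := b) (by
      unfold red
      rw [colDeg_erase_self hR]
      omega))
    rw [Finset.union_comm, ← Finset.insert_eq, Finset.insert_erase hx] at this
    exact h.not_good _ this
  have h0 := hle 0
  have h1 := hle 1
  have h2 := h.sum_eq hR hx b
  have h3 := colDeg_zero_add_one (R := R) γ S x b
  rcases Fin.exists_fin_two.1 ⟨c, rfl⟩ with rfl | rfl <;> omega

/-- The uncoloured vertex can be moved along an edge. -/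
theorem Crit.shift (hR : IsArcRel R) (h : Crit R f S) {x y : ℕ} (hx : x ∈ S) (hy : y ∈ S)
    (hγ : Good R f (S.erase x) γ) (hxy : Adj R x y) :
    Good R f (S.erase y) (γ ∘ Equiv.swap x y) := by
  obtain ⟨b, hb⟩ := hR.adj_symm hxy
  have hne := hR.adj_ne hxy
  have hlt : colDeg R γ (γ y) ((S.erase x).erase y) x b < colDeg R γ (γ y) S x b := by
    refine Finset.card_lt_card ⟨Finset.filter_subset_filter _
      ((Finset.erase_subset _ _).trans (Finset.erase_subset _ _)), fun hsub => ?_⟩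
    have : y ∈ _ := hsub (by simp [hy, hb])
    simp at this
  rw [h.colDeg_eq hR hx hγ] at hlt
  have := (hγ.mono (Finset.erase_subset y _)).union (γ' := fun _ => γ y) (T := {x})
    (good_singleton hR (b := b) (by unfold red; omega))
  have hS : (S.erase x).erase y ∪ {x} = S.erase y := by
    ext v
    simp only [Finset.mem_union, Finset.mem_erase, Finset.mem_singleton]
    constructor
    · rintro (h | rfl)
      · tauto
      · exact ⟨hne, hx⟩
    · tauto
  rw [hS] at this
  refine this.congr (fun v hv => ?_) fun _ _ _ _ => le_rfl
  rw [Finset.mem_erase] at hv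
  by_cases hvx : v = x
  · subst hvx
    simp
  · have : v ∈ (S.erase x).erase y := by simp [hv, hvx]
    rw [if_pos this, Function.comp_apply, Equiv.swap_apply_of_ne_of_ne hvx hv.1]


theorem exists_eq_append_of_not_nodup {α : Type*} : ∀ {l : List α}, ¬ l.Nodup →
    ∃ y l₁ l₂ l₃, l = l₁ ++ y :: (l₂ ++ y :: l₃)
  | [], h => absurd List.nodup_nil h
  | z :: t, h => by
    by_cases hz : z ∈ t
    · obtain ⟨l₂, l₃, rfl⟩ := List.append_of_mem hz
      exact ⟨z, [], l₂, l₃, rfl⟩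
    · obtain ⟨y, l₁, l₂, l₃, rfl⟩ :=
        exists_eq_append_of_not_nodup (l := t) fun ht => h (List.nodup_cons.2 ⟨hz, ht⟩)
      exact ⟨y, z :: l₁, l₂, l₃, rfl⟩

/-- A shortest path between two disjoint sets of vertices is simple and its interior avoids both
sets. -/
theorem exists_short_path {α : Type*} {r : α → α → Prop} {P Q : α → Prop}
    (hPQ : ∀ u, P u → ¬ Q u) {u v : α} (h : Relation.ReflTransGen r u v) (hu : P u) (hv : Q v) :
    ∃ a m b, P a ∧ Q b ∧ (a :: (m ++ [b])).IsChain r ∧ (a :: (m ++ [b])).Nodup ∧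
      ∀ y ∈ m, ¬ P y ∧ ¬ Q y := by
  have hex : ∃ n a m b, P a ∧ Q b ∧ (a :: (m ++ [b])).IsChain r ∧ m.length = n := by
    obtain ⟨l, hl, hlast⟩ := List.exists_isChain_cons_of_relationReflTransGen h
    rcases List.eq_nil_or_concat' l with rfl | ⟨m, b, rfl⟩
    · simp only [List.getLast_singleton] at hlast
      exact absurd (hlast ▸ hv) (hPQ u hu)
    · refine ⟨_, u, m, b, hu, ?_, hl, rfl⟩
      rw [List.getLast_cons (by simp), List.getLast_append_singleton] at hlast
      exact hlast ▸ hv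
  obtain ⟨a, m, b, ha, hb, hc, hm⟩ := Nat.find_spec hex
  have hmin : ∀ a' m' b', P a' → Q b' → (a' :: (m' ++ [b'])).IsChain r →
      m.length ≤ m'.length := fun a' m' b' ha' hb' hc' => by
    rw [hm]
    exact Nat.find_min' hex ⟨a', m', b', ha', hb', hc', rfl⟩
  have hmid : ∀ y ∈ m, ¬ P y ∧ ¬ Q y := by
    intro y hy
    obtain ⟨m₁, m₂, rfl⟩ := List.append_of_mem hy
    have hc' : (a :: m₁ ++ y :: (m₂ ++ [b])).IsChain r := by simpa using hc
    rw [List.isChain_split] at hc'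
    constructor
    · intro hP
      have := hmin y m₂ b hP hb hc'.2
      simp at this
      omega
    · intro hQ
      have := hmin a m₁ y ha hQ hc'.1
      simp at this
  refine ⟨a, m, b, ha, hb, hc, ?_, hmid⟩
  have hmn : m.Nodup := by
    by_contra hcon
    obtain ⟨y, m₁, m₂, m₃, rfl⟩ := exists_eq_append_of_not_nodup hcon
    have hc' : (a :: m₁ ++ y :: (m₂ ++ y :: (m₃ ++ [b]))).IsChain r := by simpa using hc
    rw [List.isChain_split] at hc'
    have hc₂ := (List.isChain_split.1 (List.cons_append ▸ hc'.2)).2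
    have := hmin a (m₁ ++ y :: m₃) b ha hb (by
      have : (a :: m₁ ++ y :: (m₃ ++ [b])).IsChain r := List.isChain_split.2 ⟨hc'.1, hc₂⟩
      simpa using this)
    simp at this
    omega
  rw [List.nodup_cons, List.nodup_append]
  have ham : a ∉ m := fun h => (hmid a h).1 ha
  have hbm : b ∉ m := fun h => (hmid b h).2 hb
  have hab : a ≠ b := fun h => hPQ a ha (h ▸ hb)
  refine ⟨by simp [ham, hab], hmn, by simp, ?_⟩
  intro y hy z hz
  rw [List.mem_singleton] at hz
  subst hz
  exact fun h => hbm (h ▸ hy)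

/-- The colour of at most two neighbours of `x` changes while all coloured degrees of `x` stay
the same. -/
theorem colDeg_pair {x a b : ℕ} (ha : a ∈ S) (hb : b ∈ S) (hab : a ≠ b)
    (hγ : ∀ u, Adj R u x → u ≠ a → u ≠ b → γ u = γ' u) {s t : Fin 2}
    (hs : γ' a = s) (ht : γ' b = t) (c : Fin 2) (β : Bool)
    (h : colDeg R γ c S x β = colDeg R γ' c S x β) :
    (if R β a x ∧ γ a = c then 1 else 0) + (if R β b x ∧ γ b = c then 1 else 0) =
      (if R β a x ∧ s = c then 1 else 0) + (if R β b x ∧ t = c then 1 else 0) := by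
  subst hs ht
  unfold colDeg at h
  rw [Finset.card_filter, Finset.card_filter, ← Finset.add_sum_erase _ _ ha,
    ← Finset.add_sum_erase _ _ ha,
    ← Finset.add_sum_erase _ _ (Finset.mem_erase.2 ⟨hab.symm, hb⟩),
    ← Finset.add_sum_erase _ _ (Finset.mem_erase.2 ⟨hab.symm, hb⟩)] at h
  have hrest : ∑ u ∈ (S.erase a).erase b, (if R β u x ∧ γ u = c then 1 else 0) =
      ∑ u ∈ (S.erase a).erase b, (if R β u x ∧ γ' u = c then 1 else 0) := by
    refine Finset.sum_congr rfl fun u hu => ?_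
    rw [Finset.mem_erase, Finset.mem_erase] at hu
    by_cases hR : R β u x
    · rw [hγ u ⟨β, hR⟩ hu.2.1 hu.1]
    · simp [hR]
  rw [hrest] at h
  omega

theorem fin_two_eq_of_ne {i j k : Fin 2} (h : i ≠ k) (h' : j ≠ k) : i = j := by
  omega

/-- The game of moving an uncoloured vertex (the hole) around a biconnected digraph with vertex set
`S`: `Cfg x γ` says that `γ` is a colouring with hole `x`. -/
structure Game (R : Bool → ℕ → ℕ → Prop) (S : Finset ℕ) (Cfg : ℕ → (ℕ → Fin 2) → Prop) :
    Prop where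
  rel : IsArcRel R
  mem : ∀ b u v, R b u v → u ∈ S ∧ v ∈ S
  sconn : Conn R S
  conn : ∀ x, ∀ u ∈ S, ∀ v ∈ S, u ≠ x → v ≠ x →
    Relation.ReflTransGen (fun p q => p ≠ x ∧ q ≠ x ∧ Adj R p q) u v
  shift : ∀ x y γ, Cfg x γ → Adj R x y → Cfg y (γ ∘ Equiv.swap x y)
  count : ∀ x γ γ', Cfg x γ → Cfg x γ' → ∀ c b, colDeg R γ c S x b = colDeg R γ' c S x b
  nbr : ∀ x γ, Cfg x γ → ∀ c, ∃ u, Adj R u x ∧ γ u = c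

namespace Game

variable {Cfg : ℕ → (ℕ → Fin 2) → Prop} {x a b : ℕ} {m : List ℕ}

theorem mem_left (G : Game R S Cfg) {u v : ℕ} (h : Adj R u v) : u ∈ S :=
  (G.mem _ _ _ h.choose_spec).1

theorem mem_right (G : Game R S Cfg) {u v : ℕ} (h : Adj R u v) : v ∈ S :=
  (G.mem _ _ _ h.choose_spec).2

theorem move (G : Game R S Cfg) : ∀ (l : List ℕ) {x : ℕ} {γ : ℕ → Fin 2}, Cfg x γ →
    (x :: l).IsChain (Adj R) → Cfg ((x :: l).getLast (by simp)) (γ ∘ (x :: l).formPerm)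
  | [], x, γ, h, _ => by simpa using h
  | y :: l, x, γ, h, hl => by
    rw [List.isChain_cons_cons] at hl
    have := G.move l (G.shift x y γ h hl.1) hl.2
    rw [List.getLast_cons (by simp), List.formPerm_cons_cons, Equiv.Perm.coe_mul,
      ← Function.comp_assoc]
    exact this

/-- Moving the hole once around a cycle. -/
theorem rotate (G : Game R S Cfg) (h : Cfg x γ) (hn : (x :: a :: (m ++ [b])).Nodup)
    (hc : (x :: a :: (m ++ [b])).IsChain (Adj R)) (hb : Adj R b x) :
    Cfg x (γ ∘ (a :: (m ++ [b])).formPerm) := by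
  have h1 := G.move _ h hc
  have hlast : (x :: a :: (m ++ [b])).getLast (by simp) = b := by
    rw [List.getLast_cons (by simp), List.getLast_cons (by simp), List.getLast_append_singleton]
  rw [hlast] at h1
  have h2 := G.shift b x _ h1 hb
  have hp : (x :: a :: (m ++ [b])).formPerm = (a :: (m ++ [b])).formPerm * Equiv.swap b x := by
    rw [← List.formPerm_rotate_one _ hn, List.rotate_cons_succ, List.rotate_zero]
    have : a :: (m ++ [b]) ++ [x] = (a :: m) ++ [b, x] := by simp
    rw [this, List.formPerm_append_pair]
    simp
  rw [hp, Equiv.Perm.coe_mul, ← Function.comp_assoc, Function.comp_assoc] at h2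
  simpa [Function.comp_assoc, ← Equiv.Perm.coe_mul] using h2

/-- Comparing the degrees of the hole `x` before and after one rotation along a cycle which has
only its two ends adjacent to `x`. -/
theorem rotate_ends (G : Game R S Cfg) (h : Cfg x γ) (hn : (x :: a :: (m ++ [b])).Nodup)
    (hc : (x :: a :: (m ++ [b])).IsChain (Adj R)) (hb : Adj R b x)
    (hm : ∀ y ∈ m, ¬ Adj R y x) :
    γ ((a :: (m ++ [b])).formPerm a) = γ b ∧ (γ a ≠ γ b → ∀ β, R β a x ↔ R β b x) := by
  have h' := G.rotate h hn hc hb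
  have ha : Adj R a x := G.rel.adj_symm (List.isChain_cons_cons.1 hc).1
  have hab : a ≠ b := by
    rintro rfl
    simp at hn
  have key := fun c β => colDeg_pair (G.mem_left ha) (G.mem_left hb) hab
    (fun u hu hua hub => by
      rw [Function.comp_apply, List.formPerm_apply_of_notMem]
      simp only [List.mem_cons, List.mem_append, List.not_mem_nil, or_false, not_or]
      exact ⟨hua, fun hum => hm u hum hu, hub⟩) (Function.comp_apply ..)
    (congrArg γ (List.formPerm_cons_concat_apply_last a b m)) c β (G.count x _ _ h h' c β)
  generalize γ ((a :: (m ++ [b])).formPerm a) = s at key ⊢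
  obtain ⟨βa, hβa⟩ := ha
  obtain ⟨βb, hβb⟩ := hb
  by_cases hs : γ a = γ b
  · refine ⟨?_, fun hne => absurd hs hne⟩
    have := key (γ a) βa
    by_contra hne
    simp only [hβa, hs, hne, if_true, if_false, and_true, and_false] at this
    omega
  · have hsb : s = γ b := by
      by_contra hne
      have hsa : s = γ a := fin_two_eq_of_ne hne hs
      have := key (γ a) βb
      simp only [hβb, hsa, Ne.symm hs, if_true, if_false, and_true, and_false] at this
      omega
    refine ⟨hsb, fun _ β => ?_⟩
    have := key (γ a) β
    simp only [hsb, Ne.symm hs, if_false, and_true, and_false] at this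
    by_cases h1 : R β a x <;> by_cases h2 : R β b x <;> simp_all

/-- Along a cycle having only its two ends adjacent to the hole, colours are constant or
alternating. -/
theorem formPerm_eq_iff (G : Game R S Cfg) (h : Cfg x γ) (hn : (x :: a :: (m ++ [b])).Nodup)
    (hc : (x :: a :: (m ++ [b])).IsChain (Adj R)) (hb : Adj R b x)
    (hm : ∀ y ∈ m, ¬ Adj R y x) {v : ℕ} (hv : v ∈ a :: (m ++ [b])) :
    γ v = γ ((a :: (m ++ [b])).formPerm v) ↔ γ a = γ b := by
  set σ := (a :: (m ++ [b])).formPerm with hσ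
  have hσb : σ b = a := List.formPerm_cons_concat_apply_last a b m
  have hpow : ∀ k : ℕ, Cfg x (γ ∘ ⇑(σ ^ k)) := by
    intro k
    induction k with
    | zero => simpa using h
    | succ k ih =>
      have := G.rotate ih hn hc hb
      rwa [Function.comp_assoc, ← Equiv.Perm.coe_mul, ← hσ, ← pow_succ] at this
  have hstep : ∀ k : ℕ, γ ((σ ^ (k + 2)) b) = γ ((σ ^ k) b) := by
    intro k
    have := (G.rotate_ends (hpow k) hn hc hb hm).1
    rw [Function.comp_apply, Function.comp_apply, ← hσ, ← hσb, ← Equiv.Perm.mul_apply,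
      ← Equiv.Perm.mul_apply, mul_assoc, ← pow_two, ← pow_add] at this
    exact this
  have hall : ∀ k : ℕ, γ ((σ ^ k) b) = γ ((σ ^ (k + 1)) b) ↔ γ a = γ b := by
    intro k
    induction k with
    | zero => simp [hσb, eq_comm]
    | succ k ih => rw [hstep k, eq_comm, ih]
  have hcyc : σ.IsCycleOn {y | y ∈ a :: (m ++ [b])} :=
    List.Nodup.isCycleOn_formPerm (List.nodup_cons.1 hn).2
  obtain ⟨k, hk⟩ := hcyc.exists_pow_eq' (List.finite_toSet _) (a := b) (by simp) hv
  rw [← hk, ← hall k, pow_succ', Equiv.Perm.mul_apply]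

theorem isChain_eq_iff (G : Game R S Cfg) (h : Cfg x γ) (hn : (x :: a :: (m ++ [b])).Nodup)
    (hc : (x :: a :: (m ++ [b])).IsChain (Adj R)) (hb : Adj R b x)
    (hm : ∀ y ∈ m, ¬ Adj R y x) :
    (a :: (m ++ [b])).IsChain fun u v => γ u = γ v ↔ γ a = γ b := by
  rw [List.isChain_iff_getElem]
  intro i hi
  have := G.formPerm_eq_iff h hn hc hb hm (List.getElem_mem (n := i) (by omega))
  rwa [List.formPerm_apply_lt_getElem _ (List.nodup_cons.1 hn).2 _ hi] at this

end Game

/-- A cycle `x, a, m, b` through the hole `x` whose two neighbours `a`, `b` of `x` have different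
colours. -/
structure BadCycle (R : Bool → ℕ → ℕ → Prop) (Cfg : ℕ → (ℕ → Fin 2) → Prop) (γ : ℕ → Fin 2)
    (x a : ℕ) (m : List ℕ) (b : ℕ) : Prop where
  cfg : Cfg x γ
  nodup : (x :: a :: (m ++ [b])).Nodup
  chain : (x :: a :: (m ++ [b])).IsChain (Adj R)
  adj : Adj R b x
  ne : γ a ≠ γ b

/-- A shortest bad cycle, over all configurations. -/
structure MinBadCycle (R : Bool → ℕ → ℕ → Prop) (Cfg : ℕ → (ℕ → Fin 2) → Prop) (γ : ℕ → Fin 2)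
    (x a : ℕ) (m : List ℕ) (b : ℕ) : Prop extends BadCycle R Cfg γ x a m b where
  min : ∀ γ' x' a' m' b', BadCycle R Cfg γ' x' a' m' b' → m.length ≤ m'.length

theorem even_length_of_alternating {γ : ℕ → Fin 2} : ∀ {t : List ℕ} {a b : ℕ},
    (a :: (t ++ [b])).IsChain (fun u v => γ u ≠ γ v) → (γ a ≠ γ b ↔ Even t.length)
  | [], a, b, h => by simpa using h
  | c :: t, a, b, h => by
    rw [List.cons_append, List.isChain_cons_cons] at h
    rw [List.length_cons, Nat.even_add_one, ← even_length_of_alternating h.2, not_not]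
    constructor
    · exact fun hab => fin_two_eq_of_ne h.1.symm hab.symm
    · exact fun hcb => hcb ▸ h.1

namespace MinBadCycle

variable {Cfg : ℕ → (ℕ → Fin 2) → Prop} {x a b : ℕ} {m : List ℕ}

theorem not_adj (G : Game R S Cfg) (h : MinBadCycle R Cfg γ x a m b) : ∀ y ∈ m, ¬ Adj R y x := by
  intro y hy hyx
  obtain ⟨m₁, m₂, rfl⟩ := List.append_of_mem hy
  have hc : (x :: a :: m₁ ++ y :: (m₂ ++ [b])).IsChain (Adj R) := by simpa using h.chain
  have hn : (x :: a :: m₁ ++ y :: (m₂ ++ [b])).Nodup := by simpa using h.nodup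
  rw [List.isChain_split] at hc
  by_cases hya : γ y = γ a
  · have hbad : BadCycle R Cfg γ x y m₂ b :=
      { cfg := h.cfg
        nodup := by
          refine hn.sublist ?_
          simp only [List.cons_append]
          exact (List.sublist_append_right (a :: m₁) _).cons_cons x
        chain := List.isChain_cons_cons.2 ⟨G.rel.adj_symm hyx, hc.2⟩
        adj := h.adj
        ne := hya ▸ h.ne }
    have := h.min _ _ _ _ _ hbad
    simp at this
    omega
  · have hbad : BadCycle R Cfg γ x a m₁ y :=
      { cfg := h.cfg
        nodup := by
          refine hn.sublist ?_
          have : x :: a :: (m₁ ++ [y]) = (x :: a :: m₁) ++ [y] := by simp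
          rw [this]
          exact List.Sublist.append_left (by simp) _
        chain := by simpa using hc.1
        adj := hyx
        ne := Ne.symm hya }
    have := h.min _ _ _ _ _ hbad
    simp at this

theorem alternating (G : Game R S Cfg) (h : MinBadCycle R Cfg γ x a m b) :
    (a :: (m ++ [b])).IsChain fun u v => γ u ≠ γ v :=
  (G.isChain_eq_iff h.cfg h.nodup h.chain h.adj (h.not_adj G)).imp fun _ _ huv =>
    fun he => h.ne (huv.1 he)

theorem even_length (G : Game R S Cfg) (h : MinBadCycle R Cfg γ x a m b) : Even m.length :=
  (even_length_of_alternating (h.alternating G)).1 h.ne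

theorem ends_iff (G : Game R S Cfg) (h : MinBadCycle R Cfg γ x a m b) (β : Bool) :
    R β a x ↔ R β b x :=
  (G.rotate_ends h.cfg h.nodup h.chain h.adj (h.not_adj G)).2 h.ne β

/-- Moving the hole of a shortest bad cycle one step along the cycle. -/
theorem step (G : Game R S Cfg) (h : MinBadCycle R Cfg γ x a m b) :
    ∃ γ' a' m', a' :: m' = m ++ [b] ∧ MinBadCycle R Cfg γ' a a' m' x ∧
      ∀ β, R β a' a ↔ R (!β) a x := by
  obtain ⟨a', m', hm⟩ := List.exists_cons_of_ne_nil (l := m ++ [b]) (by simp)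
  have hn := h.nodup
  have hc := h.chain
  have halt := h.alternating G
  rw [hm] at hn hc halt
  have hlen : m'.length = m.length := by
    have := congrArg List.length hm
    simpa using this.symm
  rw [List.isChain_cons_cons] at hc halt
  have hxa : x ≠ a' := by
    rintro rfl
    simp at hn
  have haa : a ≠ a' := by
    rintro rfl
    simp at hn
  have hnew : MinBadCycle R Cfg (γ ∘ Equiv.swap x a) a a' m' x :=
    { cfg := G.shift x a γ h.cfg hc.1
      nodup := by
        have : a :: a' :: (m' ++ [x]) = (a :: a' :: m') ++ [x] := by simp
        rw [this, List.nodup_append_comm]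
        simpa using hn
      chain := by
        have : a :: a' :: (m' ++ [x]) = a :: m ++ [b, x] := by
          rw [← List.cons_append (a := a'), ← hm]
          simp
        rw [this, List.isChain_split]
        refine ⟨?_, by simpa using h.adj⟩
        rw [List.cons_append, hm]
        exact hc.2
      adj := hc.1
      ne := by
        rw [Function.comp_apply, Function.comp_apply, Equiv.swap_apply_left,
          Equiv.swap_apply_of_ne_of_ne hxa.symm haa.symm]
        exact Ne.symm halt.1
      min := by
        rw [hlen]
        exact h.min }
  refine ⟨_, a', m', hm.symm, hnew, fun β => ?_⟩
  rw [hnew.ends_iff G, G.rel.not_iff]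

theorem rotate (G : Game R S Cfg) (h : MinBadCycle R Cfg γ x a m b) (n : ℕ) :
    ∃ γ' x' a' m' b', (x :: a :: (m ++ [b])).rotate n = x' :: a' :: (m' ++ [b']) ∧
      MinBadCycle R Cfg γ' x' a' m' b' ∧ ∀ β, R β a' x' ↔ R (not^[n] β) a x := by
  induction n with
  | zero => exact ⟨γ, x, a, m, b, by simp, h, by simp⟩
  | succ n ih =>
    obtain ⟨γ', x', a', m', b', hL, h', hβ⟩ := ih
    obtain ⟨γ'', a'', m'', hm, h'', hβ'⟩ := h'.step G
    refine ⟨γ'', a', a'', m'', x', ?_, h'', fun β => ?_⟩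
    · rw [← List.rotate_rotate, hL, List.rotate_cons_succ, List.rotate_zero,
        ← List.cons_append (a := a''), hm]
      simp
    · rw [hβ', hβ, Function.iterate_succ_apply]

theorem digon_left (G : Game R S Cfg) (h : MinBadCycle R Cfg γ x a m b) (β : Bool) :
    R β a x := by
  obtain ⟨γ', x', a', m', b', hL, -, hβ⟩ := h.rotate G (x :: a :: (m ++ [b])).length
  rw [List.rotate_length] at hL
  simp only [List.cons.injEq] at hL
  obtain ⟨rfl, rfl, -⟩ := hL
  have hodd : not^[(x :: a :: (m ++ [b])).length] = not := by
    refine Bool.involutive_not.iterate_odd ?_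
    have := h.even_length G
    simp only [List.length_cons, List.length_append]
    grind
  rw [hodd] at hβ
  obtain ⟨β', hβ'⟩ := G.rel.adj_symm (List.isChain_cons_cons.1 h.chain).1
  by_cases he : β = β'
  · exact he ▸ hβ'
  · rw [hβ]
    have : (!β) = β' := by cases β <;> cases β' <;> simp_all
    rwa [this]

theorem digon_right (G : Game R S Cfg) (h : MinBadCycle R Cfg γ x a m b) (β : Bool) :
    R β b x :=
  (h.ends_iff G β).1 (h.digon_left G β)

/-- The hole of a shortest bad cycle can be placed anywhere on the cycle. -/
theorem move (G : Game R S Cfg) (h : MinBadCycle R Cfg γ x a m b) {v : ℕ}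
    (hv : v ∈ x :: a :: (m ++ [b])) : ∃ γ' a' m' b', MinBadCycle R Cfg γ' v a' m' b' ∧
      (x :: a :: (m ++ [b])).Perm (v :: a' :: (m' ++ [b'])) := by
  obtain ⟨p, q, hpq⟩ := List.append_of_mem hv
  obtain ⟨γ', x', a', m', b', hL, h', -⟩ := h.rotate G p.length
  have hp := (List.rotate_perm (x :: a :: (m ++ [b])) p.length).symm
  rw [hL] at hp
  rw [hpq, List.rotate_append_length_eq] at hL
  simp only [List.cons_append, List.cons.injEq] at hL
  obtain ⟨rfl, -⟩ := hL
  exact ⟨γ', a', m', b', h', hp⟩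

end MinBadCycle

namespace Game

variable {Cfg : ℕ → (ℕ → Fin 2) → Prop} {x a b : ℕ} {m : List ℕ}

theorem notMem_of_isChain {r : ℕ → ℕ → Prop} : ∀ {m : List ℕ} {a : ℕ},
    (a :: (m ++ [b])).IsChain (fun p q => p ≠ x ∧ q ≠ x ∧ r p q) → x ∉ a :: (m ++ [b])
  | [], a, h => by
    simp only [List.nil_append, List.isChain_pair] at h
    simp [h.1.symm, h.2.1.symm]
  | c :: m, a, h => by
    rw [List.cons_append, List.isChain_cons_cons] at h
    rw [List.cons_append, List.mem_cons, not_or]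
    exact ⟨h.1.1.symm, notMem_of_isChain h.2⟩

/-- Two disjoint sets of vertices are joined by a simple path avoiding `x`, whose interior avoids
both sets. -/
theorem exists_path (G : Game R S Cfg) {P Q : ℕ → Prop} (hPQ : ∀ u, P u → ¬ Q u) {u v : ℕ}
    (hu : P u) (hv : Q v) (huS : u ∈ S) (hvS : v ∈ S) (hux : u ≠ x) (hvx : v ≠ x) :
    ∃ a m b, P a ∧ Q b ∧ (a :: (m ++ [b])).IsChain (Adj R) ∧ (x :: a :: (m ++ [b])).Nodup ∧
      ∀ y ∈ m, ¬ P y ∧ ¬ Q y := by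
  obtain ⟨a, m, b, ha, hb, hc, hn, hm⟩ := exists_short_path hPQ (G.conn x u huS v hvS hux hvx) hu hv
  exact ⟨a, m, b, ha, hb, hc.imp fun _ _ h => h.2.2,
    List.nodup_cons.2 ⟨notMem_of_isChain hc, hn⟩, hm⟩

theorem exists_badCycle (G : Game R S Cfg) (h : Cfg x γ) :
    ∃ a m b, BadCycle R Cfg γ x a m b := by
  obtain ⟨u, hu, hu0⟩ := G.nbr x γ h 0
  obtain ⟨v, hv, hv1⟩ := G.nbr x γ h 1
  obtain ⟨a, m, b, ha, hb, hc, hn, -⟩ := G.exists_path (x := x)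
    (P := fun u => Adj R u x ∧ γ u = 0) (Q := fun u => Adj R u x ∧ γ u = 1)
    (fun u h h' => by simp [h.2] at h') ⟨hu, hu0⟩ ⟨hv, hv1⟩ (G.mem_left hu) (G.mem_left hv)
    (G.rel.adj_ne hu) (G.rel.adj_ne hv)
  exact ⟨a, m, b, h, hn, List.isChain_cons_cons.2 ⟨G.rel.adj_symm ha.1, hc⟩, hb.1, by
    simp [ha.2, hb.2]⟩

theorem exists_minBadCycle (G : Game R S Cfg) (h : Cfg x γ) :
    ∃ γ' x' a m b, MinBadCycle R Cfg γ' x' a m b := by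
  have hex : ∃ n γ' x' a m b, BadCycle R Cfg γ' x' a m b ∧ m.length = n := by
    obtain ⟨a, m, b, hbad⟩ := G.exists_badCycle h
    exact ⟨_, γ, x, a, m, b, hbad, rfl⟩
  obtain ⟨γ', x', a, m, b, hbad, hm⟩ := Nat.find_spec hex
  refine ⟨γ', x', a, m, b, { hbad with min := fun γ'' x'' a' m' b' h' => ?_ }⟩
  rw [hm]
  exact Nat.find_min' hex ⟨γ'', x'', a', m', b', h', rfl⟩

/-- Two configurations with the same hole that differ in only one end of a cycle having only its
two ends adjacent to the hole: the cycle is a triangle. -/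
theorem eq_nil_of_ne (G : Game R S Cfg) (h : Cfg x γ) (h' : Cfg x γ')
    (hn : (x :: a :: (m ++ [b])).Nodup) (hc : (x :: a :: (m ++ [b])).IsChain (Adj R))
    (hb : Adj R b x) (hm : ∀ y ∈ m, ¬ Adj R y x) (heq : ∀ y ∈ a :: m, γ y = γ' y)
    (hne : γ b ≠ γ' b) : m = [] := by
  rcases m with _ | ⟨c, m⟩
  · rfl
  · have h1 := G.isChain_eq_iff h hn hc hb hm
    have h2 := G.isChain_eq_iff h' hn hc hb hm
    rw [List.cons_append, List.isChain_cons_cons] at h1 h2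
    have ha := heq a (by simp)
    have hc := heq c (by simp)
    have h3 := h1.1
    have h4 := h2.1
    rw [← ha, ← hc, h3] at h4
    by_cases hab : γ a = γ b
    · exact absurd (hab.symm.trans (h4.1 hab)) hne
    · exact absurd (h4.2 (fin_two_eq_of_ne hab hne.symm)) hab

/-- The hole of a shortest bad cycle that is not a triangle has no neighbour outside the cycle. -/
theorem mem_of_adj_minBadCycle (G : Game R S Cfg) (h : MinBadCycle R Cfg γ x a m b)
    (hm : m ≠ []) {w : ℕ} (hw : Adj R w x) : w ∈ a :: (m ++ [b]) := by
  by_contra hwl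
  have hxa : Adj R a x := G.rel.adj_symm (List.isChain_cons_cons.1 h.chain).1
  obtain ⟨w', m', b', ⟨hw'x, hw'l⟩, hb'l, hc, hn, hm'⟩ := G.exists_path (x := x)
    (P := fun u => Adj R u x ∧ u ∉ a :: (m ++ [b])) (Q := fun u => u ∈ a :: (m ++ [b]))
    (fun u hu => hu.2) ⟨hw, hwl⟩ (by simp) (G.mem_left hw) (G.mem_left hxa)
    (G.rel.adj_ne hw) (G.rel.adj_ne hxa)
  have hm'x : ∀ y ∈ m', ¬ Adj R y x := fun y hy hyx => (hm' y hy).1 ⟨hyx, (hm' y hy).2⟩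
  have hcx : (x :: w' :: (m' ++ [b'])).IsChain (Adj R) :=
    List.isChain_cons_cons.2 ⟨G.rel.adj_symm hw'x, hc⟩
  have hrot := G.rotate h.cfg h.nodup h.chain h.adj
  have hflip : ∀ v ∈ a :: (m ++ [b]), γ v ≠ (γ ∘ (a :: (m ++ [b])).formPerm) v := fun v hv he =>
    h.ne ((G.formPerm_eq_iff h.cfg h.nodup h.chain h.adj (h.not_adj G) hv).1 he)
  have hfix : ∀ v, v ∉ a :: (m ++ [b]) → γ v = (γ ∘ (a :: (m ++ [b])).formPerm) v := fun v hv => by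
    rw [Function.comp_apply, List.formPerm_apply_of_notMem hv]
  generalize γ ∘ (a :: (m ++ [b])).formPerm = γ' at hrot hflip hfix
  by_cases hb'x : Adj R b' x
  · obtain rfl := G.eq_nil_of_ne h.cfg hrot hn hcx hb'x hm'x (fun y hy => by
      rcases List.mem_cons.1 hy with rfl | hy
      · exact hfix _ hw'l
      · exact hfix y (hm' y hy).2) (hflip b' hb'l)
    have hbad : ∀ δ, Cfg x δ → δ w' = δ b' := by
      intro δ hδ
      by_contra hne
      have := h.min _ _ _ _ _ ⟨hδ, hn, hcx, hb'x, hne⟩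
      exact hm (List.length_eq_zero_iff.1 (Nat.le_zero.1 this))
    exact hflip b' hb'l (((hbad γ h.cfg).symm.trans (hfix w' hw'l)).trans (hbad γ' hrot))
  · have hb'm : b' ∈ m := by
      simp only [List.mem_cons, List.mem_append, List.not_mem_nil, or_false] at hb'l
      rcases hb'l with rfl | hb'm | rfl
      · exact absurd hxa hb'x
      · exact hb'm
      · exact absurd h.adj hb'x
    obtain ⟨m₁, m₂, rfl⟩ := List.append_of_mem hb'm
    have hsub : ∀ y ∈ m₂ ++ [b], y ∈ a :: (m₁ ++ b' :: m₂ ++ [b]) := fun y hy => by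
      simp only [List.mem_cons, List.mem_append] at hy ⊢
      tauto
    have hn' : (x :: w' :: (m' ++ b' :: m₂ ++ [b])).Nodup := by
      have h1 : (x :: a :: m₁ ++ (b' :: (m₂ ++ [b]))).Nodup := by simpa using h.nodup
      have h2 : (x :: w' :: m' ++ ([b'] ++ (m₂ ++ [b]))).Nodup := by
        rw [← List.append_assoc, List.nodup_append]
        refine ⟨by simpa using hn, (List.nodup_cons.1 (List.nodup_append.1 h1).2.1).2, ?_⟩
        rintro y hy z hz rfl
        have hyl := hsub y hz
        simp only [List.cons_append, List.mem_cons, List.mem_append, List.not_mem_nil,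
          or_false] at hy
        rcases hy with rfl | rfl | hy | rfl
        · exact (List.nodup_cons.1 h.nodup).1 hyl
        · exact hw'l hyl
        · exact (hm' y hy).2 hyl
        · exact (List.nodup_cons.1 (List.nodup_append.1 h1).2.1).1 hz
      simpa using h2
    have hc' : (x :: w' :: (m' ++ b' :: m₂ ++ [b])).IsChain (Adj R) := by
      have h1 : (x :: a :: m₁ ++ (b' :: (m₂ ++ [b]))).IsChain (Adj R) := by simpa using h.chain
      have h2 : (x :: w' :: m' ++ (b' :: (m₂ ++ [b]))).IsChain (Adj R) :=
        List.isChain_split.2 ⟨by simpa using hcx, (List.isChain_split.1 h1).2⟩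
      simpa using h2
    have hmid : ∀ y ∈ m' ++ b' :: m₂, ¬ Adj R y x := by
      intro y hy
      rcases List.mem_append.1 hy with hy | hy
      · exact hm'x y hy
      · exact h.not_adj G y (List.mem_append_right _ hy)
    obtain ⟨c, t, hct⟩ := List.exists_cons_of_ne_nil (l := m₂ ++ [b]) (by simp)
    have hcl := hsub c (by simp [hct])
    have hconst : ∀ δ, Cfg x δ → δ w' = δ b → δ b' = δ c := by
      intro δ hδ he
      have h1 := G.isChain_eq_iff hδ hn' hc' h.adj hmid
      rw [List.append_assoc, List.cons_append, hct, ← List.cons_append, List.isChain_split,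
        List.isChain_cons_cons] at h1
      exact h1.2.1.2 he
    have halt : γ b' ≠ γ c := by
      have h1 := h.alternating G
      rw [List.append_assoc, List.cons_append, hct, ← List.cons_append, List.isChain_split,
        List.isChain_cons_cons] at h1
      exact h1.2.1
    by_cases he : γ w' = γ b
    · exact halt (hconst γ h.cfg he)
    · have hb' := hflip b' hb'l
      have hc' := hflip c hcl
      have hbf := hflip b (by simp)
      have h1 := hconst γ' hrot (by
        rw [← hfix w' hw'l]
        exact fin_two_eq_of_ne he hbf.symm)
      rw [h1] at hb'
      exact halt (fin_two_eq_of_ne hb' hc')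

/-- A shortest bad cycle other than a triangle spans the digraph. -/
theorem toFinset_eq_of_minBadCycle (G : Game R S Cfg) (h : MinBadCycle R Cfg γ x a m b)
    (hm : m ≠ []) : (x :: a :: (m ++ [b])).toFinset = S := by
  by_contra hne
  have hsub : (x :: a :: (m ++ [b])).toFinset ⊆ S := by
    intro v hv
    rw [List.mem_toFinset] at hv
    obtain ⟨γ', a', m', b', h', -⟩ := h.move G hv
    exact G.mem_right h'.adj
  obtain ⟨u, hu, w, -, hw, huw⟩ := G.sconn.exists_adj hsub (by simp) hne
  rw [List.mem_toFinset] at hu hw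
  obtain ⟨γ', a', m', b', h', hp⟩ := h.move G hu
  have hlen : m'.length = m.length := by simpa using hp.length_eq.symm
  refine hw (hp.mem_iff.2 (List.mem_cons_of_mem _ ?_))
  refine G.mem_of_adj_minBadCycle h' ?_ (G.rel.adj_symm huw)
  rintro rfl
  exact hm (List.length_eq_zero_iff.1 hlen.symm)

theorem exists_nbrs_of_minBadCycle (G : Game R S Cfg) (h : MinBadCycle R Cfg γ x a m b)
    (hm : m ≠ []) {v : ℕ} (hv : v ∈ S) :
    ∃ γ' a' b', a' ≠ b' ∧ Cfg v γ' ∧ γ' a' ≠ γ' b' ∧ ∀ β u, R β u v ↔ u = a' ∨ u = b' := by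
  rw [← G.toFinset_eq_of_minBadCycle h hm, List.mem_toFinset] at hv
  obtain ⟨γ', a', m', b', h', hp⟩ := h.move G hv
  have hlen : m'.length = m.length := by simpa using hp.length_eq.symm
  have hm' : m' ≠ [] := by
    rintro rfl
    exact hm (List.length_eq_zero_iff.1 hlen.symm)
  refine ⟨γ', a', b', fun he => h'.ne (he ▸ rfl), h'.cfg, h'.ne, fun β u => ⟨fun hu => ?_, ?_⟩⟩
  · have := G.mem_of_adj_minBadCycle h' hm' ⟨β, hu⟩
    simp only [List.mem_cons, List.mem_append, List.not_mem_nil, or_false] at this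
    rcases this with rfl | hum | rfl
    · exact Or.inl rfl
    · exact absurd ⟨β, hu⟩ (h'.not_adj G u hum)
    · exact Or.inr rfl
  · rintro (rfl | rfl)
    · exact h'.digon_left G β
    · exact h'.digon_right G β

theorem odd_card_of_minBadCycle (G : Game R S Cfg) (h : MinBadCycle R Cfg γ x a m b)
    (hm : m ≠ []) : Odd S.card := by
  rw [← G.toFinset_eq_of_minBadCycle h hm, List.toFinset_card_of_nodup h.nodup]
  have := h.even_length G
  simp only [List.length_cons, List.length_append]
  grind

end Game

/-- A clique `K` containing the hole `x` and vertices of both colours. -/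
structure CliqueCfg (R : Bool → ℕ → ℕ → Prop) (Cfg : ℕ → (ℕ → Fin 2) → Prop) (K : Finset ℕ)
    (x : ℕ) (γ : ℕ → Fin 2) : Prop where
  mem : x ∈ K
  cfg : Cfg x γ
  adj : ∀ u ∈ K, ∀ v ∈ K, u ≠ v → Adj R u v
  colours : ∃ a ∈ K, ∃ b ∈ K, a ≠ x ∧ b ≠ x ∧ γ a ≠ γ b

namespace Game

variable {Cfg : ℕ → (ℕ → Fin 2) → Prop} {x a b : ℕ} {K : Finset ℕ}

theorem swap (G : Game R S Cfg) (h : Cfg x γ) (ha : Adj R a x) (hb : Adj R b x)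
    (hab : Adj R a b) : Cfg x (γ ∘ Equiv.swap a b) := by
  have := G.rotate (m := []) (a := a) (b := b) h
    (by simp [(G.rel.adj_ne ha).symm, (G.rel.adj_ne hb).symm, G.rel.adj_ne hab])
    (by simp [G.rel.adj_symm ha, hab]) hb
  simpa using this

/-- Two differently coloured vertices forming a triangle with the hole have the same adjacencies to
every other neighbour of the hole. -/
theorem rel_iff_of_triangle (G : Game R S Cfg) (h : Cfg x γ) (ha : Adj R a x) (hb : Adj R b x)
    (hab : Adj R a b) (hne : γ a ≠ γ b) {w : ℕ} (hw : Adj R w x) (hwa : w ≠ a) (hwb : w ≠ b)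
    (β : Bool) : R β a w ↔ R β b w := by
  have hxw := G.rel.adj_symm hw
  have h1 := G.shift x w _ h hxw
  have h2 := G.shift x w _ (G.swap h ha hb hab) hxw
  have hsw : ∀ u, u ≠ x → u ≠ w → Equiv.swap x w u = u := fun u => Equiv.swap_apply_of_ne_of_ne
  have hax := G.rel.adj_ne ha
  have hbx := G.rel.adj_ne hb
  have key := colDeg_pair (G.mem_left ha) (G.mem_left hb) (G.rel.adj_ne hab)
    (γ := γ ∘ Equiv.swap x w) (γ' := (γ ∘ Equiv.swap a b) ∘ Equiv.swap x w) (x := w)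
    (s := γ b) (t := γ a)
    (fun u hu hua hub => by
      have huw := G.rel.adj_ne hu
      by_cases hux : u = x
      · subst hux
        simp [Equiv.swap_apply_of_ne_of_ne hwa hwb]
      · simp [hsw u hux huw, Equiv.swap_apply_of_ne_of_ne hua hub])
    (by simp [hsw a hax hwa.symm]) (by simp [hsw b hbx hwb.symm]) (γ a) β
    (G.count w _ _ h1 h2 (γ a) β)
  simp only [Function.comp_apply, hsw a hax hwa.symm, hsw b hbx hwb.symm, hne.symm, and_true,
    and_false, if_false] at key
  by_cases h1 : R β a w <;> by_cases h2 : R β b w <;> simp_all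

end Game

namespace CliqueCfg

variable {Cfg : ℕ → (ℕ → Fin 2) → Prop} {x a b : ℕ} {K : Finset ℕ}

theorem move (G : Game R S Cfg) (h : CliqueCfg R Cfg K x γ) {y : ℕ} (hy : y ∈ K) :
    ∃ γ', CliqueCfg R Cfg K y γ' := by
  by_cases hxy : x = y
  · exact ⟨γ, hxy ▸ h⟩
  · refine ⟨γ ∘ Equiv.swap x y, hy, G.shift x y γ h.cfg (h.adj x h.mem y hy hxy), h.adj, ?_⟩
    obtain ⟨a, ha, b, hb, hax, hbx, hab⟩ := h.colours
    have hsw : ∀ u, u ≠ x → u ≠ y → Equiv.swap x y u = u := fun u =>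
      Equiv.swap_apply_of_ne_of_ne
    by_cases hay : a = y
    · subst hay
      have hba : b ≠ a := fun he => hab (he ▸ rfl)
      exact ⟨x, h.mem, b, hb, hxy, hba, by simpa [hsw b hbx hba] using hab⟩
    · by_cases hby : b = y
      · subst hby
        exact ⟨a, ha, x, h.mem, hay, hxy, by simpa [hsw a hax hay] using hab⟩
      · exact ⟨a, ha, b, hb, hay, hby, by simpa [hsw a hax hay, hsw b hbx hby] using hab⟩

theorem exists_insert (G : Game R S Cfg) (h : CliqueCfg R Cfg K x γ) {w : ℕ} (hw : Adj R w x)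
    (hwK : w ∉ K) : ∃ w' ∉ K, CliqueCfg R Cfg (insert w' K) x γ := by
  have hKx : ∀ u ∈ K, u ≠ x → Adj R u x := fun u hu hux => h.adj u hu x h.mem hux
  obtain ⟨a₀, ha₀, b₀, hb₀, ha₀x, hb₀x, hne₀⟩ := h.colours
  obtain ⟨w', m, b, ⟨hw'x, hw'K⟩, ⟨hbK, hbx⟩, hc, hn, hm⟩ := G.exists_path (x := x)
    (P := fun u => Adj R u x ∧ u ∉ K) (Q := fun u => u ∈ K ∧ u ≠ x)
    (fun u hu hu' => hu.2 hu'.1) ⟨hw, hwK⟩ ⟨ha₀, ha₀x⟩ (G.mem_left hw)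
    (G.mem_left (hKx a₀ ha₀ ha₀x)) (G.rel.adj_ne hw) ha₀x
  have hmK : ∀ y ∈ m, y ∉ K := by
    intro y hy hyK
    refine (hm y hy).2 ⟨hyK, ?_⟩
    rintro rfl
    exact (List.nodup_cons.1 hn).1 (by simp [hy])
  obtain ⟨a, haK, hax, hab⟩ : ∃ a ∈ K, a ≠ x ∧ γ a ≠ γ b := by
    by_cases hb : γ a₀ = γ b
    · exact ⟨b₀, hb₀, hb₀x, fun he => hne₀ (hb.trans he.symm)⟩
    · exact ⟨a₀, ha₀, ha₀x, hb⟩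
  have hne : a ≠ b := fun he => hab (he ▸ rfl)
  have hfix : ∀ y, y ∉ K → γ y = (γ ∘ Equiv.swap a b) y := fun y hy => by
    have hya : y ≠ a := fun he => hy (he ▸ haK)
    have hyb : y ≠ b := fun he => hy (he ▸ hbK)
    rw [Function.comp_apply, Equiv.swap_apply_of_ne_of_ne hya hyb]
  obtain rfl := G.eq_nil_of_ne h.cfg
    (G.swap h.cfg (hKx a haK hax) (hKx b hbK hbx) (h.adj a haK b hbK hne)) hn
    (List.isChain_cons_cons.2 ⟨G.rel.adj_symm hw'x, hc⟩) (hKx b hbK hbx)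
    (fun y hy hyx => (hm y hy).1 ⟨hyx, hmK y hy⟩)
    (fun y hy => by
      rcases List.mem_cons.1 hy with rfl | hy
      · exact hfix _ hw'K
      · exact hfix y (hmK y hy))
    (by simpa using hab.symm)
  have hwb : Adj R b w' := G.rel.adj_symm (by simpa using hc)
  have htri : ∀ u ∈ K, ∀ v ∈ K, u ≠ x → v ≠ x → γ u ≠ γ v → Adj R u w' → Adj R v w' := by
    rintro u hu v hv hux hvx huv ⟨β, hβ⟩
    exact ⟨β, (G.rel_iff_of_triangle h.cfg (hKx u hu hux) (hKx v hv hvx)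
      (h.adj u hu v hv fun he => huv (he ▸ rfl)) huv hw'x (fun he => hw'K (he ▸ hu))
      (fun he => hw'K (he ▸ hv)) β).1 hβ⟩
  have hwa := htri b hbK a haK hbx hax hab.symm hwb
  have hall : ∀ v ∈ K, Adj R v w' := by
    intro v hv
    by_cases hvx : v = x
    · exact hvx ▸ G.rel.adj_symm hw'x
    · by_cases hva : γ a = γ v
      · exact htri b hbK v hv hbx hvx (fun he => hab (hva.trans he.symm)) hwb
      · exact htri a haK v hv hax hvx hva hwa
  refine ⟨w', hw'K, Finset.mem_insert_of_mem h.mem, h.cfg, ?_,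
    a, Finset.mem_insert_of_mem haK, b, Finset.mem_insert_of_mem hbK, hax, hbx, hab⟩
  intro u hu v hv huv
  rcases Finset.mem_insert.1 hu with rfl | huK <;> rcases Finset.mem_insert.1 hv with rfl | hvK
  · exact absurd rfl huv
  · exact G.rel.adj_symm (hall v hvK)
  · exact hall u huK
  · exact h.adj u huK v hvK huv

theorem subset (G : Game R S Cfg) (h : CliqueCfg R Cfg K x γ) : K ⊆ S := by
  obtain ⟨a, ha, -, -, hax, -, -⟩ := h.colours
  intro u hu
  by_cases hux : u = x
  · exact hux ▸ G.mem_right (h.adj a ha x h.mem hax)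
  · exact G.mem_left (h.adj u hu x h.mem hux)

theorem exists_spanning (G : Game R S Cfg) (h : CliqueCfg R Cfg K x γ) :
    ∃ x' γ', CliqueCfg R Cfg S x' γ' := by
  obtain ⟨M, hM, hmax⟩ := Finset.exists_max_image
    (S.powerset.filter fun M => ∃ x' γ', CliqueCfg R Cfg M x' γ') Finset.card
    ⟨K, Finset.mem_filter.2 ⟨Finset.mem_powerset.2 (h.subset G), x, γ, h⟩⟩
  simp only [Finset.mem_filter, Finset.mem_powerset] at hM hmax
  obtain ⟨hMS, x', γ', hM⟩ := hM
  by_cases hne : M = S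
  · exact ⟨x', γ', hne ▸ hM⟩
  · obtain ⟨u, hu, w, -, hw, huw⟩ := G.sconn.exists_adj hMS ⟨x', hM.mem⟩ hne
    obtain ⟨γ'', hM'⟩ := hM.move G hu
    obtain ⟨w', hw', hM''⟩ := hM'.exists_insert G (G.rel.adj_symm huw) hw
    have := hmax _ ⟨hM''.subset G, _, _, hM''⟩
    rw [Finset.card_insert_of_notMem hw'] at this
    omega

theorem digon (G : Game R S Cfg) (h : CliqueCfg R Cfg S x γ) {u v : ℕ} (hu : u ∈ S) (hv : v ∈ S)
    (huv : u ≠ v) (β : Bool) : R β u v := by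
  obtain ⟨γ', h'⟩ := h.move G hv
  obtain ⟨w, hw, hwu⟩ := G.nbr v γ' h'.cfg (γ' u + 1)
  have hne : γ' u ≠ γ' w := by
    rw [hwu]
    omega
  have huw : u ≠ w := fun he => hne (he ▸ rfl)
  have hmin : MinBadCycle R Cfg γ' v u [] w :=
    { cfg := h'.cfg
      nodup := by simp [huv.symm, (G.rel.adj_ne hw).symm, huw]
      chain := by simp [h.adj v hv u hu huv.symm, h.adj u hu w (G.mem_left hw) huw]
      adj := hw
      ne := hne
      min := fun _ _ _ _ _ _ => Nat.zero_le _ }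
  exact hmin.digon_left G β

end CliqueCfg

/-- A biconnected digraph carrying the game is a bidirected odd cycle or a bidirected complete
graph. -/
theorem Game.cycle_or_complete {Cfg : ℕ → (ℕ → Fin 2) → Prop} {x : ℕ} (G : Game R S Cfg)
    (h : Cfg x γ) :
    (Odd S.card ∧ ∀ v ∈ S, ∃ γ' a b, a ≠ b ∧ Cfg v γ' ∧ γ' a ≠ γ' b ∧
      ∀ β u, R β u v ↔ u = a ∨ u = b) ∨ ∀ u ∈ S, ∀ v ∈ S, u ≠ v → ∀ β, R β u v := by
  obtain ⟨γ', x', a, m, b, hbad⟩ := G.exists_minBadCycle h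
  by_cases hm : m = []
  · subst hm
    right
    have hc := hbad.chain
    simp only [List.nil_append, List.isChain_cons_cons, List.isChain_singleton, and_true] at hc
    have hax := G.rel.adj_symm hc.1
    have hcl : CliqueCfg R Cfg {x', a, b} x' γ' :=
      { mem := by simp
        cfg := hbad.cfg
        adj := by
          have h1 := G.rel.adj_symm hc.2
          have h2 := G.rel.adj_symm hbad.adj
          have h3 := hbad.adj
          intro u hu v hv huv
          simp only [Finset.mem_insert, Finset.mem_singleton] at hu hv
          rcases hu with rfl | rfl | rfl <;> rcases hv with rfl | rfl | rfl <;> tauto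
        colours := ⟨a, by simp, b, by simp, G.rel.adj_ne hax, G.rel.adj_ne hbad.adj, hbad.ne⟩ }
    obtain ⟨x'', γ'', hS⟩ := hcl.exists_spanning G
    exact fun u hu v hv huv => hS.digon G hu hv huv
  · exact Or.inl ⟨G.odd_card_of_minBadCycle hbad hm,
      fun v hv => G.exists_nbrs_of_minBadCycle hbad hm hv⟩

/-- In a biconnected critical pair, a colour without budget at one vertex has no budget at all. -/
theorem Crit.eq_zero (hR : IsArcRel R) (h : Crit R f S) (hbi : ∀ x ∈ S, Conn R (S.erase x))
    {c : Fin 2} {x : ℕ} (hx : x ∈ S) (hfx : ∀ b, f c x b = 0) : ∀ v ∈ S, ∀ b, f c v b = 0 := by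
  suffices hS : S.filter (fun v => ∀ b, f c v b = 0) = S by
    intro v hv
    rw [← hS] at hv
    exact (Finset.mem_filter.1 hv).2
  by_contra hne
  obtain ⟨u, hu, w, hw, hw', huw⟩ := h.conn.exists_adj (Finset.filter_subset _ _)
    ⟨x, Finset.mem_filter.2 ⟨hx, hfx⟩⟩ hne
  rw [Finset.mem_filter] at hu hw'
  obtain ⟨b, hb⟩ : ∃ b, 0 < f c w b := by
    by_contra! hcon
    exact hw' ⟨hw, fun b => Nat.le_zero.1 (hcon b)⟩
  obtain ⟨β, hβ⟩ := hR.adj_symm huw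
  have huw' : u ≠ w := hR.adj_ne huw
  obtain ⟨γ, hγ⟩ := exists_good_of_lt hR (S.erase w).card (S.erase w) (red R f {w} fun _ => c) rfl
    (hbi w hw) (valid_red_singleton h.valid hw) u (Finset.mem_erase.2 ⟨huw', hu.1⟩) β (by
      have h1 : deg R S u β = deg R {w} u β + deg R (S.erase w) u β := by
        rw [← deg_union (by simp)]
        congr 1
        rw [← Finset.insert_eq, Finset.insert_erase hw]
      have h2 : 0 < deg R {w} u β := Finset.card_pos.2 ⟨w, by simp [hβ]⟩
      have h3 := h.valid u hu.1 β
      have h4 : ∀ c', red R f {w} (fun _ => c) c' u β = f c' u β := by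
        intro c'
        unfold red
        by_cases hcc : c = c'
        · rw [← hcc, hu.2 β, Nat.zero_sub]
        · rw [show colDeg R (fun _ => c) c' {w} u β = 0 by simp [colDeg, hcc], Nat.sub_zero]
      rw [h4, h4]
      omega)
  have := (good_singleton (γ := fun _ => c) hR hb).union hγ
  rw [← Finset.insert_eq, Finset.insert_erase hw] at this
  exact h.not_good _ this

theorem Crit.game (hR : IsArcRel R) (hmem : ∀ b u v, R b u v → u ∈ S ∧ v ∈ S)
    (h : Crit R f S) (hbi : ∀ x ∈ S, Conn R (S.erase x))
    (hpos : ∀ c, ∀ x ∈ S, ∃ b, f c x b ≠ 0) :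
    Game R S fun x γ => x ∈ S ∧ Good R f (S.erase x) γ where
  rel := hR
  mem := hmem
  sconn := h.conn
  conn := by
    intro x u hu v hv hux hvx
    by_cases hx : x ∈ S
    · refine Relation.ReflTransGen.mono (fun p q hpq => ?_) _ _ ((hbi x hx).2 u
        (Finset.mem_erase.2 ⟨hux, hu⟩) v (Finset.mem_erase.2 ⟨hvx, hv⟩))
      exact ⟨Finset.ne_of_mem_erase hpq.1, Finset.ne_of_mem_erase hpq.2.1, hpq.2.2⟩
    · refine Relation.ReflTransGen.mono (fun p q hpq => ?_) _ _ (h.conn.2 u hu v hv)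
      exact ⟨fun he => hx (he ▸ hpq.1), fun he => hx (he ▸ hpq.2.1), hpq.2.2⟩
  shift := by
    rintro x y γ ⟨hx, hγ⟩ hxy
    have hy : y ∈ S := (hmem _ _ _ hxy.choose_spec).2
    exact ⟨hy, h.shift hR hx hy hγ hxy⟩
  count := by
    rintro x γ γ' ⟨hx, hγ⟩ ⟨-, hγ'⟩ c b
    rw [h.colDeg_eq hR hx hγ, h.colDeg_eq hR hx hγ']
  nbr := by
    rintro x γ ⟨hx, hγ⟩ c
    obtain ⟨b, hb⟩ := hpos c x hx
    rw [← h.colDeg_eq hR hx hγ] at hb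
    obtain ⟨u, hu⟩ := Finset.card_pos.1 (Nat.pos_of_ne_zero hb)
    rw [Finset.mem_filter] at hu
    exact ⟨u, ⟨b, hu.2.1⟩, hu.2.2⟩

/-- The structure of biconnected critical pairs. -/
theorem Crit.mono_or_cycle_or_complete (hR : IsArcRel R)
    (hmem : ∀ b u v, R b u v → u ∈ S ∧ v ∈ S) (h : Crit R f S)
    (hbi : ∀ x ∈ S, Conn R (S.erase x)) :
    (∃ c, ∀ v ∈ S, ∀ b, f c v b = 0) ∨
    (Odd S.card ∧ ∀ v ∈ S, (∀ c b, f c v b = 1) ∧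
      ∃ a b, a ≠ b ∧ ∀ β u, R β u v ↔ u = a ∨ u = b) ∨
    ((∀ u ∈ S, ∀ v ∈ S, u ≠ v → ∀ β, R β u v) ∧
      ∀ c, ∀ u ∈ S, ∀ v ∈ S, ∀ β β', f c u β = f c v β') := by
  by_cases hpos : ∀ c, ∀ x ∈ S, ∃ b, f c x b ≠ 0
  · right
    have G := h.game hR hmem hbi hpos
    obtain ⟨x, hx⟩ := h.conn.1
    obtain ⟨γ, hγ⟩ := exists_good_erase hR h.conn hx fun v hv _ => h.valid v hv
    refine (G.cycle_or_complete ⟨hx, hγ⟩).imp (And.imp_right fun hcyc v hv => ?_) fun hcom =>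
      ⟨hcom, ?_⟩
    · obtain ⟨γ', a, b, hab, hcfg, hne, hrel⟩ := hcyc v hv
      refine ⟨fun c β => ?_, a, b, hab, hrel⟩
      rw [← h.colDeg_eq hR hv hcfg.2]
      have haS := (hmem _ _ _ ((hrel β a).2 (Or.inl rfl))).1
      have hbS := (hmem _ _ _ ((hrel β b).2 (Or.inr rfl))).1
      refine Finset.card_eq_one.2 ?_
      by_cases hac : γ' a = c
      · refine ⟨a, ?_⟩
        ext u
        simp only [Finset.mem_filter, Finset.mem_singleton, hrel]
        constructor
        · rintro ⟨-, rfl | rfl, hu⟩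
          · rfl
          · exact absurd (hac.trans hu.symm) hne
        · rintro rfl
          exact ⟨haS, Or.inl rfl, hac⟩
      · refine ⟨b, ?_⟩
        ext u
        simp only [Finset.mem_filter, Finset.mem_singleton, hrel]
        constructor
        · rintro ⟨-, rfl | rfl, hu⟩
          · exact absurd hu hac
          · rfl
        · rintro rfl
          exact ⟨hbS, Or.inr rfl, fin_two_eq_of_ne hne.symm (Ne.symm hac)⟩
    · have hcol : ∀ δ v, v ∈ S → Good R f (S.erase v) δ → ∀ c β,
          f c v β = ((S.erase v).filter fun u => δ u = c).card := by
        intro δ v hv hδ c β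
        rw [← h.colDeg_eq hR hv hδ]
        unfold colDeg
        congr 1
        ext u
        simp only [Finset.mem_filter, Finset.mem_erase]
        constructor
        · rintro ⟨hu, huv, huc⟩
          exact ⟨⟨hR.adj_ne ⟨β, huv⟩, hu⟩, huc⟩
        · rintro ⟨⟨huv, hu⟩, huc⟩
          exact ⟨hu, hcom u hu v hv huv β, huc⟩
      have hfx : ∀ c, ∀ v ∈ S, ∀ β β', f c v β = f c x β' := by
        intro c v hv β β'
        rw [hcol γ x hx hγ]
        by_cases hvx : x = v
        · rw [← hvx, hcol γ x hx hγ]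
        · rw [hcol _ v hv (h.shift hR hx hv hγ ⟨true, hcom x hx v hv hvx true⟩)]
          refine Finset.card_equiv (Equiv.swap x v) fun u => ?_
          simp only [Finset.mem_filter, Finset.mem_erase, Function.comp_apply]
          refine and_congr_left fun _ => ?_
          rw [Ne, Ne, Equiv.swap_apply_eq_iff, Equiv.swap_apply_left]
          refine and_congr_right fun huv => ?_
          by_cases hux : u = x
          · subst hux
            simp [hx, hv]
          · rw [Equiv.swap_apply_of_ne_of_ne hux huv]
      intro c u hu v hv β β'
      rw [hfx c u hu β true, hfx c v hv β' true]
  · push Not at hpos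
    obtain ⟨c, x, hx, hfx⟩ := hpos
    exact Or.inl ⟨c, h.eq_zero hR hbi hx hfx⟩

theorem conn_of_separated (hR : IsArcRel R) (hS : Conn R S) (hTS : T ⊆ S) {x : ℕ} (hx : x ∈ T)
    (hsep : ∀ u ∈ T, u ≠ x → ∀ w ∈ S, w ∉ T → ¬ Adj R u w) : Conn R T := by
  have hreach : ∀ v ∈ T, Relation.ReflTransGen (fun p q => p ∈ T ∧ q ∈ T ∧ Adj R p q) x v := by
    by_contra! hcon
    obtain ⟨v, hv, hxv⟩ := hcon
    obtain ⟨u, hu, w, hw, hwU, huw⟩ := hS.exists_adj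
      (T := T.filter fun v => ¬ Relation.ReflTransGen (fun p q => p ∈ T ∧ q ∈ T ∧ Adj R p q) x v)
      ((Finset.filter_subset _ _).trans hTS) ⟨v, Finset.mem_filter.2 ⟨hv, hxv⟩⟩ (by
        intro he
        have hxS := hTS hx
        rw [← he, Finset.mem_filter] at hxS
        exact hxS.2 .refl)
    rw [Finset.mem_filter] at hu hwU
    by_cases hwT : w ∈ T
    · have hxw : Relation.ReflTransGen (fun p q => p ∈ T ∧ q ∈ T ∧ Adj R p q) x w := by
        by_contra hxw
        exact hwU ⟨hwT, hxw⟩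
      exact hu.2 (hxw.tail ⟨hwT, hu.1, hR.adj_symm huw⟩)
    · exact hsep u hu.1 (fun he => hu.2 (he ▸ .refl)) w hw hwT huw
  have hsymm : Std.Symm (fun p q => p ∈ T ∧ q ∈ T ∧ Adj R p q) :=
    ⟨fun p q h => ⟨h.2.1, h.1, hR.adj_symm h.2.2⟩⟩
  exact ⟨⟨x, hx⟩, fun u hu v hv =>
    (Relation.ReflTransGen.stdSymm.symm _ _ (hreach u hu)).trans (hreach v hv)⟩

/-- A cut-vertex `x` splits a critical pair into two critical pairs. -/
theorem Crit.exists_split (hR : IsArcRel R) (h : Crit R f S) {x : ℕ} (hx : x ∈ S)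
    (hne : S ≠ {x}) (hcut : ¬ Conn R (S.erase x)) :
    ∃ (S₁ S₂ : Finset ℕ) (f₁ f₂ : Fin 2 → ℕ → Bool → ℕ), S₁ ∩ S₂ = {x} ∧ S = S₁ ∪ S₂ ∧
      S₁ ⊂ S ∧ S₂ ⊂ S ∧ (∀ u ∈ S₁, ∀ v ∈ S₂, Adj R u v → u = x ∨ v = x) ∧
      Crit R f₁ S₁ ∧ Crit R f₂ S₂ ∧ (∀ c, ∀ v ∈ S₁, v ≠ x → ∀ b, f c v b = f₁ c v b) ∧
      (∀ c, ∀ v ∈ S₂, v ≠ x → ∀ b, f c v b = f₂ c v b) ∧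
      ∀ c b, f c x b = f₁ c x b + f₂ c x b := by
  have hnonempty : (S.erase x).Nonempty := by
    rw [Finset.nonempty_iff_ne_empty]
    intro he
    exact hne (((Finset.erase_eq_empty_iff S x).1 he).resolve_left (Finset.ne_empty_of_mem hx))
  obtain ⟨u, hu, v, hv, huv⟩ : ∃ u ∈ S.erase x, ∃ v ∈ S.erase x, ¬ Relation.ReflTransGen
      (fun p q => p ∈ S.erase x ∧ q ∈ S.erase x ∧ Adj R p q) u v := by
    by_contra! hcon
    exact hcut ⟨hnonempty, hcon⟩
  obtain ⟨C, hCx, huC, hvC, hsep⟩ : ∃ C ⊆ S.erase x, u ∈ C ∧ v ∉ C ∧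
      ∀ p ∈ C, ∀ q ∈ S.erase x, q ∉ C → ¬ Adj R p q := by
    refine ⟨(S.erase x).filter fun w => Relation.ReflTransGen
      (fun p q => p ∈ S.erase x ∧ q ∈ S.erase x ∧ Adj R p q) u w, Finset.filter_subset _ _,
      Finset.mem_filter.2 ⟨hu, .refl⟩, fun hvC => huv (Finset.mem_filter.1 hvC).2, ?_⟩
    intro p hp q hq hqC hpq
    rw [Finset.mem_filter] at hp hqC
    exact hqC ⟨hq, hp.2.tail ⟨hp.1, hq, hpq⟩⟩
  have hCS : C ⊆ S := hCx.trans (Finset.erase_subset _ _)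
  have hxC : x ∉ C := fun hxC => Finset.ne_of_mem_erase (hCx hxC) rfl
  have hS₁ : insert x C ⊆ S := Finset.insert_subset hx hCS
  have hx₂ : x ∈ S \ C := Finset.mem_sdiff.2 ⟨hx, hxC⟩
  have he₁ : (insert x C).erase x = C := Finset.erase_insert hxC
  have hconn₁ : Conn R (insert x C) := by
    refine conn_of_separated hR h.conn hS₁ (Finset.mem_insert_self x C) ?_
    intro p hp hpx q hq hqC
    rw [Finset.mem_insert, not_or] at hqC
    exact hsep p ((Finset.mem_insert.1 hp).resolve_left hpx) q (Finset.mem_erase.2 ⟨hqC.1, hq⟩)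
      hqC.2
  have hconn₂ : Conn R (S \ C) := by
    refine conn_of_separated hR h.conn Finset.sdiff_subset hx₂ ?_
    intro p hp hpx q hq hqC hpq
    rw [Finset.mem_sdiff] at hp hqC
    have hqC' : q ∈ C := by
      by_contra hcon
      exact hqC ⟨hq, hcon⟩
    exact hsep q hqC' p (Finset.mem_erase.2 ⟨hpx, hp.1⟩) hp.2 (hR.adj_symm hpq)
  have hdeg : ∀ w b, deg R S w b = deg R C w b + deg R (S \ C) w b := fun w b => by
    rw [← deg_union Finset.disjoint_sdiff, Finset.union_sdiff_of_subset hCS]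
  obtain ⟨γ₁, hγ₁⟩ := exists_good_erase (f := f) hR hconn₁ (Finset.mem_insert_self x C)
    fun w hw _ b => (deg_mono hS₁ w b).trans (h.valid w (hS₁ hw) b)
  rw [he₁] at hγ₁
  have hcrit₂ : Crit R (red R f C γ₁) (S \ C) := by
    refine ⟨hconn₂, fun w hw b => ?_, fun δ hδ => ?_⟩
    · have h1 := h.valid w (Finset.mem_sdiff.1 hw).1 b
      have h2 := hdeg w b
      have h3 := colDeg_zero_add_one (R := R) γ₁ C w b
      unfold red
      omega
    · have := hγ₁.union hδ
      rw [Finset.union_sdiff_of_subset hCS] at this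
      exact h.not_good _ this
  have hle : ∀ c b, colDeg R γ₁ c C x b ≤ f c x b := by
    intro c b
    have h1 := hcrit₂.sum_eq hR hx₂ b
    have h2 := h.sum_eq hR hx b
    have h3 := hdeg x b
    have h4 := colDeg_zero_add_one (R := R) γ₁ C x b
    unfold red at h1
    rcases Fin.exists_fin_two.1 ⟨c, rfl⟩ with rfl | rfl <;> omega
  have hcrit₁ : Crit R (fun c w b => if w = x then colDeg R γ₁ c C x b else f c w b)
      (insert x C) := by
    refine ⟨hconn₁, fun w hw b => ?_, fun δ hδ => ?_⟩
    · by_cases hwx : w = x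
      · simp only [hwx, if_true]
        rw [colDeg_zero_add_one, ← deg_erase_self hR, he₁]
      · simp only [hwx, if_false]
        exact (deg_mono hS₁ w b).trans (h.valid w (hS₁ hw) b)
    · obtain ⟨γ₂, hγ₂⟩ := exists_good_erase hR hconn₂ hx₂ fun w hw _ b => hcrit₂.valid w hw b
      have hcol := fun c b => hcrit₂.colDeg_eq hR hx₂ hγ₂ c b
      have hγ₂' : Good R f ((S \ C).erase x) γ₂ :=
        hγ₂.congr (fun _ _ => rfl) fun _ _ _ _ => Nat.sub_le _ _
      have hδ' : Good R (red R f ((S \ C).erase x) γ₂) (insert x C) δ := by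
        refine hδ.congr (fun _ _ => rfl) fun c w hw b => ?_
        by_cases hwx : w = x
        · subst hwx
          have h1 := hcol c b
          have h2 := hle c b
          simp only [if_true]
          unfold red at h1 ⊢
          rw [colDeg_erase_self hR, h1]
          omega
        · have hwC := (Finset.mem_insert.1 hw).resolve_left hwx
          simp only [hwx, if_false]
          unfold red
          rw [colDeg_eq_zero, Nat.sub_zero]
          intro q hq hqw
          rw [Finset.mem_erase, Finset.mem_sdiff] at hq
          exact hsep w hwC q (Finset.mem_erase.2 ⟨hq.1, hq.2.1⟩) hq.2.2 (hR.adj_symm hqw)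
      have := hγ₂'.union hδ'
      have hunion : (S \ C).erase x ∪ insert x C = S := by
        rw [Finset.union_insert, ← Finset.insert_union, Finset.insert_erase hx₂,
          Finset.sdiff_union_of_subset hCS]
      rw [hunion] at this
      exact h.not_good _ this
  refine ⟨insert x C, S \ C, _, _, ?_, ?_, ?_, ?_, ?_, hcrit₁, hcrit₂, ?_, ?_, ?_⟩
  · rw [Finset.insert_inter_of_mem hx₂, Finset.inter_sdiff_self, insert_empty_eq]
  · rw [Finset.insert_union, Finset.union_sdiff_of_subset hCS, Finset.insert_eq_of_mem hx]
  · refine ⟨hS₁, fun hcon => ?_⟩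
    rw [Finset.mem_erase] at hv
    exact (Finset.mem_insert.1 (hcon hv.2)).elim hv.1 hvC
  · refine ⟨Finset.sdiff_subset, fun hcon => ?_⟩
    exact (Finset.mem_sdiff.1 (hcon (hCS huC))).2 huC
  · intro p hp q hq hpq
    rw [Finset.mem_sdiff] at hq
    by_contra! hcon
    exact hsep p ((Finset.mem_insert.1 hp).resolve_left hcon.1) q
      (Finset.mem_erase.2 ⟨hcon.2, hq.1⟩) hq.2 hpq
  · intro c w hw hwx b
    simp only [hwx, if_false]
  · intro c w hw hwx b
    unfold red
    rw [colDeg_eq_zero, Nat.sub_zero]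
    intro q hq hqw
    rw [Finset.mem_sdiff] at hw
    exact hsep q hq w (Finset.mem_erase.2 ⟨hwx, hw.1⟩) hw.2 hqw
  · intro c b
    have := hle c b
    simp only [if_true]
    unfold red
    omega

theorem deg_congr {R' : Bool → ℕ → ℕ → Prop} (hR' : ∀ b, ∀ u ∈ S, ∀ v ∈ S, R b u v ↔ R' b u v)
    (hTS : T ⊆ S) {v : ℕ} (hv : v ∈ S) (b : Bool) : deg R T v b = deg R' T v b := by
  unfold deg
  congr 1
  ext u
  simp only [Finset.mem_filter]
  exact and_congr_right fun hu => hR' b u (hTS hu) v hv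

theorem Crit.congr_rel {R' : Bool → ℕ → ℕ → Prop} (h : Crit R f S)
    (hR' : ∀ b, ∀ u ∈ S, ∀ v ∈ S, R b u v ↔ R' b u v) : Crit R' f S where
  conn := ⟨h.conn.1, fun u hu v hv => Relation.ReflTransGen.mono (fun p q hpq =>
    ⟨hpq.1, hpq.2.1, hpq.2.2.imp fun b hb => (hR' b p hpq.1 q hpq.2.1).1 hb⟩) _ _
    (h.conn.2 u hu v hv)⟩
  valid := fun v hv b => by
    rw [← deg_congr hR' subset_rfl hv]
    exact h.valid v hv b
  not_good := fun γ hγ => h.not_good γ fun c U hU hne hc => by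
    obtain ⟨v, hv, b, hb⟩ := hγ c U hU hne hc
    exact ⟨v, hv, b, by rwa [deg_congr hR' hU (hU hv)]⟩

/-- The arcs of `D`, as a relation indexed by their direction. -/
def arc (D : Digraph') : Bool → ℕ → ℕ → Prop
  | true, u, v => (u, v) ∈ D.arcs
  | false, u, v => (v, u) ∈ D.arcs

theorem isArcRel_arc (D : Digraph') : IsArcRel (arc D) where
  symm := by rintro (_ | _) u v h <;> exact h
  irrefl := by rintro (_ | _) u h <;> exact D.no_loops _ h rfl

theorem arc_mem (D : Digraph') : ∀ b u v, arc D b u v → u ∈ D.verts ∧ v ∈ D.verts := by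
  rintro (_ | _) u v h
  · exact ⟨D.mem_snd _ h, D.mem_fst _ h⟩
  · exact ⟨D.mem_fst _ h, D.mem_snd _ h⟩

theorem inDeg_eq_deg (D : Digraph') (v : ℕ) : D.inDeg v = deg (arc D) D.verts v true := by
  unfold Digraph'.inDeg deg
  rw [← Finset.card_image_of_injective (D.verts.filter fun u => arc D true u v)
    (Prod.mk_left_injective v)]
  congr 1
  ext ⟨p, q⟩
  simp only [Finset.mem_filter, Finset.mem_image, Prod.mk.injEq]
  constructor
  · rintro ⟨h, rfl⟩
    exact ⟨p, ⟨D.mem_fst _ h, h⟩, rfl, rfl⟩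
  · rintro ⟨u, ⟨-, h⟩, rfl, rfl⟩
    exact ⟨h, rfl⟩

theorem outDeg_eq_deg (D : Digraph') (v : ℕ) : D.outDeg v = deg (arc D) D.verts v false := by
  unfold Digraph'.outDeg deg
  rw [← Finset.card_image_of_injective (D.verts.filter fun u => arc D false u v)
    (Prod.mk_right_injective v)]
  congr 1
  ext ⟨p, q⟩
  simp only [Finset.mem_filter, Finset.mem_image, Prod.mk.injEq]
  constructor
  · rintro ⟨h, rfl⟩
    exact ⟨q, ⟨D.mem_snd _ h, h⟩, rfl, rfl⟩
  · rintro ⟨u, ⟨-, h⟩, rfl, rfl⟩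
    exact ⟨h, rfl⟩

theorem ugAdj_iff (D : Digraph') (u v : ℕ) :
    D.ugAdj u v ↔ u ∈ D.verts ∧ v ∈ D.verts ∧ Adj (arc D) u v := by
  unfold Digraph'.ugAdj Adj
  rw [Bool.exists_bool]
  simp only [arc]
  tauto

theorem connected_iff_conn (D : Digraph') : D.Connected ↔ Conn (arc D) D.verts := by
  have : D.ugAdj = fun p q => p ∈ D.verts ∧ q ∈ D.verts ∧ Adj (arc D) p q := by
    ext p q
    exact ugAdj_iff D p q
  unfold Digraph'.Connected Conn
  rw [this]

theorem arc_induce (D : Digraph') (S : Finset ℕ) (b : Bool) {u v : ℕ} (hu : u ∈ S) (hv : v ∈ S) :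
    arc D b u v ↔ arc (D.induce S) b u v := by
  cases b <;> simp [arc, Digraph'.induce, hu, hv]

theorem verts_induce {D : Digraph'} (hS : S ⊆ D.verts) : (D.induce S).verts = S :=
  Finset.inter_eq_right.2 hS

theorem connected_induce {D : Digraph'} (hS : S ⊆ D.verts) (h : Conn (arc D) S) :
    (D.induce S).Connected := by
  rw [connected_iff_conn, verts_induce hS]
  refine ⟨h.1, fun u hu v hv => Relation.ReflTransGen.mono (fun p q hpq => ?_) _ _
    (h.2 u hu v hv)⟩
  exact ⟨hpq.1, hpq.2.1, hpq.2.2.imp fun b hb => (arc_induce D S b hpq.1 hpq.2.1).1 hb⟩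

theorem crit_induce {D : Digraph'} (hS : S ⊆ D.verts) (h : Crit (arc D) f S) :
    Crit (arc (D.induce S)) f (D.induce S).verts := by
  rw [verts_induce hS]
  exact h.congr_rel fun b u hu v hv => arc_induce D S b hu hv

/-- The budgets of a pair, written as functions to `ℕ × ℕ`. -/
def toPair (f : Fin 2 → ℕ → Bool → ℕ) : Fin 2 → ℕ → ℕ × ℕ := fun c v => (f c v true, f c v false)

theorem mem_ugNbrs (D : Digraph') (u v : ℕ) : u ∈ D.ugNbrs v ↔ Adj (arc D) u v := by
  unfold Adj
  rw [Bool.exists_bool]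
  simp [Digraph'.ugNbrs, Digraph'.inNbrs, Digraph'.outNbrs, arc, or_comm]

theorem isHardPair_of_biconnected {D : Digraph'} (h : Crit (arc D) f D.verts)
    (hbi : ∀ x ∈ D.verts, Conn (arc D) (D.verts.erase x)) : IsHardPair 2 D (toPair f) := by
  have hR := isArcRel_arc D
  have hD := (connected_iff_conn D).2 h.conn
  rcases h.mono_or_cycle_or_complete hR (arc_mem D) hbi with
    ⟨c, hc⟩ | ⟨hodd, hcyc⟩ | ⟨hcom, hconst⟩
  · have hsum : ∀ v ∈ D.verts, ∀ b, f (c + 1) v b = deg (arc D) D.verts v b := by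
      intro v hv b
      rw [← h.sum_eq hR hv b]
      have := hc v hv b
      rcases Fin.exists_fin_two.1 ⟨c, rfl⟩ with rfl | rfl
      · simp [this]
      · simp [this]
    refine IsHardPair.mono (c + 1) ⟨?_, hD, fun x hx => ?_⟩ (fun v hv => ?_) fun k hk v hv => ?_
    · obtain ⟨x, hx⟩ := h.conn.1
      have := Finset.card_pos.2 (hbi x hx).1
      rw [Finset.card_erase_of_mem hx] at this
      omega
    · unfold Digraph'.del
      rw [Finset.sdiff_singleton_eq_erase]
      exact connected_induce (Finset.erase_subset _ _) (hbi x hx)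
    · rw [inDeg_eq_deg, outDeg_eq_deg, ← hsum v hv, ← hsum v hv]
      rfl
    · have hkc : k = c := fin_two_eq_of_ne hk (by omega)
      simp [toPair, hkc, hc v hv]
  · refine IsHardPair.bicycle 0 1 (by decide) ⟨?_, ⟨hD, fun v hv => ?_⟩, hodd⟩
      (fun v hv => ?_) (fun v hv => ?_) (fun k hk₀ hk₁ => ?_)
    · rintro ⟨p, q⟩ hpq
      obtain ⟨-, a, b, -, hrel⟩ := hcyc q (D.mem_snd _ hpq)
      exact (hrel false p).2 ((hrel true p).1 hpq)
    · obtain ⟨-, a, b, hab, hrel⟩ := hcyc v hv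
      rw [← Finset.card_pair hab]
      congr 1
      ext u
      rw [mem_ugNbrs]
      simp [Adj, hrel]
    · simp [toPair, (hcyc v hv).1]
    · simp [toPair, (hcyc v hv).1]
    · exact absurd (Fin.exists_fin_two.1 ⟨k, rfl⟩) (by tauto)
  · refine IsHardPair.complete (fun u hu v hv huv => hcom u hu v hv huv true)
      (fun k u hu v hv => ?_) (fun k v hv => hconst k v hv v hv true false) fun v hv => ?_
    · exact Prod.ext (hconst k u hu v hv _ _) (hconst k u hu v hv _ _)
    · rw [Fin.sum_univ_two]
      refine (h.sum_eq hR hv false).trans ?_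
      rw [← Finset.card_erase_of_mem hv]
      unfold deg
      congr 1
      ext u
      simp only [Finset.mem_filter, Finset.mem_erase]
      constructor
      · rintro ⟨hu, huv⟩
        exact ⟨hR.adj_ne ⟨_, huv⟩, hu⟩
      · rintro ⟨huv, hu⟩
        exact ⟨hu, hcom u hu v hv huv false⟩

theorem isHardPair_of_crit : ∀ (n : ℕ) (D : Digraph') (f : Fin 2 → ℕ → Bool → ℕ),
    D.verts.card = n → Crit (arc D) f D.verts → IsHardPair 2 D (toPair f) := by
  intro n
  induction n using Nat.strong_induction_on with
  | _ n ih =>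
    intro D f hn h
    have hR := isArcRel_arc D
    by_cases hone : ∃ x, D.verts = {x}
    · obtain ⟨x, hx⟩ := hone
      have hzero : ∀ c, ∀ v ∈ D.verts, ∀ b, f c v b = 0 := by
        intro c v hv b
        have h1 := h.sum_eq hR hv b
        have h2 : deg (arc D) D.verts v b = 0 := by
          rw [hx, Finset.mem_singleton] at hv
          rw [← deg_erase_self hR, hx, hv]
          simp [deg]
        rcases Fin.exists_fin_two.1 ⟨c, rfl⟩ with rfl | rfl <;> omega
      refine IsHardPair.complete (fun u hu v hv huv => ?_) (fun k u hu v hv => ?_)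
        (fun k v hv => ?_) fun v hv => ?_
      · rw [hx, Finset.mem_singleton] at hu hv
        exact absurd (hu.trans hv.symm) huv
      · simp [toPair, hzero k u hu, hzero k v hv]
      · simp [toPair, hzero k v hv]
      · simp [toPair, hzero _ v hv, hx]
    by_cases hbi : ∀ x ∈ D.verts, Conn (arc D) (D.verts.erase x)
    · exact isHardPair_of_biconnected h hbi
    · push Not at hbi
      obtain ⟨x, hx, hcut⟩ := hbi
      obtain ⟨S₁, S₂, f₁, f₂, hinter, hunion, hS₁, hS₂, hsep, h₁, h₂, hf₁, hf₂, hfx⟩ :=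
        h.exists_split hR hx (fun he => hone ⟨x, he⟩) hcut
      have hcard : ∀ {S'}, S' ⊂ D.verts → (D.induce S').verts.card < n := fun hS' => by
        rw [verts_induce hS'.1, ← hn]
        exact Finset.card_lt_card hS'
      refine IsHardPair.join (D.induce S₁) (D.induce S₂) (toPair f₁) (toPair f₂) x
        (ih _ (hcard hS₁) _ _ rfl (crit_induce hS₁.1 h₁))
        (ih _ (hcard hS₂) _ _ rfl (crit_induce hS₂.1 h₂)) ?_ ?_ ?_ ?_ ?_ ?_
      · rw [verts_induce hS₁.1, verts_induce hS₂.1, hinter]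
      · rw [verts_induce hS₁.1, verts_induce hS₂.1, hunion]
      · have hx₁ : x ∈ S₁ ∩ S₂ := by simp [hinter]
        rw [Finset.mem_inter] at hx₁
        ext ⟨p, q⟩
        simp only [Digraph'.induce, Finset.mem_union, Finset.mem_filter]
        constructor
        · intro hpq
          have hp := D.mem_fst _ hpq
          have hq := D.mem_snd _ hpq
          simp only [hunion, Finset.mem_union] at hp hq
          have h3 : p ∈ S₁ → q ∈ S₂ → p = x ∨ q = x := fun hp hq => hsep p hp q hq ⟨true, hpq⟩
          have h4 : q ∈ S₁ → p ∈ S₂ → q = x ∨ p = x := fun hq hp => hsep q hq p hp ⟨false, hpq⟩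
          grind
        · tauto
      · intro k v hv hvx
        rw [verts_induce hS₁.1] at hv
        simp [toPair, hf₁ k v hv hvx]
      · intro k v hv hvx
        rw [verts_induce hS₂.1] at hv
        simp [toPair, hf₂ k v hv hvx]
      · intro k
        simp [toPair, hfx]

theorem isDicolouring_of_good {D : Digraph'} {γ : ℕ → Fin 2} (h : Good (arc D) f D.verts γ) :
    D.IsDicolouring 2 (toPair f) γ := by
  intro c H hH hne
  have hsub : H.verts ⊆ D.verts := hH.1.trans Finset.inter_subset_left
  have hdeg : ∀ v b, deg (arc H) H.verts v b ≤ deg (arc D) H.verts v b := by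
    intro v b
    refine Finset.card_le_card fun u hu => ?_
    rw [Finset.mem_filter] at hu ⊢
    refine ⟨hu.1, ?_⟩
    cases b
    · exact (Finset.mem_filter.1 (hH.2 hu.2)).1
    · exact (Finset.mem_filter.1 (hH.2 hu.2)).1
  obtain ⟨v, hv, b, hb⟩ := h c H.verts hsub hne fun v hv =>
    (Finset.mem_filter.1 (Finset.mem_inter.1 (hH.1 hv)).2).2
  refine ⟨v, hv, ?_⟩
  rw [inDeg_eq_deg, outDeg_eq_deg]
  cases b
  · exact Or.inr ((hdeg v false).trans_lt hb)
  · exact Or.inl ((hdeg v true).trans_lt hb)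

end DegenerateColouring

open DegenerateColouring in
/-- **Lemma (two-colour case).** Let `(D,F=(f₁,f₂))` be a valid pair that is not a hard pair.
Then `D` is `F`-dicolourable. -/
theorem two_colour_nonhard_dicolourable
    (D : Digraph') (F : Fin 2 → ℕ → ℕ × ℕ)
    (hvalid : D.ValidPair 2 F) (hnothard : ¬ IsHardPair 2 D F) :
    D.Dicolourable 2 F := by
  by_contra hcon
  obtain ⟨f, rfl⟩ : ∃ f, F = toPair f :=
    ⟨fun c v b => cond b (F c v).1 (F c v).2, rfl⟩
  refine hnothard (isHardPair_of_crit _ D f rfl ⟨(connected_iff_conn D).1 hvalid.1,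
    fun v hv b => ?_, fun γ hγ => hcon ⟨γ, isDicolouring_of_good hγ⟩⟩)
  have h := hvalid.2 v hv
  rw [Fin.sum_univ_two, Fin.sum_univ_two, inDeg_eq_deg, outDeg_eq_deg] at h
  cases b
  · exact h.2
  · exact h.1
end
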